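/- arXiv:2107.10594 — 3 statements merged into one kernel-verified Lean document; each statement's English description precedes it below -/
import Mathlib

section
/- Let c₀ > 1. There exist ν₀ ∈ (0,1], c > 0 and C > 1, depending only on c₀, with the following property: for every ν with 0 < ν < ν₀, every real α with |α| ≥ c₀, and every rapidly decaying solution θ of the subcritical QG mode system with viscosity ν at wave number α, one has Σ_β |θ(t,β)|² ≤ C² e^{−2c ν^{3/7} t} Σ_β |θ(0,β)|² for all 0 ≤ t ≤ C^{−1} ν^{−1}. -/
/-- `S(β) = (α² + β²)^{1/2}`. -/
noncomputable def Sv (α : ℝ) (β : ℤ) : ℝ := Real.sqrt (α ^ 2 + (β : ℝ) ^ 2)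

/-- A family `θ : ℝ → ℤ → ℂ` is rapidly decaying if for every `k ∈ ℕ` and `T > 0`,
`sup_{0 ≤ t ≤ T} Σ_β (1+β²)^k |θ(t,β)|² < ∞`. -/
def RapidlyDecaying (θ : ℝ → ℤ → ℂ) : Prop :=
  ∀ k : ℕ, ∀ T : ℝ, 0 < T → ∃ M : ℝ, ∀ t : ℝ, 0 ≤ t → t ≤ T →
    Summable (fun β : ℤ => (1 + (β : ℝ) ^ 2) ^ k * ‖θ t β‖ ^ 2) ∧
    (∑' β : ℤ, (1 + (β : ℝ) ^ 2) ^ k * ‖θ t β‖ ^ 2) ≤ M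

/-- The subcritical QG mode system with viscosity `ν` at wave number `α`:
`d/dt θ(t,β) = −ν (α²+β²) θ(t,β) − (i α e^{−νt}/2)[(1 − S(β−1)⁻¹) θ(t,β−1) + (1 − S(β+1)⁻¹) θ(t,β+1)]`. -/
def SubcriticalQG (α ν : ℝ) (θ : ℝ → ℤ → ℂ) : Prop :=
  ∀ t : ℝ, ∀ β : ℤ,
    HasDerivAt (fun s => θ s β)
      (-((ν * (α ^ 2 + (β : ℝ) ^ 2) : ℝ) : ℂ) * θ t β
        - Complex.I * (α : ℂ) * ((Real.exp (-(ν * t)) : ℝ) : ℂ) / 2 *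
          ((1 - ((Sv α (β - 1) : ℝ) : ℂ)⁻¹) * θ t (β - 1)
            + (1 - ((Sv α (β + 1) : ℝ) : ℂ)⁻¹) * θ t (β + 1))) t


def RD {E : Type*} [NormedAddCommGroup E] (x : ℤ → E) : Prop :=
  ∀ k : ℕ, ∃ C : ℝ, ∀ β : ℤ, (1 + (β : ℝ) ^ 2) ^ k * ‖x β‖ ≤ C

section RDs
variable {E F : Type*} [NormedAddCommGroup E] [NormedAddCommGroup F]

lemma RD.of_le {x : ℤ → E} (hx : RD x) {y : ℤ → F} (K : ℝ) (m : ℕ)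
    (h : ∀ β : ℤ, ‖y β‖ ≤ K * (1 + (β : ℝ) ^ 2) ^ m * ‖x β‖) : RD y := by
  intro k
  obtain ⟨C, hC⟩ := hx (k + m)
  refine ⟨|K| * C, fun β => ?_⟩
  have h1 : (0:ℝ) ≤ (1 + (β : ℝ) ^ 2) ^ k := by positivity
  have h2 : (0:ℝ) ≤ (1 + (β : ℝ) ^ 2) ^ m := by positivity
  calc (1 + (β : ℝ) ^ 2) ^ k * ‖y β‖ ≤ (1 + (β : ℝ) ^ 2) ^ k * (K * (1 + (β : ℝ) ^ 2) ^ m * ‖x β‖) :=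
        mul_le_mul_of_nonneg_left (h β) h1
    _ = K * ((1 + (β : ℝ) ^ 2) ^ (k + m) * ‖x β‖) := by rw [pow_add]; ring
    _ ≤ |K| * ((1 + (β : ℝ) ^ 2) ^ (k + m) * ‖x β‖) := by
        gcongr; exact le_abs_self K
    _ ≤ |K| * C := by gcongr; exact hC β

lemma RD.add {x y : ℤ → E} (hx : RD x) (hy : RD y) : RD (fun β => x β + y β) := by
  intro k
  obtain ⟨C, hC⟩ := hx k
  obtain ⟨D, hD⟩ := hy k
  refine ⟨C + D, fun β => ?_⟩
  calc _ ≤ (1 + (β : ℝ) ^ 2) ^ k * (‖x β‖ + ‖y β‖) := by gcongr; exact norm_add_le _ _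
    _ ≤ _ := by rw [mul_add]; exact add_le_add (hC β) (hD β)

lemma RD.neg {x : ℤ → E} (hx : RD x) : RD (fun β => -x β) := by
  intro k; simpa using hx k

lemma RD.sub {x y : ℤ → E} (hx : RD x) (hy : RD y) : RD (fun β => x β - y β) := by
  simpa [sub_eq_add_neg] using hx.add hy.neg

lemma RD.shift {x : ℤ → E} (hx : RD x) (n : ℤ) : RD (fun β => x (β + n)) := by
  intro k
  obtain ⟨C, hC⟩ := hx k
  refine ⟨(2 * (1 + (n:ℝ)^2)) ^ k * C, fun β => ?_⟩
  have h1 : (1 + (β : ℝ) ^ 2) ≤ (2 * (1 + (n:ℝ)^2)) * (1 + ((β + n : ℤ) : ℝ) ^ 2) := by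
    push_cast
    nlinarith [sq_nonneg ((β:ℝ) + 2 * n), sq_nonneg ((n:ℝ) * (β + n)), sq_nonneg (n:ℝ)]
  calc _ ≤ ((2 * (1 + (n:ℝ)^2)) * (1 + ((β + n : ℤ) : ℝ) ^ 2)) ^ k * ‖x (β + n)‖ := by gcongr
    _ = (2 * (1 + (n:ℝ)^2)) ^ k * ((1 + ((β + n : ℤ) : ℝ) ^ 2) ^ k * ‖x (β + n)‖) := by
        rw [mul_pow]; ring
    _ ≤ _ := by gcongr; exact hC _

lemma summable_inv_one_add_sq : Summable (fun β : ℤ => (1 + (β : ℝ) ^ 2)⁻¹) := by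
  have h : Summable (fun β : ℤ => 1 / (β : ℝ) ^ 2) :=
    Real.summable_one_div_int_pow.mpr (by norm_num)
  have h2 : Summable (fun β : ℤ => 1 / (β : ℝ) ^ 2 + if β = 0 then (1:ℝ) else 0) :=
    h.add (summable_of_ne_finset_zero (s := {0}) (by intro b hb; simp at hb; simp [hb]))
  refine h2.of_nonneg_of_le (fun β => by positivity) (fun β => ?_)
  by_cases hb : β = 0
  · simp [hb]
  · simp only [hb, if_false, add_zero, one_div]
    have : (0:ℝ) < (β:ℝ)^2 := by positivity
    gcongr; linarith

lemma RD.summable [CompleteSpace E] {x : ℤ → E} (hx : RD x) : Summable x := by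
  obtain ⟨C, hC⟩ := hx 1
  refine Summable.of_norm_bounded (summable_inv_one_add_sq.mul_left C) (fun β => ?_)
  have h1 : (0:ℝ) < 1 + (β:ℝ)^2 := by positivity
  have := hC β
  rw [pow_one] at this
  rw [← div_eq_mul_inv, le_div_iff₀ h1]; linarith

lemma RD.bdd {x : ℤ → E} (hx : RD x) : ∃ C : ℝ, 0 ≤ C ∧ ∀ β, ‖x β‖ ≤ C := by
  obtain ⟨C, hC⟩ := hx 0
  simp at hC
  exact ⟨C, (norm_nonneg _).trans (hC 0), hC⟩

/-- product-type control -/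
lemma RD.prod {x : ℤ → E} {y : ℤ → F} (hx : RD x) (hy : RD y) {G : Type*} [NormedAddCommGroup G]
    {f : ℤ → G} (K : ℝ) (m : ℕ)
    (h : ∀ β : ℤ, ‖f β‖ ≤ K * (1 + (β : ℝ) ^ 2) ^ m * (‖x β‖ * ‖y β‖)) : RD f := by
  obtain ⟨C, hC0, hC⟩ := hy.bdd
  refine hx.of_le (|K| * C) m (fun β => (h β).trans ?_)
  have : K * (1 + (β : ℝ) ^ 2) ^ m * (‖x β‖ * ‖y β‖) ≤ |K| * (1 + (β : ℝ) ^ 2) ^ m * (‖x β‖ * C) := by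
    gcongr
    · exact le_abs_self K
    · exact hC β
  linarith
end RDs

lemma tsum_tele {h : ℤ → ℝ} (hh : RD h) : ∑' β, (h (β + 1) - h β) = 0 := by
  have h1 := (hh.shift 1).summable
  rw [h1.tsum_sub hh.summable, sub_eq_zero]
  exact (Equiv.addRight (1:ℤ)).tsum_eq h

lemma tsum_shift (h : ℤ → ℝ) (n : ℤ) : ∑' β, h (β + n) = ∑' β, h β :=
  (Equiv.addRight n).tsum_eq h

lemma tsum_eq_of_tele {u v h : ℤ → ℝ} (hu : RD u) (hv : RD v) (hh : RD h)
    (e : ∀ β, u β - v β = h (β + 1) - h β) : ∑' β, u β = ∑' β, v β := by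
  rw [← sub_eq_zero, ← hu.summable.tsum_sub hv.summable]
  simp_rw [e]; exact tsum_tele hh

/-- Cauchy-Schwarz for nonneg real sequences -/
lemma tsum_cs {u v : ℤ → ℝ} (hu : RD u) (hv : RD v) :
    ∑' β, |u β| * |v β| ≤ Real.sqrt (∑' β, u β ^ 2) * Real.sqrt (∑' β, v β ^ 2) := by
  have h2u : Summable (fun β => |u β| ^ (2:ℝ)) := by
    refine (hu.prod hu (f := fun β => u β ^ 2) 1 0 (by intro β; simp [sq])).summable.congr ?_
    intro β; simp
  have h2v : Summable (fun β => |v β| ^ (2:ℝ)) := by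
    refine (hv.prod hv (f := fun β => v β ^ 2) 1 0 (by intro β; simp [sq])).summable.congr ?_
    intro β; simp
  have := Real.inner_le_Lp_mul_Lq_tsum_of_nonneg (p := 2) (q := 2) (f := fun β => |u β|) (g := fun β => |v β|)
    (by constructor <;> norm_num) (fun _ => abs_nonneg _) (fun _ => abs_nonneg _) h2u h2v
  have h3 := this
  simp only [Real.rpow_two, sq_abs] at h3
  rw [Real.sqrt_eq_rpow, Real.sqrt_eq_rpow]
  exact h3

lemma tsum_abs_le {f u v : ℤ → ℝ} (hu : RD u) (hv : RD v) (h : ∀ β, |f β| ≤ |u β| * |v β|) :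
    |∑' β, f β| ≤ Real.sqrt (∑' β, u β ^ 2) * Real.sqrt (∑' β, v β ^ 2) := by
  have hp : RD (fun β => |u β| * |v β|) := hu.prod hv 1 0 (by intro β; simp)
  have hf : RD f := hp.of_le 1 0 (by
    intro β
    have := h β
    simp only [pow_zero, Real.norm_eq_abs, abs_mul, abs_abs]; linarith)
  refine le_trans ?_ (tsum_cs hu hv)
  have h1 : Summable (fun β => ‖f β‖) := hf.summable.norm
  calc |∑' β, f β| = ‖∑' β, f β‖ := rfl
    _ ≤ ∑' β, ‖f β‖ := norm_tsum_le_tsum_norm h1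
    _ ≤ _ := h1.tsum_le_tsum (fun β => h β) hp.summable

/-- polynomially bounded real weights -/
def PB (p : ℤ → ℝ) : Prop := ∃ (K : ℝ) (m : ℕ), 0 ≤ K ∧ ∀ β : ℤ, |p β| ≤ K * (1 + (β : ℝ) ^ 2) ^ m

lemma PB.const (a : ℝ) : PB (fun _ => a) := ⟨|a|, 0, abs_nonneg _, by simp⟩
lemma PB.of_bdd {p : ℤ → ℝ} (a : ℝ) (h : ∀ β, |p β| ≤ a) : PB p :=
  ⟨a, 0, (abs_nonneg _).trans (h 0), by simpa using h⟩
lemma PB.id : PB (fun β : ℤ => (β : ℝ)) := ⟨1, 1, zero_le_one, fun β => by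
  rw [abs_le]; constructor <;> nlinarith [sq_nonneg ((β:ℝ) - 1), sq_nonneg ((β:ℝ) + 1)]⟩
lemma PB.mul {p q : ℤ → ℝ} (hp : PB p) (hq : PB q) : PB (fun β => p β * q β) := by
  obtain ⟨K, m, hK, h⟩ := hp
  obtain ⟨L, n, hL, h'⟩ := hq
  refine ⟨K * L, m + n, by positivity, fun β => ?_⟩
  rw [abs_mul]
  calc _ ≤ (K * (1 + (β : ℝ) ^ 2) ^ m) * (L * (1 + (β : ℝ) ^ 2) ^ n) := by
        gcongr
        · exact h β
        · exact h' β
    _ = _ := by rw [pow_add]; ring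
lemma PB.add {p q : ℤ → ℝ} (hp : PB p) (hq : PB q) : PB (fun β => p β + q β) := by
  obtain ⟨K, m, hK, h⟩ := hp
  obtain ⟨L, n, hL, h'⟩ := hq
  refine ⟨K + L, m + n, by positivity, fun β => ?_⟩
  have h1 : (1:ℝ) ≤ 1 + (β:ℝ)^2 := by nlinarith [sq_nonneg (β:ℝ)]
  calc _ ≤ |p β| + |q β| := abs_add_le _ _
    _ ≤ (K * (1 + (β : ℝ) ^ 2) ^ m) + (L * (1 + (β : ℝ) ^ 2) ^ n) := add_le_add (h β) (h' β)
    _ ≤ (K * (1 + (β : ℝ) ^ 2) ^ (m + n)) + (L * (1 + (β : ℝ) ^ 2) ^ (m + n)) := by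
        gcongr <;> first | exact h1 | omega
    _ = _ := by ring
lemma PB.sub {p q : ℤ → ℝ} (hp : PB p) (hq : PB q) : PB (fun β => p β - q β) := by
  have := hp.add ((PB.const (-1)).mul hq)
  simpa [sub_eq_add_neg] using this
lemma PB.sq {p : ℤ → ℝ} (hp : PB p) : PB (fun β => p β ^ 2) := by
  simpa [_root_.sq] using hp.mul hp

lemma RD.pmul {p u : ℤ → ℝ} (hu : RD u) (hp : PB p) : RD (fun β => p β * u β) := by
  obtain ⟨K, m, hK, h⟩ := hp
  refine hu.of_le K m (fun β => ?_)
  rw [norm_mul, Real.norm_eq_abs]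
  gcongr; exact h β

lemma RD.cmul {p : ℤ → ℝ} {x : ℤ → ℂ} (hx : RD x) (hp : PB p) : RD (fun β => (p β : ℂ) * x β) := by
  obtain ⟨K, m, hK, h⟩ := hp
  refine hx.of_le K m (fun β => ?_)
  rw [norm_mul, Complex.norm_real, Real.norm_eq_abs]
  gcongr; exact h β

lemma RD.reM {x y : ℤ → ℂ} (hx : RD x) (hy : RD y) :
    RD (fun β => ((starRingEnd ℂ) (x β) * y β).re) :=
  hx.prod hy 1 0 (fun β => by
    simpa using Complex.abs_re_le_norm ((starRingEnd ℂ) (x β) * y β))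

lemma RD.imM {x y : ℤ → ℂ} (hx : RD x) (hy : RD y) :
    RD (fun β => ((starRingEnd ℂ) (x β) * y β).im) :=
  hx.prod hy 1 0 (fun β => by
    simpa using Complex.abs_im_le_norm ((starRingEnd ℂ) (x β) * y β))

lemma RD.nrm {x : ℤ → ℂ} (hx : RD x) : RD (fun β => ‖x β‖) :=
  hx.of_le 1 0 (fun β => by simp)

lemma RD.nsq {x : ℤ → ℂ} (hx : RD x) : RD (fun β => ‖x β‖ ^ 2) :=
  hx.prod hx 1 0 (fun β => by simp [sq])

lemma abs_reM (x y : ℂ) : |((starRingEnd ℂ) x * y).re| ≤ ‖x‖ * ‖y‖ := by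
  simpa using Complex.abs_re_le_norm ((starRingEnd ℂ) x * y)
lemma abs_imM (x y : ℂ) : |((starRingEnd ℂ) x * y).im| ≤ ‖x‖ * ‖y‖ := by
  simpa using Complex.abs_im_le_norm ((starRingEnd ℂ) x * y)

noncomputable def cs (ρ : ℤ → ℂ) (β : ℤ) : ℂ := (ρ (β - 1) + ρ (β + 1)) / 2
noncomputable def dl (ρ : ℤ → ℂ) (β : ℤ) : ℂ := ρ (β + 1) - ρ (β - 1)

lemma RD.cs {ρ : ℤ → ℂ} (h : RD ρ) : RD (cs ρ) := by
  have h1 := (h.shift (-1)).add (h.shift 1)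
  refine h1.of_le (1/2) 0 (fun β => ?_)
  simp only [_root_.cs, pow_zero, mul_one, sub_eq_add_neg, norm_div, Complex.norm_ofNat]
  linarith

lemma RD.dl {ρ : ℤ → ℂ} (h : RD ρ) : RD (dl ρ) := by
  have h1 := (h.shift 1).sub (h.shift (-1))
  exact h1

lemma cs_re (ρ : ℤ → ℂ) (β : ℤ) : (cs ρ β).re = ((ρ (β - 1)).re + (ρ (β + 1)).re) / 2 := by
  have : cs ρ β = ((1 / 2 : ℝ) : ℂ) * (ρ (β - 1) + ρ (β + 1)) := by simp [cs]; ring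
  rw [this, Complex.re_ofReal_mul, Complex.add_re]; ring
lemma cs_im (ρ : ℤ → ℂ) (β : ℤ) : (cs ρ β).im = ((ρ (β - 1)).im + (ρ (β + 1)).im) / 2 := by
  have : cs ρ β = ((1 / 2 : ℝ) : ℂ) * (ρ (β - 1) + ρ (β + 1)) := by simp [cs]; ring
  rw [this, Complex.im_ofReal_mul, Complex.add_im]; ring
lemma dl_re (ρ : ℤ → ℂ) (β : ℤ) : (dl ρ β).re = (ρ (β + 1)).re - (ρ (β - 1)).re := rfl
lemma dl_im (ρ : ℤ → ℂ) (β : ℤ) : (dl ρ β).im = (ρ (β + 1)).im - (ρ (β - 1)).im := rfl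

noncomputable def Fs (b : ℤ → ℝ) (α ν l : ℝ) (θ : ℤ → ℂ) (β : ℤ) : ℂ :=
  ((ν * (α ^ 2 + (β : ℝ) ^ 2) : ℝ) : ℂ) * θ β +
    Complex.I * (α : ℂ) * (cs (fun β => (b β : ℂ) * θ β) β - (l : ℂ) * θ β)

lemma PB.S2 (α : ℝ) : PB (fun β : ℤ => α ^ 2 + (β : ℝ) ^ 2) := (PB.const _).add PB.id.sq

lemma RD.cmulc {x : ℤ → ℂ} (hx : RD x) (a : ℂ) : RD (fun β => a * x β) :=
  hx.of_le ‖a‖ 0 (fun β => by simp)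

lemma RD.Fs {b : ℤ → ℝ} (hb : PB b) (α ν l : ℝ) {θ : ℤ → ℂ} (h : RD θ) : RD (Fs b α ν l θ) := by
  have h1 := h.cmul ((PB.const ν).mul (PB.S2 α))
  have h2 := ((h.cmul hb).cs.sub (h.cmulc l)).cmulc (Complex.I * α)
  exact h1.add h2

section ident
variable {b : ℤ → ℝ} (hb : PB b) (α ν l : ℝ) {θ ρ : ℤ → ℂ} (h : RD θ)
  (hρ : ρ = fun β => (b β : ℂ) * θ β)
include hb h hρ

lemma I1 : ∑' β, ((starRingEnd ℂ) (ρ β) * Fs b α ν l θ β).re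
    = ∑' β : ℤ, ν * (α ^ 2 + (β : ℝ) ^ 2) * (b β * ‖θ β‖ ^ 2) := by
  have hr : RD ρ := hρ ▸ h.cmul hb
  refine tsum_eq_of_tele (h := fun β => (-(α / 2)) * ((starRingEnd ℂ) (ρ (β - 1)) * ρ β).im)
    (hr.reM (h.Fs hb α ν l)) ((h.nsq.pmul hb).pmul ((PB.const ν).mul (PB.S2 α)))
    (((hr.shift (-1)).imM hr).pmul (PB.const _)) (fun β => ?_)
  have e : ρ β = (b β : ℂ) * θ β := by rw [hρ]
  have e1 : (ρ β).re = b β * (θ β).re := by rw [e]; simp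
  have e2 : (ρ β).im = b β * (θ β).im := by rw [e]; simp
  rw [Fs, ← hρ, Complex.sq_norm, Complex.normSq_apply]
  obtain ⟨r, hr'⟩ : ∃ r : ℝ, r = ν * (α ^ 2 + (β : ℝ) ^ 2) := ⟨_, rfl⟩
  rw [← hr']
  have e3 : β + 1 - 1 = β := by ring
  simp only [Complex.mul_re, Complex.mul_im, cs_re, cs_im, dl_re, dl_im, Complex.conj_re, Complex.conj_im,
    Complex.add_re, Complex.add_im, Complex.sub_re, Complex.sub_im, Complex.I_re, Complex.I_im,
    Complex.ofReal_re, Complex.ofReal_im, e1, e2, e3]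
  push_cast
  rw [hr']; ring

lemma I2 : ∑' β : ℤ, (α ^ 2 + (β : ℝ) ^ 2) * ((starRingEnd ℂ) (ρ β) * Fs b α ν l θ β).re
    = (∑' β : ℤ, ν * (α ^ 2 + (β : ℝ) ^ 2) ^ 2 * (b β * ‖θ β‖ ^ 2)) +
      α * ∑' β : ℤ, (1 / 2) * β * ((starRingEnd ℂ) (ρ β) * dl ρ β).im := by
  have hr : RD ρ := hρ ▸ h.cmul hb
  have hA : RD (fun β : ℤ => ν * (α ^ 2 + (β : ℝ) ^ 2) ^ 2 * (b β * ‖θ β‖ ^ 2)) :=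
    ((h.nsq.pmul hb).pmul ((PB.const ν).mul (PB.S2 α).sq))
  have hB : RD (fun β : ℤ => (1 / 2) * (β : ℝ) * ((starRingEnd ℂ) (ρ β) * dl ρ β).im) :=
    (hr.imM hr.dl).pmul ((PB.const (1/2)).mul PB.id)
  rw [← tsum_mul_left, ← hA.summable.tsum_add (hB.summable.mul_left α)]
  refine tsum_eq_of_tele
    (h := fun β => ((α / 2) * (β - (α ^ 2 + (β : ℝ) ^ 2))) * ((starRingEnd ℂ) (ρ (β - 1)) * ρ β).im)
    ((hr.reM (h.Fs hb α ν l)).pmul (PB.S2 α)) (hA.add (hB.pmul (PB.const α)))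
    (((hr.shift (-1)).imM hr).pmul ((PB.const _).mul (PB.id.sub (PB.S2 α)))) (fun β => ?_)
  have e : ρ β = (b β : ℂ) * θ β := by rw [hρ]
  have e1 : (ρ β).re = b β * (θ β).re := by rw [e]; simp
  have e2 : (ρ β).im = b β * (θ β).im := by rw [e]; simp
  rw [Fs, ← hρ, Complex.sq_norm, Complex.normSq_apply]
  obtain ⟨r, hr'⟩ : ∃ r : ℝ, r = ν * (α ^ 2 + (β : ℝ) ^ 2) := ⟨_, rfl⟩
  rw [← hr']
  have e3 : β + 1 - 1 = β := by ring
  simp only [Complex.mul_re, Complex.mul_im, cs_re, cs_im, dl_re, dl_im, Complex.conj_re, Complex.conj_im,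
    Complex.add_re, Complex.add_im, Complex.sub_re, Complex.sub_im, Complex.I_re, Complex.I_im,
    Complex.ofReal_re, Complex.ofReal_im, e1, e2, e3]
  push_cast
  rw [hr']; ring

lemma I3 : ∑' β : ℤ, (-(b β * ((starRingEnd ℂ) (cs ρ β - (l : ℂ) * θ β) * (β * dl ρ β + cs ρ β)).re))
    = (∑' β : ℤ, (1 / 4) * (b β * ‖dl ρ β‖ ^ 2)) +
      ∑' β : ℤ, (1 / 2) * (β * (b (β + 1) - b (β - 1))) * ‖ρ β‖ ^ 2 := by
  have hr : RD ρ := hρ ▸ h.cmul hb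
  have hb1 : PB (fun β => b (β + 1) - b (β - 1)) := by
    have hs : ∀ n : ℤ, PB (fun β => b (β + n)) := by
      intro n
      obtain ⟨K, m, hK, hh⟩ := hb
      refine ⟨K * (2 * (1 + (n:ℝ)^2)) ^ m, m, by positivity, fun β => (hh _).trans ?_⟩
      rw [mul_assoc, ← mul_pow]
      gcongr
      push_cast
      nlinarith [sq_nonneg ((β:ℝ) - n), sq_nonneg ((n:ℝ) * β)]
    exact (hs 1).sub (hs (-1))
  have hA : RD (fun β : ℤ => (1 / 4) * (b β * ‖dl ρ β‖ ^ 2)) :=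
    ((hr.dl.nsq.pmul hb).pmul (PB.const _))
  have hB : RD (fun β : ℤ => (1 / 2) * ((β : ℝ) * (b (β + 1) - b (β - 1))) * ‖ρ β‖ ^ 2) :=
    hr.nsq.pmul ((PB.const _).mul (PB.id.mul hb1))
  rw [← hA.summable.tsum_add hB.summable]
  have hz : RD (fun β : ℤ => (β : ℂ) * dl ρ β + cs ρ β) := by
    have := (hr.dl.cmul PB.id).add hr.cs
    simpa using this
  have hU := ((hr.cs.sub (h.cmulc (l:ℂ))).reM hz).pmul hb
  refine tsum_eq_of_tele
    (h := fun β => l * (β - 1 / 2) * ((starRingEnd ℂ) (ρ (β - 1)) * ρ β).re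
      - (1 / 2) * (b (β - 1) * (β * ‖ρ β‖ ^ 2) + b β * ((β - 1) * ‖ρ (β - 1)‖ ^ 2)))
    hU.neg (hA.add hB) ?_ (fun β => ?_)
  · refine RD.sub (((hr.shift (-1)).reM hr).pmul ((PB.const _).mul (PB.id.sub (PB.const _)))) ?_
    refine RD.pmul (RD.add ?_ ?_) (PB.const _)
    · have h0 : PB (fun β => b (β - 1)) := by
        have hs : ∀ n : ℤ, PB (fun β => b (β + n)) := by
          intro n
          obtain ⟨K, m, hK, hh⟩ := hb
          refine ⟨K * (2 * (1 + (n:ℝ)^2)) ^ m, m, by positivity, fun β => (hh _).trans ?_⟩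
          rw [mul_assoc, ← mul_pow]
          gcongr
          push_cast
          nlinarith [sq_nonneg ((β:ℝ) - n), sq_nonneg ((n:ℝ) * β)]
        exact hs (-1)
      exact (hr.nsq.pmul PB.id).pmul h0
    · exact ((hr.shift (-1)).nsq.pmul (PB.id.sub (PB.const _))).pmul hb
  have e : ρ β = (b β : ℂ) * θ β := by rw [hρ]
  have e1 : b β * (θ β).re = (ρ β).re := by rw [e]; simp
  have e2 : b β * (θ β).im = (ρ β).im := by rw [e]; simp
  have e3 : β + 1 - 1 = β := by ring
  simp only [Complex.sq_norm, Complex.normSq_apply, e3]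
  simp only [Complex.mul_re, Complex.mul_im, cs_re, cs_im, dl_re, dl_im, Complex.conj_re, Complex.conj_im,
    Complex.add_re, Complex.add_im, Complex.sub_re, Complex.sub_im,
    Complex.ofReal_re, Complex.ofReal_im, Complex.intCast_re, Complex.intCast_im, e3]
  push_cast
  linear_combination (l * (β * ((ρ (β+1)).re - (ρ (β-1)).re) + ((ρ (β-1)).re + (ρ (β+1)).re)/2)) * e1
    + (l * (β * ((ρ (β+1)).im - (ρ (β-1)).im) + ((ρ (β-1)).im + (ρ (β+1)).im)/2)) * e2

end ident

lemma dl_pw (ρ : ℤ → ℂ) (β : ℤ) :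
    ‖dl ρ β‖ ^ 2 = 2 * ‖ρ (β + 1)‖ ^ 2 + 2 * ‖ρ (β - 1)‖ ^ 2 - 4 * ‖cs ρ β‖ ^ 2 := by
  simp only [Complex.sq_norm, Complex.normSq_apply]
  simp [cs, dl]
  ring

lemma I4 {ρ : ℤ → ℂ} (h : RD ρ) :
    ∑' β, ‖dl ρ β‖ ^ 2 = 4 * (∑' β, ‖ρ β‖ ^ 2) - 4 * ∑' β, ‖cs ρ β‖ ^ 2 := by
  simp_rw [dl_pw]
  have h1 : Summable (fun β => ‖ρ (β + 1)‖ ^ 2) := (h.shift 1).nsq.summable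
  have h2 : Summable (fun β => ‖ρ (β - 1)‖ ^ 2) := (h.shift (-1)).nsq.summable
  have h3 := h.cs.nsq.summable
  have t1 : ∑' β, ‖ρ (β + 1)‖ ^ 2 = ∑' β, ‖ρ β‖ ^ 2 := tsum_shift (fun β => ‖ρ β‖ ^ 2) 1
  have t2 : ∑' β, ‖ρ (β - 1)‖ ^ 2 = ∑' β, ‖ρ β‖ ^ 2 := tsum_shift (fun β => ‖ρ β‖ ^ 2) (-1)
  rw [((h1.mul_left 2).add (h2.mul_left 2)).tsum_sub (h3.mul_left 4),
    (h1.mul_left 2).tsum_add (h2.mul_left 2), tsum_mul_left, tsum_mul_left, tsum_mul_left, t1, t2]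
  ring

lemma I5 {ρ : ℤ → ℂ} (h : RD ρ) :
    ∑' β : ℤ, (β : ℝ) ^ 2 * ‖dl ρ β‖ ^ 2 = 4 * (∑' β : ℤ, (β : ℝ) ^ 2 * ‖ρ β‖ ^ 2) +
      4 * (∑' β, ‖ρ β‖ ^ 2) - 4 * ∑' β : ℤ, (β : ℝ) ^ 2 * ‖cs ρ β‖ ^ 2 := by
  have hA : RD (fun β : ℤ => (β : ℝ) ^ 2 * ‖ρ β‖ ^ 2) := h.nsq.pmul PB.id.sq
  have hC : RD (fun β : ℤ => (β : ℝ) ^ 2 * ‖cs ρ β‖ ^ 2) := h.cs.nsq.pmul PB.id.sq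
  rw [← tsum_mul_left, ← tsum_mul_left, ← tsum_mul_left,
    ← (hA.summable.mul_left 4).tsum_add (h.nsq.summable.mul_left 4),
    ← ((hA.summable.mul_left 4).add (h.nsq.summable.mul_left 4)).tsum_sub (hC.summable.mul_left 4)]
  refine tsum_eq_of_tele
    (h := fun β => 2 * (((β - 1) ^ 2 : ℝ) * ‖ρ β‖ ^ 2) - 2 * ((β : ℝ) ^ 2 * ‖ρ (β - 1)‖ ^ 2))
    (h.dl.nsq.pmul PB.id.sq)
    (((hA.pmul (PB.const 4)).add (h.nsq.pmul (PB.const 4))).sub (hC.pmul (PB.const 4))) ?_ (fun β => ?_)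
  · exact ((h.nsq.pmul (PB.id.sub (PB.const 1)).sq).pmul (PB.const 2)).sub
      (((h.shift (-1)).nsq.pmul PB.id.sq).pmul (PB.const 2))
  have e3 : β + 1 - 1 = β := by ring
  rw [dl_pw]
  simp only [e3]
  push_cast
  ring


lemma Sv_sq (α : ℝ) (β : ℤ) : Sv α β ^ 2 = α ^ 2 + (β : ℝ) ^ 2 := Real.sq_sqrt (by positivity)
lemma Sv_nonneg (α : ℝ) (β : ℤ) : 0 ≤ Sv α β := Real.sqrt_nonneg _
lemma Sv_ge {α : ℝ} (β : ℤ) : α ≤ Sv α β := Real.le_sqrt_of_sq_le (by nlinarith [sq_nonneg (β:ℝ)])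

noncomputable def bb (α : ℝ) (β : ℤ) : ℝ := 1 - (Sv α β)⁻¹

lemma bb_le_one (α : ℝ) (β : ℤ) : bb α β ≤ 1 := by
  have := inv_nonneg.mpr (Sv_nonneg α β)
  unfold bb; linarith

lemma bb_lower {c₀ α : ℝ} (hc : 1 < c₀) (hα : c₀ ≤ α) (β : ℤ) : 1 ≤ c₀ / (c₀ - 1) * bb α β := by
  have h1 : c₀ ≤ Sv α β := hα.trans (Sv_ge β)
  have h2 : (Sv α β)⁻¹ ≤ c₀⁻¹ := inv_anti₀ (by linarith) h1
  have h3 : 0 < c₀ - 1 := by linarith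
  have h4 : c₀ * c₀⁻¹ = 1 := mul_inv_cancel₀ (by linarith)
  rw [div_mul_eq_mul_div, le_div_iff₀ h3]
  unfold bb; nlinarith

lemma bb_pos {c₀ α : ℝ} (hc : 1 < c₀) (hα : c₀ ≤ α) (β : ℤ) : 0 < bb α β := by
  have := bb_lower hc hα β
  have h3 : 0 < c₀ / (c₀ - 1) := div_pos (by linarith) (by linarith)
  by_contra h; push Not at h
  nlinarith

lemma PB.bb {c₀ α : ℝ} (hc : 1 < c₀) (hα : c₀ ≤ α) : PB (bb α) :=
  PB.of_bdd 1 (fun β => by rw [abs_of_pos (bb_pos hc hα β)]; exact bb_le_one α β)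

lemma Sv_pos {α : ℝ} (h : 1 ≤ α) (β : ℤ) : 0 < Sv α β := by have := Sv_ge (α := α) β; linarith

lemma Sv_near {α : ℝ} (h : 1 ≤ α) (β γ : ℤ) (hn : |(γ:ℝ) - β| ≤ 1) : Sv α γ ≤ 2 * Sv α β := by
  refine Real.sqrt_le_iff.mpr ⟨by have := Sv_nonneg α β; linarith, ?_⟩
  rw [mul_pow, Sv_sq]
  have := abs_le.mp hn
  nlinarith [sq_nonneg ((γ:ℝ) - 2 * β), this.1, this.2]

lemma bb_diff {α : ℝ} (h : 1 ≤ α) (β : ℤ) :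
    (β:ℝ) ^ 2 / Sv α β ^ 3 ≤ 4 * (β * (bb α (β + 1) - bb α (β - 1))) := by
  have h0 := Sv_pos h β
  have hp := Sv_pos h (β + 1)
  have hm := Sv_pos h (β - 1)
  have e1 : Sv α (β + 1) ≤ 2 * Sv α β := Sv_near h _ _ (by push_cast; simp)
  have e2 : Sv α (β - 1) ≤ 2 * Sv α β := Sv_near h _ _ (by push_cast; simp)
  have q1 := Sv_sq α (β + 1)
  have q2 := Sv_sq α (β - 1)
  push_cast at q1 q2
  set s := Sv α β
  set p := Sv α (β + 1)
  set m := Sv α (β - 1)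
  have e : bb α (β + 1) - bb α (β - 1) = 4 * β / (p * m * (p + m)) := by
    unfold bb
    change (1 - p⁻¹) - (1 - m⁻¹) = _
    field_simp
    nlinarith
  rw [e]
  have : 4 * ((β:ℝ) * (4 * β / (p * m * (p + m)))) = 16 * (β:ℝ)^2 / (p * m * (p + m)) := by ring
  rw [this, div_le_div_iff₀ (by positivity) (by positivity)]
  have h5 : p * m * (p + m) ≤ (2 * s) * (2 * s) * (2 * s + 2 * s) := by gcongr
  have h6 : 0 ≤ (β:ℝ)^2 := by positivity
  calc (β:ℝ)^2 * (p * m * (p + m)) ≤ (β:ℝ)^2 * ((2 * s) * (2 * s) * (2 * s + 2 * s)) := by gcongr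
    _ = _ := by ring

lemma tsum_jump {ρ : ℤ → ℂ} (h : RD ρ) (N : ℕ) :
    ∑' β, ‖ρ (β + 2 * N) - ρ β‖ ^ 2 ≤ (N:ℝ) ^ 2 * ∑' β, ‖dl ρ β‖ ^ 2 := by
  have pw : ∀ β : ℤ, ‖ρ (β + 2 * N) - ρ β‖ ^ 2 ≤ N * ∑ j ∈ Finset.range N, ‖dl ρ (β + (2 * j + 1))‖ ^ 2 := by
    intro β
    have e : ρ (β + 2 * N) - ρ β = ∑ j ∈ Finset.range N, dl ρ (β + (2 * j + 1)) := by
      have := Finset.sum_range_sub (fun j : ℕ => ρ (β + 2 * j)) N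
      simp only [Nat.cast_zero, mul_zero, add_zero] at this
      rw [← this]
      refine Finset.sum_congr rfl (fun j _ => ?_)
      unfold dl; push_cast
      congr 2 <;> ring
    rw [e]
    calc _ ≤ (∑ j ∈ Finset.range N, ‖dl ρ (β + (2 * j + 1))‖) ^ 2 := by
          gcongr; exact norm_sum_le _ _
      _ ≤ _ := by simpa using sq_sum_le_card_mul_sum_sq (s := Finset.range N) (f := fun j : ℕ => ‖dl ρ (β + (2 * j + 1))‖)
  have s1 : ∀ j : ℕ, Summable (fun β : ℤ => ‖dl ρ (β + (2 * j + 1))‖ ^ 2) := fun j => (h.dl.shift _).nsq.summable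
  have s2 : Summable (fun β : ℤ => (N:ℝ) * ∑ j ∈ Finset.range N, ‖dl ρ (β + (2 * j + 1))‖ ^ 2) :=
    (summable_sum (fun j _ => s1 j)).mul_left _
  refine (((h.shift (2 * N)).sub h).nsq.summable.tsum_le_tsum pw s2).trans ?_
  rw [tsum_mul_left, Summable.tsum_finsetSum (fun j _ => s1 j)]
  have : ∀ j : ℕ, ∑' β : ℤ, ‖dl ρ (β + (2 * j + 1))‖ ^ 2 = ∑' β, ‖dl ρ β‖ ^ 2 := fun j =>
    tsum_shift (fun β => ‖dl ρ β‖ ^ 2) _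
  simp_rw [this]
  simp; apply le_of_eq; ring

lemma PB.inv_pow {α : ℝ} (h : 1 ≤ α) (k : ℕ) : PB (fun β => (Sv α β ^ k)⁻¹) :=
  PB.of_bdd 1 (fun β => by
    have h1 : 1 ≤ Sv α β := h.trans (Sv_ge β)
    rw [abs_of_nonneg (by positivity)]
    exact inv_le_one_of_one_le₀ (one_le_pow₀ h1))

lemma T_bound {ρ : ℤ → ℂ} (h : RD ρ) {x α : ℝ} (hx : 1 ≤ x) (hα : α = x ^ 4) :
    ∑' β, (Sv α β ^ 1)⁻¹ * ‖ρ β‖ ^ 2 ≤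
      30 * x ^ 2 * (∑' β : ℤ, ((β:ℝ) ^ 2 * (Sv α β ^ 3)⁻¹) * ‖ρ β‖ ^ 2) + 8 * x ^ 2 * ∑' β, ‖dl ρ β‖ ^ 2 := by
  have hα1 : 1 ≤ α := hα ▸ one_le_pow₀ hx
  obtain ⟨N, hN⟩ : ∃ N : ℕ, N = ⌈x ^ 3⌉₊ := ⟨_, rfl⟩
  have hN1 : x ^ 3 ≤ N := hN ▸ Nat.le_ceil _
  have hx3 : 1 ≤ x ^ 3 := one_le_pow₀ hx
  have hN2 : (N:ℝ) ≤ 2 * x ^ 3 := by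
    have := Nat.ceil_lt_add_one (a := x ^ 3) (by positivity)
    rw [← hN] at this; linarith
  set w : ℤ → ℝ := fun β => (β:ℝ) ^ 2 * (Sv α β ^ 3)⁻¹ with hw
  have hPw : PB w := PB.id.sq.mul (PB.inv_pow hα1 3)
  have key : ∀ β : ℤ, x ^ 3 ≤ |(β:ℝ)| → (Sv α β ^ 1)⁻¹ ≤ (1 + x ^ 2) * w β := by
    intro β hb
    have h0 := Sv_pos hα1 β
    have h1 : Sv α β ^ 2 ≤ (1 + x ^ 2) * (β:ℝ) ^ 2 := by
      rw [Sv_sq, hα]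
      have : (x ^ 3) ^ 2 ≤ (β:ℝ) ^ 2 := by rw [← sq_abs (β:ℝ)]; gcongr
      nlinarith [sq_nonneg x]
    calc (Sv α β ^ 1)⁻¹ = Sv α β ^ 2 * (Sv α β ^ 3)⁻¹ := by field_simp
      _ ≤ ((1 + x ^ 2) * (β:ℝ) ^ 2) * (Sv α β ^ 3)⁻¹ := by gcongr
      _ = _ := by rw [hw]; ring
  have wn : ∀ β, 0 ≤ w β := fun β => by
    have := Sv_nonneg α β
    rw [hw]; positivity
  have pw : ∀ β : ℤ, (Sv α β ^ 1)⁻¹ * ‖ρ β‖ ^ 2 ≤ (1 + x ^ 2) * (w β * ‖ρ β‖ ^ 2) +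
      14 * (1 + x ^ 2) * (w (β + 2 * N) * ‖ρ (β + 2 * N)‖ ^ 2) +
      2 * (x ^ 4)⁻¹ * ‖ρ (β + 2 * N) - ρ β‖ ^ 2 := by
    intro β
    have n1 := wn β
    have n2 := wn (β + 2 * N)
    by_cases hb : x ^ 3 ≤ |(β:ℝ)|
    · have := mul_le_mul_of_nonneg_right (key β hb) (sq_nonneg ‖ρ β‖)
      have : 0 ≤ 14 * (1 + x ^ 2) * (w (β + 2 * N) * ‖ρ (β + 2 * N)‖ ^ 2) +
        2 * (x ^ 4)⁻¹ * ‖ρ (β + 2 * N) - ρ β‖ ^ 2 := by positivity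
      linarith
    · push Not at hb
      have hb' := abs_lt.mp hb
      have hg1 : x ^ 3 ≤ ((β + 2 * N : ℤ) : ℝ) := by push_cast; linarith
      have hg2 : ((β + 2 * N : ℤ) : ℝ) ≤ 5 * x ^ 3 := by push_cast; linarith
      have hk := key (β + 2 * N) (hg1.trans (le_abs_self _))
      have hS0 := Sv_pos hα1 (β + 2 * N)
      have hS : Sv α (β + 2 * N) ≤ 7 * x ^ 4 := by
        refine Real.sqrt_le_iff.mpr ⟨by positivity, ?_⟩
        have h1 : ((β + 2 * N : ℤ) : ℝ) ^ 2 ≤ (5 * x ^ 3) ^ 2 := by gcongr; linarith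
        have h2 : x ^ 6 ≤ x ^ 8 := pow_le_pow_right₀ hx (by norm_num)
        rw [hα]
        nlinarith
      have hx4 : (x ^ 4)⁻¹ ≤ 7 * ((1 + x ^ 2) * w (β + 2 * N)) := by
        refine le_trans ?_ (mul_le_mul_of_nonneg_left hk (by norm_num))
        rw [pow_one, ← div_eq_mul_inv, inv_eq_one_div, div_le_div_iff₀ (by positivity) hS0]
        linarith
      have hSb : (Sv α β ^ 1)⁻¹ ≤ (x ^ 4)⁻¹ := by
        rw [pow_one]; gcongr; rw [← hα]; exact Sv_ge β
      have htri : ‖ρ β‖ ^ 2 ≤ 2 * ‖ρ (β + 2 * N)‖ ^ 2 + 2 * ‖ρ (β + 2 * N) - ρ β‖ ^ 2 := by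
        have : ‖ρ β‖ ≤ ‖ρ (β + 2 * N)‖ + ‖ρ (β + 2 * N) - ρ β‖ := by
          have := norm_sub_le (ρ (β + 2 * N)) (ρ (β + 2 * N) - ρ β)
          simpa using this
        nlinarith [norm_nonneg (ρ β), sq_nonneg (‖ρ (β + 2 * N)‖ - ‖ρ (β + 2 * N) - ρ β‖)]
      calc (Sv α β ^ 1)⁻¹ * ‖ρ β‖ ^ 2 ≤ (x ^ 4)⁻¹ * (2 * ‖ρ (β + 2 * N)‖ ^ 2 + 2 * ‖ρ (β + 2 * N) - ρ β‖ ^ 2) := by gcongr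
        _ = 2 * ((x ^ 4)⁻¹ * ‖ρ (β + 2 * N)‖ ^ 2) + 2 * (x ^ 4)⁻¹ * ‖ρ (β + 2 * N) - ρ β‖ ^ 2 := by ring
        _ ≤ 2 * ((7 * ((1 + x ^ 2) * w (β + 2 * N))) * ‖ρ (β + 2 * N)‖ ^ 2) + 2 * (x ^ 4)⁻¹ * ‖ρ (β + 2 * N) - ρ β‖ ^ 2 := by
            gcongr
        _ ≤ _ := by
          have : 0 ≤ (1 + x ^ 2) * (w β * ‖ρ β‖ ^ 2) := by positivity
          linarith
  have sw : RD (fun β => w β * ‖ρ β‖ ^ 2) := h.nsq.pmul hPw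
  have A1 := sw.summable
  have A2 : Summable (fun β : ℤ => w (β + 2 * N) * ‖ρ (β + 2 * N)‖ ^ 2) := (sw.shift (2 * N)).summable
  have A3 : Summable (fun β : ℤ => ‖ρ (β + 2 * N) - ρ β‖ ^ 2) := ((h.shift (2 * N)).sub h).nsq.summable
  have := (h.nsq.pmul (PB.inv_pow hα1 1)).summable.tsum_le_tsum pw
    (((A1.mul_left _).add (A2.mul_left _)).add (A3.mul_left _))
  rw [((A1.mul_left _).add (A2.mul_left _)).tsum_add (A3.mul_left _),
    (A1.mul_left _).tsum_add (A2.mul_left _), tsum_mul_left, tsum_mul_left, tsum_mul_left,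
    tsum_shift (fun β => w β * ‖ρ β‖ ^ 2) (2 * N)] at this
  have hj := tsum_jump h N
  have hV : 0 ≤ ∑' β, w β * ‖ρ β‖ ^ 2 := tsum_nonneg (fun β => mul_nonneg (wn β) (sq_nonneg _))
  have hd : 0 ≤ ∑' β, ‖dl ρ β‖ ^ 2 := tsum_nonneg (fun β => sq_nonneg _)
  have hx2 : 1 ≤ x ^ 2 := one_le_pow₀ hx
  have h3 : 2 * (x ^ 4)⁻¹ * ∑' β, ‖ρ (β + 2 * N) - ρ β‖ ^ 2 ≤ 8 * x ^ 2 * ∑' β, ‖dl ρ β‖ ^ 2 := by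
    calc _ ≤ 2 * (x ^ 4)⁻¹ * ((2 * x ^ 3) ^ 2 * ∑' β, ‖dl ρ β‖ ^ 2) := by
          gcongr
          refine hj.trans ?_
          gcongr
      _ = _ := by field_simp; ring
  have h4 : (1 + x ^ 2) * (∑' β, w β * ‖ρ β‖ ^ 2) + 14 * (1 + x ^ 2) * (∑' β, w β * ‖ρ β‖ ^ 2)
      ≤ 30 * x ^ 2 * (∑' β, w β * ‖ρ β‖ ^ 2) := by nlinarith
  linarith


set_option maxHeartbeats 2000000 in
lemma alg1 {W C₁ e x y f p m D g n ε P Q : ℝ} (hW : 1 ≤ W) (hC : 1 ≤ C₁) (he : 0 < e) (he1 : 2 * (1008 * C₁ * W ^ 2 * e ^ 3) < 1)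
    (he2 : e ≤ 1 / 2) (hx : 1 ≤ x) (hy : 0 < y) (hye : y ^ 2 ≤ e ^ 4)
    (f0 : 0 ≤ f) (p0 : 0 ≤ p) (m0 : 0 ≤ m) (D0 : 0 ≤ D) (g0 : 0 ≤ g) (n0 : 0 ≤ n) (hDQ : D ^ 2 ≤ Q)
    (h1 : y ^ 14 * p ^ 2 ≤ f) (h2 : y ^ 14 * m ^ 2 ≤ m * f + x ^ 4 * p * D)
    (h3 : (x ^ 4) ^ 2 * g ^ 2 ≤ 2 * f ^ 2 + 2 * W ^ 2 * (y ^ 14) ^ 2 * m ^ 2)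
    (h4 : P ≤ 4 * g * (n + 1)) (h5 : n ^ 2 ≤ 4 * ε * p ^ 2 + 4 + 8 * m * g)
    (h6 : ε ≤ 2 * W ^ 2 * Q + 4 * W * g) (h7 : Q ≤ C₁ * x ^ 2 * P)
    (h8 : y ^ 4 ≤ Q + y ^ 12 * p ^ 2) (hf : f ≤ e ^ 4 * y ^ 6) : False := by
  have he3 : e ≤ 1 := by linarith
  have hx0 : 0 < x := by linarith
  have hx2 : 1 ≤ x ^ 2 := one_le_pow₀ hx
  have hx4 : 1 ≤ x ^ 4 := one_le_pow₀ hx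
  have he4 : e ^ 4 ≤ e := pow_le_of_le_one he.le he3 (by norm_num)
  have hy2 : y ^ 2 ≤ 1 := by linarith
  -- rescaled variables
  obtain ⟨p', rfl⟩ : ∃ p', p = p' / y ^ 4 := ⟨p * y ^ 4, by field_simp⟩
  obtain ⟨D', rfl⟩ : ∃ D', D = D' * y ^ 2 := ⟨D / y ^ 2, by field_simp⟩
  obtain ⟨u, rfl⟩ : ∃ u, m = u / y ^ 8 := ⟨m * y ^ 8, by field_simp⟩
  obtain ⟨k, rfl⟩ : ∃ k, g = k * y ^ 6 / x ^ 4 := ⟨g / y ^ 6 * x ^ 4, by field_simp⟩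
  obtain ⟨n', rfl⟩ : ∃ n', n = n' / y ^ 2 := ⟨n * y ^ 2, by field_simp⟩
  obtain ⟨f', rfl⟩ : ∃ f', f = f' * y ^ 6 := ⟨f / y ^ 6, by field_simp⟩
  obtain ⟨q, rfl⟩ : ∃ q, Q = q * y ^ 4 := ⟨Q / y ^ 4, by field_simp⟩
  obtain ⟨ε', rfl⟩ : ∃ ε', ε = ε' * y ^ 4 := ⟨ε / y ^ 4, by field_simp⟩
  have p0' : 0 ≤ p' := by by_contra h; push Not at h; exact absurd p0 (not_le.mpr (div_neg_of_neg_of_pos h (by positivity)))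
  have u0' : 0 ≤ u := by by_contra h; push Not at h; exact absurd m0 (not_le.mpr (div_neg_of_neg_of_pos h (by positivity)))
  have n0' : 0 ≤ n' := by by_contra h; push Not at h; exact absurd n0 (not_le.mpr (div_neg_of_neg_of_pos h (by positivity)))
  have D0' : 0 ≤ D' := nonneg_of_mul_nonneg_left D0 (by positivity)
  have f0' : 0 ≤ f' := nonneg_of_mul_nonneg_left f0 (by positivity)
  have k0' : 0 ≤ k := by
    have : k = (k * y ^ 6 / x ^ 4) * (x ^ 4 / y ^ 6) := by field_simp
    rw [this]; positivity
  have hf' : f' ≤ e ^ 4 := le_of_mul_le_mul_right hf (by positivity)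
  have h1' : p' ^ 2 ≤ f' := by
    have : y ^ 14 * (p' / y ^ 4) ^ 2 = p' ^ 2 * y ^ 6 := by field_simp
    rw [this] at h1; exact le_of_mul_le_mul_right h1 (by positivity)
  have hDq : D' ^ 2 ≤ q := by
    have : (D' * y ^ 2) ^ 2 = D' ^ 2 * y ^ 4 := by ring
    rw [this] at hDQ; exact le_of_mul_le_mul_right hDQ (by positivity)
  have h8' : 1 ≤ q + p' ^ 2 := by
    have : q * y ^ 4 + y ^ 12 * (p' / y ^ 4) ^ 2 = (q + p' ^ 2) * y ^ 4 := by field_simp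
    rw [this] at h8; refine le_of_mul_le_mul_right (a := y ^ 4) (by linarith) (by positivity)
  have h2' : u ^ 2 ≤ u * f' + x ^ 4 * p' * D' := by
    have a1 : y ^ 14 * (u / y ^ 8) ^ 2 = u ^ 2 * (1 / y ^ 2) := by field_simp
    have a2 : u / y ^ 8 * (f' * y ^ 6) + x ^ 4 * (p' / y ^ 4) * (D' * y ^ 2) = (u * f' + x ^ 4 * p' * D') * (1 / y ^ 2) := by field_simp
    rw [a1, a2] at h2; exact le_of_mul_le_mul_right h2 (by positivity)
  have h3' : k ^ 2 ≤ 2 * f' ^ 2 + 2 * W ^ 2 * u ^ 2 := by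
    have a1 : (x ^ 4) ^ 2 * (k * y ^ 6 / x ^ 4) ^ 2 = k ^ 2 * y ^ 12 := by field_simp
    have a2 : 2 * (f' * y ^ 6) ^ 2 + 2 * W ^ 2 * (y ^ 14) ^ 2 * (u / y ^ 8) ^ 2 = (2 * f' ^ 2 + 2 * W ^ 2 * u ^ 2) * y ^ 12 := by field_simp
    rw [a1, a2] at h3; exact le_of_mul_le_mul_right h3 (by positivity)
  have h6' : ε' ≤ 2 * W ^ 2 * q + 4 * W * (k * y ^ 2 / x ^ 4) := by
    have a2 : 2 * W ^ 2 * (q * y ^ 4) + 4 * W * (k * y ^ 6 / x ^ 4) = (2 * W ^ 2 * q + 4 * W * (k * y ^ 2 / x ^ 4)) * y ^ 4 := by field_simp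
    rw [a2] at h6; exact le_of_mul_le_mul_right h6 (by positivity)
  have h5' : n' ^ 2 ≤ 4 * ε' * p' ^ 2 + 4 * y ^ 4 + 8 * (y ^ 2 * u * k / x ^ 4) := by
    have a1 : (n' / y ^ 2) ^ 2 = n' ^ 2 * (1 / y ^ 4) := by field_simp
    have a2 : 4 * (ε' * y ^ 4) * (p' / y ^ 4) ^ 2 + 4 + 8 * (u / y ^ 8) * (k * y ^ 6 / x ^ 4) =
      (4 * ε' * p' ^ 2 + 4 * y ^ 4 + 8 * (y ^ 2 * u * k / x ^ 4)) * (1 / y ^ 4) := by field_simp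
    rw [a1, a2] at h5; exact le_of_mul_le_mul_right h5 (by positivity)
  have h7' : q ≤ 4 * C₁ * (k / x ^ 2) * (n' + y ^ 2) := by
    have : q * y ^ 4 ≤ (4 * C₁ * (k / x ^ 2) * (n' + y ^ 2)) * y ^ 4 := by
      calc q * y ^ 4 ≤ C₁ * x ^ 2 * P := h7
        _ ≤ C₁ * x ^ 2 * (4 * (k * y ^ 6 / x ^ 4) * (n' / y ^ 2 + 1)) := by gcongr
        _ = _ := by field_simp
    exact le_of_mul_le_mul_right this (by positivity)
  have hpe : p' ≤ e ^ 2 := by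
    refine (sq_le_sq₀ p0' (by positivity)).mp ?_
    calc p' ^ 2 ≤ e ^ 4 := h1'.trans hf'
      _ = _ := by ring
  have hq : 1 / 2 ≤ q := by linarith
  obtain ⟨v, hv0, hv⟩ : ∃ v : ℝ, 0 ≤ v ∧ v ^ 4 = q :=
    ⟨√(√q), Real.sqrt_nonneg _, by
      rw [show (4:ℕ) = 2 * 2 by norm_num, pow_mul, Real.sq_sqrt (Real.sqrt_nonneg _), Real.sq_sqrt (by linarith)]⟩
  subst hv
  have hv : 1 / 2 ≤ v := by
    by_contra h; push Not at h
    have : v ^ 4 ≤ (1 / 2) ^ 4 := pow_le_pow_left₀ hv0 h.le 4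
    norm_num at this; linarith
  have hDv : D' ≤ v ^ 2 := by
    refine (sq_le_sq₀ D0' (by positivity)).mp ?_
    calc D' ^ 2 ≤ v ^ 4 := hDq
      _ = _ := by ring
  have hxev : e ≤ 2 * (x ^ 2 * e * v) := by
    have h9 : 1 * (1/2) ≤ x ^ 2 * v := mul_le_mul hx2 hv (by norm_num) (by positivity)
    have h10 : e * (1 * (1/2)) ≤ e * (x ^ 2 * v) := mul_le_mul_of_nonneg_left h9 he.le
    linarith
  have hu : u ≤ 3 * (x ^ 2 * e * v) := by
    by_contra h; push Not at h
    have hb : x ^ 4 * p' * D' ≤ (x ^ 2 * e * v) ^ 2 := by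
      calc x ^ 4 * p' * D' ≤ x ^ 4 * e ^ 2 * v ^ 2 := by gcongr
        _ = _ := by ring
    have hb2 : u * f' ≤ u * (2 * (x ^ 2 * e * v)) := by gcongr; linarith
    have hp : 0 < x ^ 2 * e * v := by positivity
    clear * - h hb hb2 hp h2'
    generalize x ^ 2 * e * v = z at *
    nlinarith
  have hk : k ≤ 6 * W * (x ^ 2 * e * v) := by
    refine (sq_le_sq₀ k0' (by positivity)).mp ?_
    have a1 : f' ^ 2 ≤ (2 * (x ^ 2 * e * v)) ^ 2 := by gcongr; linarith
    have a2 : u ^ 2 ≤ (3 * (x ^ 2 * e * v)) ^ 2 := by gcongr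
    have a3 : W ^ 2 * u ^ 2 ≤ W ^ 2 * (3 * (x ^ 2 * e * v)) ^ 2 := by gcongr
    have a4 : (x ^ 2 * e * v) ^ 2 ≤ W ^ 2 * (x ^ 2 * e * v) ^ 2 := le_mul_of_one_le_left (by positivity) (one_le_pow₀ hW)
    have a5 : (6 * W * (x ^ 2 * e * v)) ^ 2 = 36 * (W ^ 2 * (x ^ 2 * e * v) ^ 2) := by ring
    rw [a5]
    have a6 : W ^ 2 * (3 * (x ^ 2 * e * v)) ^ 2 = 9 * (W ^ 2 * (x ^ 2 * e * v) ^ 2) := by ring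
    have a7 : (2 * (x ^ 2 * e * v)) ^ 2 = 4 * (x ^ 2 * e * v) ^ 2 := by ring
    rw [a6] at a3; rw [a7] at a1
    have a8 : 0 ≤ W ^ 2 * (x ^ 2 * e * v) ^ 2 := by positivity
    linarith
  have hW2 : W ≤ W ^ 2 := le_self_pow₀ hW (by norm_num)
  have hv2 : v ^ 2 ≤ 4 * v ^ 4 := by
    have : (1/2) ^ 2 * v ^ 2 ≤ v ^ 2 * v ^ 2 := by gcongr
    linarith [show v ^ 2 * v ^ 2 = v ^ 4 by ring]
  have hv3 : v ≤ 8 * v ^ 4 := by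
    have : (1/2) ^ 3 * v ≤ v ^ 3 * v := by gcongr
    linarith [show v ^ 3 * v = v ^ 4 by ring]
  have hε : ε' ≤ 200 * W ^ 2 * v ^ 4 := by
    have : k * y ^ 2 / x ^ 4 ≤ 6 * W * v := by
      rw [div_le_iff₀ (by positivity)]
      calc k * y ^ 2 ≤ 6 * W * (x ^ 2 * e * v) * 1 := by gcongr
        _ ≤ 6 * W * (x ^ 2 * 1 * v) * x ^ 2 := by gcongr
        _ = _ := by ring
    calc ε' ≤ 2 * W ^ 2 * v ^ 4 + 4 * W * (6 * W * v) := h6'.trans (by gcongr)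
      _ = 2 * W ^ 2 * v ^ 4 + 24 * W ^ 2 * v := by ring
      _ ≤ 2 * W ^ 2 * v ^ 4 + 24 * W ^ 2 * (8 * v ^ 4) := by gcongr
      _ ≤ _ := by linarith [show 0 ≤ W ^ 2 * v ^ 4 by positivity]
  have hp2 : p' ^ 2 ≤ e ^ 4 := h1'.trans hf'
  have hn : n' ≤ 38 * W * (e ^ 2 * v ^ 2) := by
    refine (sq_le_sq₀ n0' (by positivity)).mp ?_
    have a1 : 4 * ε' * p' ^ 2 ≤ 4 * (200 * W ^ 2 * v ^ 4) * e ^ 4 := by gcongr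
    have a2 : y ^ 4 ≤ 16 * (e ^ 4 * v ^ 4) := by
      have b1 : 1 ≤ 16 * v ^ 4 := by linarith
      calc y ^ 4 = y ^ 2 * y ^ 2 := by ring
        _ ≤ e ^ 4 * 1 := by gcongr
        _ ≤ e ^ 4 * (16 * v ^ 4) := by gcongr
        _ = _ := by ring
    have a3 : y ^ 2 * u * k / x ^ 4 ≤ 18 * W * 4 * (e ^ 4 * v ^ 4) := by
      rw [div_le_iff₀ (by positivity)]
      calc y ^ 2 * u * k ≤ e ^ 4 * (3 * (x ^ 2 * e * v)) * (6 * W * (x ^ 2 * e * v)) := by gcongr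
        _ = 18 * W * e ^ 4 * (e ^ 2) * v ^ 2 * x ^ 4 := by ring
        _ ≤ 18 * W * e ^ 4 * 1 * (4 * v ^ 4) * x ^ 4 := by gcongr; exact pow_le_one₀ he.le he3
        _ = _ := by ring
    have a4 : e ^ 4 * v ^ 4 ≤ W ^ 2 * (e ^ 4 * v ^ 4) := le_mul_of_one_le_left (by positivity) (one_le_pow₀ hW)
    have a5 : W * (e ^ 4 * v ^ 4) ≤ W ^ 2 * (e ^ 4 * v ^ 4) := by gcongr
    have : (38 * W * (e ^ 2 * v ^ 2)) ^ 2 = 1444 * (W ^ 2 * (e ^ 4 * v ^ 4)) := by ring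
    have a6 : 0 ≤ W ^ 2 * (e ^ 4 * v ^ 4) := by positivity
    rw [this]; linarith
  have hfin : v ^ 4 ≤ 1008 * C₁ * W ^ 2 * e ^ 3 * v ^ 3 := by
    have a1 : k / x ^ 2 ≤ 6 * W * (e * v) := by
      rw [div_le_iff₀ (by positivity)]; linarith
    have a2 : n' + y ^ 2 ≤ 42 * W * (e ^ 2 * v ^ 2) := by
      have : y ^ 2 ≤ 4 * W * (e ^ 2 * v ^ 2) := by
        calc y ^ 2 ≤ e ^ 2 * e ^ 2 := hye.trans (le_of_eq (by ring))
          _ ≤ 1 * e ^ 2 * (4 * v ^ 2) := by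
            have b1 : e ^ 2 ≤ 1 := pow_le_one₀ he.le he3
            have b2 : (1/2) ^ 2 ≤ v ^ 2 := by gcongr
            have b3 : e ^ 2 ≤ 4 * v ^ 2 := by linarith
            calc e ^ 2 * e ^ 2 ≤ e ^ 2 * (4 * v ^ 2) := by gcongr
              _ = _ := by ring
          _ ≤ W * e ^ 2 * (4 * v ^ 2) := by gcongr
          _ = _ := by ring
      linarith
    calc v ^ 4 ≤ 4 * C₁ * (k / x ^ 2) * (n' + y ^ 2) := h7'
      _ ≤ 4 * C₁ * (6 * W * (e * v)) * (42 * W * (e ^ 2 * v ^ 2)) := by gcongr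
      _ = _ := by ring
  have hv3' : 0 < v ^ 3 := by positivity
  have : v ≤ 1008 * C₁ * W ^ 2 * e ^ 3 := by
    refine le_of_mul_le_mul_right (a := v ^ 3) ?_ hv3'
    linarith
  linarith


lemma sqrt_nsq_le {u v : ℤ → ℝ} (hu : Summable u) (hv : Summable v) (h : ∀ β, u β ≤ v β) :
    ∑' β, u β ≤ ∑' β, v β := hu.tsum_le_tsum h hv

section stat
variable {c₀ α : ℝ} (hc : 1 < c₀) (hα : c₀ ≤ α) (ν l : ℝ) {θ ρ : ℤ → ℂ} (h : RD θ)
  (hρ : ρ = fun β => (bb α β : ℂ) * θ β)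
include hc hα h hρ

lemma RDρ : RD ρ := hρ ▸ h.cmul (PB.bb hc hα)

omit h in
lemma nρ (β : ℤ) : ‖ρ β‖ = bb α β * ‖θ β‖ := by
  rw [hρ]; simp [abs_of_pos (bb_pos hc hα β)]

omit h in
lemma nρ_sq_le (β : ℤ) : ‖ρ β‖ ^ 2 ≤ bb α β * ‖θ β‖ ^ 2 := by
  rw [nρ hc hα hρ]
  have h1 := bb_pos hc hα β
  have h2 := bb_le_one α β
  nlinarith [sq_nonneg ‖θ β‖, mul_nonneg h1.le (sq_nonneg ‖θ β‖)]

omit h in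
lemma nθ_le (β : ℤ) : ‖θ β‖ ≤ c₀ / (c₀ - 1) * ‖ρ β‖ := by
  rw [nρ hc hα hρ, ← mul_assoc]
  exact le_mul_of_one_le_left (norm_nonneg _) (bb_lower hc hα β)

omit h in
lemma nρ_le (β : ℤ) : ‖ρ β‖ ≤ ‖θ β‖ := by
  rw [nρ hc hα hρ]
  exact mul_le_of_le_one_left (norm_nonneg _) (bb_le_one α β)

lemma E1 (hν : 0 ≤ ν) : ν * (∑' β : ℤ, (α ^ 2 + (β : ℝ) ^ 2) * ‖ρ β‖ ^ 2) ≤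
    √(∑' β, ‖ρ β‖ ^ 2) * √(∑' β, ‖Fs (bb α) α ν l θ β‖ ^ 2) := by
  have hr := RDρ hc hα h hρ
  have hb := PB.bb hc hα
  have hF := h.Fs hb α ν l
  have t := tsum_abs_le hr.nrm hF.nrm (f := fun β => ((starRingEnd ℂ) (ρ β) * Fs (bb α) α ν l θ β).re)
    (fun β => by simpa using abs_reM _ _)
  rw [I1 hb α ν l h hρ] at t
  refine le_trans ?_ ((le_abs_self _).trans t)
  rw [← tsum_mul_left]
  refine Summable.tsum_le_tsum (fun β => ?_) ((hr.nsq.pmul (PB.S2 α)).summable.mul_left _)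
    ((h.nsq.pmul hb).pmul ((PB.const ν).mul (PB.S2 α))).summable
  rw [mul_assoc]
  gcongr
  exact nρ_sq_le hc hα hρ β

lemma E2_s2 (hν : 0 ≤ ν) : ν * (∑' β : ℤ, ((α ^ 2 + (β : ℝ) ^ 2) * ‖ρ β‖) ^ 2) ≤
    √(∑' β : ℤ, ((α ^ 2 + (β : ℝ) ^ 2) * ‖ρ β‖) ^ 2) * √(∑' β, ‖Fs (bb α) α ν l θ β‖ ^ 2) +
    α * (√(∑' β : ℤ, (α ^ 2 + (β : ℝ) ^ 2) * ‖ρ β‖ ^ 2) * √(∑' β, ‖dl ρ β‖ ^ 2)) := by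
  have hr := RDρ hc hα h hρ
  have hb := PB.bb hc hα
  have hF := h.Fs hb α ν l
  have hα0 : 0 < α := by linarith
  have t := tsum_abs_le (hr.nrm.pmul (PB.S2 α)) hF.nrm
    (f := fun β => (α ^ 2 + (β : ℝ) ^ 2) * ((starRingEnd ℂ) (ρ β) * Fs (bb α) α ν l θ β).re)
    (fun β => by
      rw [abs_mul, abs_mul, mul_assoc]
      gcongr
      simpa using abs_reM _ _)
  rw [I2 hb α ν l h hρ] at t
  have t2 := tsum_abs_le (hr.nrm.pmul PB.id) hr.dl.nrm
    (f := fun β : ℤ => (1 / 2) * (β:ℝ) * ((starRingEnd ℂ) (ρ β) * dl ρ β).im)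
    (fun β => by
      rw [abs_mul, abs_mul, abs_mul, mul_assoc, mul_assoc]
      have := abs_imM (ρ β) (dl ρ β)
      have h2 : |(1/2:ℝ)| = 1/2 := by norm_num
      rw [h2, abs_norm, abs_norm]
      have h3 : |(β:ℝ)| * |((starRingEnd ℂ) (ρ β) * dl ρ β).im| ≤ |(β:ℝ)| * (‖ρ β‖ * ‖dl ρ β‖) := by gcongr
      have h4 : 0 ≤ |(β:ℝ)| * |((starRingEnd ℂ) (ρ β) * dl ρ β).im| := by positivity
      linarith)
  have t3 : ∑' β : ℤ, ((β:ℝ) * ‖ρ β‖) ^ 2 ≤ ∑' β : ℤ, (α ^ 2 + (β : ℝ) ^ 2) * ‖ρ β‖ ^ 2 := by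
    refine Summable.tsum_le_tsum (fun β => ?_) ?_ (hr.nsq.pmul (PB.S2 α)).summable
    · rw [mul_pow]; gcongr; nlinarith
    · simp_rw [mul_pow]; exact (hr.nsq.pmul PB.id.sq).summable
  have t4 : |∑' β : ℤ, (1 / 2) * (β:ℝ) * ((starRingEnd ℂ) (ρ β) * dl ρ β).im| ≤
    √(∑' β : ℤ, (α ^ 2 + (β : ℝ) ^ 2) * ‖ρ β‖ ^ 2) * √(∑' β, ‖dl ρ β‖ ^ 2) := t2.trans (by gcongr)
  have t5 : ν * (∑' β : ℤ, ((α ^ 2 + (β : ℝ) ^ 2) * ‖ρ β‖) ^ 2) ≤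
      ∑' β : ℤ, ν * (α ^ 2 + (β : ℝ) ^ 2) ^ 2 * (bb α β * ‖θ β‖ ^ 2) := by
    rw [← tsum_mul_left]
    refine Summable.tsum_le_tsum (fun β => ?_) ?_
      ((h.nsq.pmul hb).pmul ((PB.const ν).mul (PB.S2 α).sq)).summable
    · rw [mul_pow, mul_assoc]; gcongr; exact nρ_sq_le hc hα hρ β
    · simp_rw [mul_pow]; exact (hr.nsq.pmul (PB.S2 α).sq).summable.mul_left _
  have t6 := (le_abs_self _).trans t
  have t7 := (abs_le.mp t4).1
  have t8 := mul_le_mul_of_nonneg_left t7 hα0.le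
  linarith

lemma E3 : α ^ 2 * (∑' β, ‖cs ρ β - (l:ℂ) * θ β‖ ^ 2) ≤ 2 * (∑' β, ‖Fs (bb α) α ν l θ β‖ ^ 2) +
    2 * (c₀ / (c₀ - 1)) ^ 2 * ν ^ 2 * (∑' β : ℤ, ((α ^ 2 + (β : ℝ) ^ 2) * ‖ρ β‖) ^ 2) := by
  have hr := RDρ hc hα h hρ
  have hb := PB.bb hc hα
  have hF := h.Fs hb α ν l
  have hg := hr.cs.sub (h.cmulc (l:ℂ))
  have s2 : Summable (fun β : ℤ => ((α ^ 2 + (β : ℝ) ^ 2) * ‖ρ β‖) ^ 2) := by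
    simp_rw [mul_pow]; exact (hr.nsq.pmul (PB.S2 α).sq).summable
  rw [← tsum_mul_left, ← tsum_mul_left, ← tsum_mul_left,
    ← (hF.nsq.summable.mul_left _).tsum_add (s2.mul_left _)]
  refine Summable.tsum_le_tsum (fun β => ?_) (hg.nsq.summable.mul_left _)
    ((hF.nsq.summable.mul_left _).add (s2.mul_left _))
  have e : Complex.I * (α:ℂ) * (cs ρ β - (l:ℂ) * θ β) =
      Fs (bb α) α ν l θ β - ((ν * (α ^ 2 + (β : ℝ) ^ 2) : ℝ) : ℂ) * θ β := by
    rw [Fs, ← hρ]; ring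
  have e1 : α ^ 2 * ‖cs ρ β - (l:ℂ) * θ β‖ ^ 2 = ‖Complex.I * (α:ℂ) * (cs ρ β - (l:ℂ) * θ β)‖ ^ 2 := by
    simp [mul_pow]
  rw [e1, e]
  have h1 := norm_sub_le (Fs (bb α) α ν l θ β) (((ν * (α ^ 2 + (β : ℝ) ^ 2) : ℝ) : ℂ) * θ β)
  have h2 : ‖((ν * (α ^ 2 + (β : ℝ) ^ 2) : ℝ) : ℂ) * θ β‖ ≤ c₀ / (c₀ - 1) * (|ν| * ((α ^ 2 + (β : ℝ) ^ 2) * ‖ρ β‖)) := by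
    rw [norm_mul, Complex.norm_real, Real.norm_eq_abs, abs_mul, abs_of_nonneg (by positivity : 0 ≤ α ^ 2 + (β : ℝ) ^ 2)]
    have := nθ_le hc hα hρ β
    calc _ ≤ |ν| * (α ^ 2 + (β : ℝ) ^ 2) * (c₀ / (c₀ - 1) * ‖ρ β‖) := by gcongr
      _ = _ := by ring
  have h3 : ‖((ν * (α ^ 2 + (β : ℝ) ^ 2) : ℝ) : ℂ) * θ β‖ ^ 2 ≤ (c₀ / (c₀ - 1)) ^ 2 * ν ^ 2 * ((α ^ 2 + (β : ℝ) ^ 2) * ‖ρ β‖) ^ 2 := by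
    calc _ ≤ (c₀ / (c₀ - 1) * (|ν| * ((α ^ 2 + (β : ℝ) ^ 2) * ‖ρ β‖))) ^ 2 := by gcongr
      _ = _ := by rw [mul_pow, mul_pow, sq_abs]; ring
  have h4 : ‖Fs (bb α) α ν l θ β - ((ν * (α ^ 2 + (β : ℝ) ^ 2) : ℝ) : ℂ) * θ β‖ ^ 2 ≤
      2 * ‖Fs (bb α) α ν l θ β‖ ^ 2 + 2 * ‖((ν * (α ^ 2 + (β : ℝ) ^ 2) : ℝ) : ℂ) * θ β‖ ^ 2 := by
    refine (pow_le_pow_left₀ (norm_nonneg _) h1 2).trans ?_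
    nlinarith [sq_nonneg (‖Fs (bb α) α ν l θ β‖ - ‖((ν * (α ^ 2 + (β : ℝ) ^ 2) : ℝ) : ℂ) * θ β‖)]
  linarith

omit hα hc h hρ in
lemma csR {ρ : ℤ → ℂ} (hr : RD ρ) : ∑' β, ‖cs ρ β‖ ^ 2 ≤ ∑' β, ‖ρ β‖ ^ 2 := by
  have := I4 hr
  have h0 : 0 ≤ ∑' β, ‖dl ρ β‖ ^ 2 := tsum_nonneg (fun β => sq_nonneg _)
  linarith

lemma E4 : (∑' β : ℤ, (1 / 4) * (bb α β * ‖dl ρ β‖ ^ 2)) +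
      ∑' β : ℤ, (1 / 2) * (β * (bb α (β + 1) - bb α (β - 1))) * ‖ρ β‖ ^ 2 ≤
    √(∑' β, ‖cs ρ β - (l:ℂ) * θ β‖ ^ 2) *
      √(2 * (∑' β : ℤ, (β:ℝ) ^ 2 * ‖dl ρ β‖ ^ 2) + 2 * ∑' β, ‖ρ β‖ ^ 2) := by
  have hr := RDρ hc hα h hρ
  have hb := PB.bb hc hα
  have hg := hr.cs.sub (h.cmulc (l:ℂ))
  have hz : RD (fun β : ℤ => (β : ℂ) * dl ρ β + cs ρ β) := by
    have := (hr.dl.cmul PB.id).add hr.cs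
    simpa using this
  rw [← I3 hb l h hρ]
  refine (le_abs_self _).trans ((tsum_abs_le hg.nrm hz.nrm (fun β => ?_)).trans ?_)
  · rw [abs_neg, abs_mul, abs_of_pos (bb_pos hc hα β), abs_norm, abs_norm]
    refine (mul_le_of_le_one_left (abs_nonneg _) (bb_le_one α β)).trans (abs_reM _ _)
  · gcongr
    have c := csR hr
    have s1 := (hr.dl.nsq.pmul PB.id.sq).summable
    have s2 := hr.cs.nsq.summable
    have : ∑' β : ℤ, ‖(β : ℂ) * dl ρ β + cs ρ β‖ ^ 2 ≤
        ∑' β : ℤ, (2 * ((β:ℝ) ^ 2 * ‖dl ρ β‖ ^ 2) + 2 * ‖cs ρ β‖ ^ 2) := by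
      refine Summable.tsum_le_tsum (fun β => ?_) hz.nsq.summable ((s1.mul_left 2).add (s2.mul_left 2))
      have h1 := norm_add_le ((β : ℂ) * dl ρ β) (cs ρ β)
      have h2 : ‖(β : ℂ) * dl ρ β‖ ^ 2 = (β:ℝ) ^ 2 * ‖dl ρ β‖ ^ 2 := by
        rw [norm_mul, mul_pow, Complex.norm_intCast, sq_abs]
      rw [← h2]
      refine (pow_le_pow_left₀ (norm_nonneg _) h1 2).trans ?_
      nlinarith [sq_nonneg (‖(β : ℂ) * dl ρ β‖ - ‖cs ρ β‖)]
    rw [(s1.mul_left 2).tsum_add (s2.mul_left 2), tsum_mul_left, tsum_mul_left] at this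
    linarith

lemma E5 {k : ℝ} (hk : k = min |l| 1) : ∑' β : ℤ, (β:ℝ) ^ 2 * ‖dl ρ β‖ ^ 2 ≤
    4 * (1 - k ^ 2) * (∑' β : ℤ, (α ^ 2 + (β : ℝ) ^ 2) * ‖ρ β‖ ^ 2) + 4 * (∑' β, ‖ρ β‖ ^ 2) +
    8 * (√(∑' β : ℤ, ((α ^ 2 + (β : ℝ) ^ 2) * ‖ρ β‖) ^ 2) * √(∑' β, ‖cs ρ β - (l:ℂ) * θ β‖ ^ 2)) := by
  have hr := RDρ hc hα h hρ
  have hg := hr.cs.sub (h.cmulc (l:ℂ))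
  have hk0 : 0 ≤ k := hk ▸ le_min (abs_nonneg _) zero_le_one
  have hk1 : k ≤ 1 := hk ▸ min_le_right _ _
  have hkl : k ≤ |l| := hk ▸ min_le_left _ _
  rw [I5 hr]
  have t := tsum_abs_le (hr.nrm.pmul (PB.S2 α)) hg.nrm
    (f := fun β : ℤ => (β:ℝ) ^ 2 * (‖ρ β‖ * ‖cs ρ β - (l:ℂ) * θ β‖))
    (fun β => by
      have : 0 ≤ ‖cs ρ β - (l:ℂ) * θ β‖ := norm_nonneg _
      rw [abs_of_nonneg (by positivity), abs_of_nonneg (by positivity), abs_of_nonneg (by positivity),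
        ← mul_assoc]
      gcongr
      nlinarith)
  have pw : ∀ β : ℤ, k ^ 2 * ((β:ℝ) ^ 2 * ‖ρ β‖ ^ 2) - 2 * ((β:ℝ) ^ 2 * (‖ρ β‖ * ‖cs ρ β - (l:ℂ) * θ β‖)) ≤
      (β:ℝ) ^ 2 * ‖cs ρ β‖ ^ 2 := by
    intro β
    have a1 : |l| * ‖θ β‖ ≤ ‖cs ρ β‖ + ‖cs ρ β - (l:ℂ) * θ β‖ := by
      have := norm_sub_le (cs ρ β) (cs ρ β - (l:ℂ) * θ β)
      simpa using this
    have a2 : k * ‖ρ β‖ ≤ |l| * ‖θ β‖ := by gcongr; exact nρ_le hc hα hρ β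
    have a0 := norm_nonneg (ρ β)
    have b0 := norm_nonneg (cs ρ β)
    have d0 := norm_nonneg (cs ρ β - (l:ℂ) * θ β)
    generalize ‖cs ρ β - (l:ℂ) * θ β‖ = G at *
    generalize ‖cs ρ β‖ = C at *
    generalize ‖ρ β‖ = r at *
    have a3 : k ^ 2 * r ^ 2 - 2 * (r * G) ≤ C ^ 2 := by
      have a4 : k * r * G ≤ r * G := by
        have := mul_nonneg a0 d0
        nlinarith
      by_cases hh : k * r ≤ G
      · nlinarith [mul_nonneg hk0 a0, mul_nonneg a0 d0]
      · push Not at hh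
        have : (k * r - G) ^ 2 ≤ C ^ 2 := by
          apply pow_le_pow_left₀ <;> linarith
        nlinarith
    have := mul_le_mul_of_nonneg_left a3 (sq_nonneg (β:ℝ))
    linarith
  have s1 := (hr.nsq.pmul PB.id.sq).summable
  have s2 : Summable (fun β : ℤ => (β:ℝ) ^ 2 * (‖ρ β‖ * ‖cs ρ β - (l:ℂ) * θ β‖)) :=
    ((hr.nrm.prod hg.nrm (f := fun β => ‖ρ β‖ * ‖cs ρ β - (l:ℂ) * θ β‖) 1 0 (fun β => by simp)).pmul PB.id.sq).summable
  have s3 := (hr.cs.nsq.pmul PB.id.sq).summable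
  have t2 := Summable.tsum_le_tsum pw ((s1.mul_left _).sub (s2.mul_left 2)) s3
  rw [(s1.mul_left _).tsum_sub (s2.mul_left 2), tsum_mul_left, tsum_mul_left] at t2
  have t3 := (le_abs_self _).trans t
  have t4 : ∑' β : ℤ, (β:ℝ) ^ 2 * ‖ρ β‖ ^ 2 ≤ ∑' β : ℤ, (α ^ 2 + (β : ℝ) ^ 2) * ‖ρ β‖ ^ 2 := by
    refine Summable.tsum_le_tsum (fun β => ?_) s1 (hr.nsq.pmul (PB.S2 α)).summable
    gcongr; nlinarith
  have t5 : (1 - k ^ 2) * (∑' β : ℤ, (β:ℝ) ^ 2 * ‖ρ β‖ ^ 2) ≤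
      (1 - k ^ 2) * ∑' β : ℤ, (α ^ 2 + (β : ℝ) ^ 2) * ‖ρ β‖ ^ 2 := by
    gcongr; nlinarith
  linarith

lemma E6 {k W : ℝ} (hW : W = c₀ / (c₀ - 1)) (hk : k = min |l| 1) : (1 - k ^ 2) * (∑' β, ‖ρ β‖ ^ 2) ≤
    (∑' β, ‖dl ρ β‖ ^ 2) + 2 * W ^ 2 * (∑' β, (Sv α β ^ 1)⁻¹ * ‖ρ β‖ ^ 2) +
    4 * W * (√(∑' β, ‖ρ β‖ ^ 2) * √(∑' β, ‖cs ρ β - (l:ℂ) * θ β‖ ^ 2)) := by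
  have hr := RDρ hc hα h hρ
  have hg := hr.cs.sub (h.cmulc (l:ℂ))
  have hα1 : 1 ≤ α := by linarith
  have hW1 : 1 ≤ W := by rw [hW, le_div_iff₀ (by linarith)]; linarith
  have hd : 0 ≤ ∑' β, ‖dl ρ β‖ ^ 2 := tsum_nonneg (fun β => sq_nonneg _)
  have hT : 0 ≤ ∑' β, (Sv α β ^ 1)⁻¹ * ‖ρ β‖ ^ 2 := tsum_nonneg (fun β => by
    have := Sv_nonneg α β
    positivity)
  by_cases hl : 1 ≤ |l|
  · rw [min_eq_right hl] at hk
    have hW0 : 0 ≤ W := by linarith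
    have hz : (1 - k ^ 2) = 0 := by rw [hk]; ring
    rw [hz, zero_mul]; positivity
  push Not at hl
  rw [min_eq_left hl.le] at hk
  have hk0 : 0 ≤ k := hk ▸ abs_nonneg _
  have e4 := I4 hr
  have s1 := h.nsq.summable
  have s0 := hr.nsq.summable
  have sg : Summable (fun β => ‖cs ρ β - (l:ℂ) * θ β‖ ^ 2) := hg.nsq.summable
  have sTR : Summable (fun β => (Sv α β ^ 1)⁻¹ * ‖ρ β‖ ^ 2) := (hr.nsq.pmul (PB.inv_pow hα1 1)).summable
  have s2 : Summable (fun β : ℤ => ‖θ β‖ * ‖cs ρ β - (l:ℂ) * θ β‖) :=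
    ((h.nrm.prod hg.nrm (f := fun β => ‖θ β‖ * ‖cs ρ β - (l:ℂ) * θ β‖) 1 0 (fun β => by simp))).summable
  have cs1 := tsum_abs_le h.nrm hg.nrm (f := fun β : ℤ => ‖θ β‖ * ‖cs ρ β - (l:ℂ) * θ β‖)
    (fun β => by rw [abs_mul])
  have th1 : ∑' β, ‖θ β‖ ^ 2 ≤ W ^ 2 * ∑' β, ‖ρ β‖ ^ 2 := by
    rw [← tsum_mul_left]
    refine Summable.tsum_le_tsum (fun β => ?_) s1 (s0.mul_left _)
    rw [← mul_pow, hW]; gcongr; exact nθ_le hc hα hρ β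
  have th2 : ∑' β, ‖θ β‖ ^ 2 ≤ (∑' β, ‖ρ β‖ ^ 2) + 2 * W ^ 2 * ∑' β, (Sv α β ^ 1)⁻¹ * ‖ρ β‖ ^ 2 := by
    rw [← tsum_mul_left, ← s0.tsum_add (sTR.mul_left _)]
    refine Summable.tsum_le_tsum (fun β => ?_) s1 (s0.add (sTR.mul_left _))
    have h1 := nρ hc hα hρ β
    have h2 := bb_lower hc hα β
    rw [← hW] at h2
    have h3 := bb_pos hc hα β
    have h4 : (Sv α β)⁻¹ = 1 - bb α β := by unfold bb; ring
    have h5 := bb_le_one α β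
    rw [pow_one, h4, h1]
    generalize bb α β = b at *
    have key : 1 ≤ b ^ 2 + 2 * W ^ 2 * (1 - b) * b ^ 2 := by
      have : 1 ≤ (W * b) ^ 2 := one_le_pow₀ h2
      nlinarith
    have := mul_le_mul_of_nonneg_right key (sq_nonneg ‖θ β‖)
    nlinarith
  have gk : ∀ β, ‖cs ρ β‖ ^ 2 ≤ k ^ 2 * ‖θ β‖ ^ 2 + 2 * (‖θ β‖ * ‖cs ρ β - (l:ℂ) * θ β‖) + ‖cs ρ β - (l:ℂ) * θ β‖ ^ 2 := by
    intro β
    have a1 : ‖cs ρ β‖ ≤ k * ‖θ β‖ + ‖cs ρ β - (l:ℂ) * θ β‖ := by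
      have := norm_add_le ((l:ℂ) * θ β) (cs ρ β - (l:ℂ) * θ β)
      rw [hk]; simpa using this
    have a2 : 0 ≤ ‖θ β‖ * ‖cs ρ β - (l:ℂ) * θ β‖ := by positivity
    have := pow_le_pow_left₀ (norm_nonneg _) a1 2
    nlinarith
  have t1 := Summable.tsum_le_tsum gk hr.cs.nsq.summable (((s1.mul_left _).add (s2.mul_left 2)).add sg)
  rw [((s1.mul_left _).add (s2.mul_left 2)).tsum_add sg, (s1.mul_left _).tsum_add (s2.mul_left 2),
    tsum_mul_left, tsum_mul_left] at t1
  have gg : ∑' β, ‖cs ρ β - (l:ℂ) * θ β‖ ^ 2 ≤ 4 * W ^ 2 * ∑' β, ‖ρ β‖ ^ 2 := by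
    have pw : ∀ β, ‖cs ρ β - (l:ℂ) * θ β‖ ^ 2 ≤ 2 * ‖cs ρ β‖ ^ 2 + 2 * ‖θ β‖ ^ 2 := by
      intro β
      have a1 := norm_sub_le (cs ρ β) ((l:ℂ) * θ β)
      have a2 : ‖(l:ℂ) * θ β‖ ≤ ‖θ β‖ := by
        rw [norm_mul, Complex.norm_real]; exact mul_le_of_le_one_left (norm_nonneg _) hl.le
      have := pow_le_pow_left₀ (norm_nonneg _) (a1.trans (add_le_add_right a2 _)) 2
      nlinarith [sq_nonneg (‖cs ρ β‖ - ‖θ β‖)]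
    have t := Summable.tsum_le_tsum pw sg ((hr.cs.nsq.summable.mul_left 2).add (s1.mul_left 2))
    rw [(hr.cs.nsq.summable.mul_left 2).tsum_add (s1.mul_left 2), tsum_mul_left, tsum_mul_left] at t
    have := csR hr
    have hR0 : 0 ≤ ∑' β, ‖ρ β‖ ^ 2 := tsum_nonneg (fun β => sq_nonneg _)
    have : (∑' β, ‖ρ β‖ ^ 2) ≤ W ^ 2 * (∑' β, ‖ρ β‖ ^ 2) := le_mul_of_one_le_left hR0 (one_le_pow₀ hW1)
    linarith
  have hR0 : 0 ≤ ∑' β, ‖ρ β‖ ^ 2 := tsum_nonneg (fun β => sq_nonneg _)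
  have hG0 : 0 ≤ ∑' β, ‖cs ρ β - (l:ℂ) * θ β‖ ^ 2 := tsum_nonneg (fun β => sq_nonneg _)
  have cs2 := (le_abs_self _).trans cs1
  have r1 : √(∑' β, ‖θ β‖ ^ 2) ≤ W * √(∑' β, ‖ρ β‖ ^ 2) := by
    rw [← Real.sqrt_sq (by linarith : 0 ≤ W), ← Real.sqrt_mul (sq_nonneg W)]
    exact Real.sqrt_le_sqrt th1
  have r2 : √(∑' β, ‖cs ρ β - (l:ℂ) * θ β‖ ^ 2) ≤ 2 * W * √(∑' β, ‖ρ β‖ ^ 2) := by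
    rw [← Real.sqrt_sq (by linarith : 0 ≤ 2 * W), ← Real.sqrt_mul (sq_nonneg _)]
    exact Real.sqrt_le_sqrt (gg.trans (le_of_eq (by ring)))
  have r3 : ∑' β, ‖cs ρ β - (l:ℂ) * θ β‖ ^ 2 ≤ 2 * W * √(∑' β, ‖ρ β‖ ^ 2) * √(∑' β, ‖cs ρ β - (l:ℂ) * θ β‖ ^ 2) := by
    have := mul_le_mul_of_nonneg_right r2 (Real.sqrt_nonneg (∑' β, ‖cs ρ β - (l:ℂ) * θ β‖ ^ 2))
    rwa [Real.mul_self_sqrt hG0] at this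
  have r4 : √(∑' β, ‖θ β‖ ^ 2) * √(∑' β, ‖cs ρ β - (l:ℂ) * θ β‖ ^ 2) ≤ W * √(∑' β, ‖ρ β‖ ^ 2) * √(∑' β, ‖cs ρ β - (l:ℂ) * θ β‖ ^ 2) := by gcongr
  have hk2 : k ^ 2 ≤ 1 := pow_le_one₀ hk0 (by rw [hk]; exact hl.le)
  have t3 : k ^ 2 * (∑' β, ‖θ β‖ ^ 2) ≤ k ^ 2 * (∑' β, ‖ρ β‖ ^ 2) + 2 * W ^ 2 * ∑' β, (Sv α β ^ 1)⁻¹ * ‖ρ β‖ ^ 2 := by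
    have a1 := mul_le_mul_of_nonneg_left th2 (sq_nonneg k)
    have a2 : k ^ 2 * (2 * W ^ 2 * ∑' β, (Sv α β ^ 1)⁻¹ * ‖ρ β‖ ^ 2) ≤ 2 * W ^ 2 * ∑' β, (Sv α β ^ 1)⁻¹ * ‖ρ β‖ ^ 2 :=
      mul_le_of_le_one_left (by positivity) hk2
    linarith
  linarith

lemma E7 {x P : ℝ} (hx : 1 ≤ x) (hαx : α = x ^ 4)
    (hP : P = (∑' β : ℤ, (1 / 4) * (bb α β * ‖dl ρ β‖ ^ 2)) +
      ∑' β : ℤ, (1 / 2) * (β * (bb α (β + 1) - bb α (β - 1))) * ‖ρ β‖ ^ 2) :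
    (∑' β, (Sv α β ^ 1)⁻¹ * ‖ρ β‖ ^ 2) + (∑' β, ‖dl ρ β‖ ^ 2) ≤ (240 + 36 * (c₀ / (c₀ - 1))) * x ^ 2 * P := by
  have hr := RDρ hc hα h hρ
  have hα1 : 1 ≤ α := by linarith
  have hW1 : 1 ≤ c₀ / (c₀ - 1) := by rw [le_div_iff₀ (by linarith)]; linarith
  have t := T_bound hr hx hαx
  set W := c₀ / (c₀ - 1) with hW
  have hb := PB.bb hc hα
  have d1 : ∑' β, ‖dl ρ β‖ ^ 2 ≤ 4 * W * ∑' β : ℤ, (1 / 4) * (bb α β * ‖dl ρ β‖ ^ 2) := by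
    rw [← tsum_mul_left]
    refine Summable.tsum_le_tsum (fun β => ?_) hr.dl.nsq.summable
      ((hr.dl.nsq.pmul hb).pmul (PB.const _) |>.summable.mul_left _)
    have := mul_le_mul_of_nonneg_right (bb_lower hc hα β) (sq_nonneg ‖dl ρ β‖)
    rw [← hW] at this
    linarith
  have hb1 : PB (fun β => bb α (β + 1) - bb α (β - 1)) := PB.of_bdd 2 (fun β => by
    have a1 := bb_le_one α (β + 1)
    have a2 := bb_pos hc hα (β + 1)
    have a3 := bb_le_one α (β - 1)
    have a4 := bb_pos hc hα (β - 1)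
    rw [abs_le]; constructor <;> linarith)
  have v1 : ∑' β : ℤ, ((β:ℝ) ^ 2 * (Sv α β ^ 3)⁻¹) * ‖ρ β‖ ^ 2 ≤
      8 * ∑' β : ℤ, (1 / 2) * (β * (bb α (β + 1) - bb α (β - 1))) * ‖ρ β‖ ^ 2 := by
    rw [← tsum_mul_left]
    refine Summable.tsum_le_tsum (fun β => ?_) (hr.nsq.pmul (PB.id.sq.mul (PB.inv_pow hα1 3))).summable
      ((hr.nsq.pmul ((PB.const _).mul (PB.id.mul hb1))).summable.mul_left _)
    have := mul_le_mul_of_nonneg_right (bb_diff hα1 β) (sq_nonneg ‖ρ β‖)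
    rw [div_eq_mul_inv] at this
    linarith
  have V0 : 0 ≤ ∑' β : ℤ, ((β:ℝ) ^ 2 * (Sv α β ^ 3)⁻¹) * ‖ρ β‖ ^ 2 := tsum_nonneg (fun β => by
    have := Sv_nonneg α β
    positivity)
  have d0 : 0 ≤ ∑' β, ‖dl ρ β‖ ^ 2 := tsum_nonneg (fun β => by positivity)
  generalize (∑' β : ℤ, (1 / 4) * (bb α β * ‖dl ρ β‖ ^ 2)) = P1 at *
  generalize ∑' β : ℤ, (1 / 2) * (β * (bb α (β + 1) - bb α (β - 1))) * ‖ρ β‖ ^ 2 = P2 at *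
  generalize ∑' β : ℤ, ((β:ℝ) ^ 2 * (Sv α β ^ 3)⁻¹) * ‖ρ β‖ ^ 2 = V at *
  generalize ∑' β, ‖dl ρ β‖ ^ 2 = d at *
  generalize (∑' β, (Sv α β ^ 1)⁻¹ * ‖ρ β‖ ^ 2) = T at *
  have p1 : 0 ≤ P1 := by
    by_contra hh; push Not at hh
    have : 4 * W * P1 < 0 := by nlinarith
    linarith
  have p2 : 0 ≤ P2 := by linarith
  have hx2 : 1 ≤ x ^ 2 := one_le_pow₀ hx
  calc T + d ≤ 30 * x ^ 2 * V + 8 * x ^ 2 * d + d := by linarith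
    _ ≤ 30 * x ^ 2 * V + 8 * x ^ 2 * d + x ^ 2 * d := by nlinarith
    _ = 30 * x ^ 2 * V + 9 * x ^ 2 * d := by ring
    _ ≤ 30 * x ^ 2 * (8 * P2) + 9 * x ^ 2 * (4 * W * P1) := by gcongr
    _ ≤ 30 * x ^ 2 * (8 * P2) + 9 * x ^ 2 * (4 * W * P1) + (240 * x ^ 2 * P1 + 36 * W * x ^ 2 * P2) := by
      have : 0 ≤ 240 * x ^ 2 * P1 + 36 * W * x ^ 2 * P2 := by positivity
      linarith
    _ = _ := by rw [hP]; ring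

lemma E8 {y : ℝ} (hy : 0 < y) : y ^ 4 * (∑' β, ‖ρ β‖ ^ 2) ≤ (∑' β, (Sv α β ^ 1)⁻¹ * ‖ρ β‖ ^ 2) +
    y ^ 12 * ∑' β : ℤ, (α ^ 2 + (β : ℝ) ^ 2) * ‖ρ β‖ ^ 2 := by
  have hr := RDρ hc hα h hρ
  have hα1 : 1 ≤ α := by linarith
  have s1 := (hr.nsq.pmul (PB.inv_pow hα1 1)).summable
  have s2 := (hr.nsq.pmul (PB.S2 α)).summable
  rw [← tsum_mul_left, ← tsum_mul_left, ← s1.tsum_add (s2.mul_left _)]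
  refine Summable.tsum_le_tsum (fun β => ?_) (hr.nsq.summable.mul_left _) (s1.add (s2.mul_left _))
  rw [← mul_assoc, ← add_mul, ← Sv_sq]
  gcongr
  have h0 := Sv_pos hα1 β
  generalize Sv α β = s at *
  rw [pow_one]
  by_cases hh : s * y ^ 4 ≤ 1
  · have : y ^ 4 ≤ s⁻¹ := by rw [← one_div, le_div_iff₀ h0]; linarith
    have : 0 ≤ y ^ 12 * s ^ 2 := by positivity
    linarith
  · push Not at hh
    have : 1 ≤ (s * y ^ 4) ^ 2 := one_le_pow₀ hh.le
    have h3 : y ^ 4 * 1 ≤ y ^ 4 * (s * y ^ 4) ^ 2 := by gcongr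
    have h4 : 0 < s⁻¹ := by positivity
    nlinarith
end stat


set_option maxHeartbeats 1000000 in
theorem static_est {c₀ : ℝ} (hc : 1 < c₀) : ∃ e : ℝ, 0 < e ∧ e ≤ 1 / 2 ∧
    ∀ y : ℝ, 0 < y → y ^ 2 ≤ e ^ 4 → ∀ α : ℝ, c₀ ≤ α → ∀ (l : ℝ) (θ : ℤ → ℂ), RD θ →
      e ^ 8 * y ^ 12 * (∑' β, ‖(bb α β : ℂ) * θ β‖ ^ 2) ≤ ∑' β, ‖Fs (bb α) α (y ^ 14) l θ β‖ ^ 2 ∧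
      (α * y ^ 4 ≤ 2 → e ^ 6 * y ^ 34 * (∑' β : ℤ, ((α ^ 2 + (β : ℝ) ^ 2) * ‖(bb α β : ℂ) * θ β‖) ^ 2) ≤
        9 * ∑' β, ‖Fs (bb α) α (y ^ 14) l θ β‖ ^ 2) := by
  obtain ⟨W, hW⟩ : ∃ W, W = c₀ / (c₀ - 1) := ⟨_, rfl⟩
  have hW1 : 1 ≤ W := by rw [hW, le_div_iff₀ (by linarith)]; linarith
  obtain ⟨C₁, hC₁⟩ : ∃ C₁, C₁ = 240 + 36 * W := ⟨_, rfl⟩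
  have hC1 : 1 ≤ C₁ := by linarith
  have hW2 : 1 ≤ W ^ 2 := one_le_pow₀ hW1
  have hKpos : 4096 ≤ 4096 * C₁ * W ^ 2 := by nlinarith
  obtain ⟨e, he⟩ : ∃ e, e = 1 / (4096 * C₁ * W ^ 2) := ⟨_, rfl⟩
  have e0 : 0 < e := by rw [he]; positivity
  have eK : e * (4096 * C₁ * W ^ 2) = 1 := by rw [he]; field_simp
  have e1 : e ≤ 1 / 2 := by nlinarith
  have e3 : e ^ 3 ≤ e := pow_le_of_le_one e0.le (by linarith) (by norm_num)
  have eb : 2 * (1008 * C₁ * W ^ 2 * e ^ 3) < 1 := by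
    have : 2 * (1008 * C₁ * W ^ 2 * e ^ 3) ≤ 2 * (1008 * C₁ * W ^ 2 * e) := by gcongr
    nlinarith
  refine ⟨e, e0, e1, fun y hy hye α hα l θ hθ => ?_⟩
  obtain ⟨ρ, hρ⟩ : ∃ ρ : ℤ → ℂ, ρ = fun β => (bb α β : ℂ) * θ β := ⟨_, rfl⟩
  have hρβ : ∀ β, (bb α β : ℂ) * θ β = ρ β := fun β => by rw [hρ]
  simp only [hρβ]
  have hα1 : 1 ≤ α := by linarith
  obtain ⟨x, hx, hxα⟩ : ∃ x : ℝ, 1 ≤ x ∧ α = x ^ 4 :=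
    ⟨√(√α), Real.one_le_sqrt.mpr (Real.one_le_sqrt.mpr hα1), by
      rw [show (4:ℕ) = 2 * 2 by norm_num, pow_mul, Real.sq_sqrt (Real.sqrt_nonneg _), Real.sq_sqrt (by linarith)]⟩
  have hν : 0 ≤ y ^ 14 := by positivity
  have hr := RDρ hc hα hθ hρ
  obtain ⟨k, hk⟩ : ∃ k, k = min |l| 1 := ⟨_, rfl⟩
  obtain ⟨P, hP⟩ : ∃ P, P = (∑' β : ℤ, (1 / 4) * (bb α β * ‖dl ρ β‖ ^ 2)) +
      ∑' β : ℤ, (1 / 2) * (β * (bb α (β + 1) - bb α (β - 1))) * ‖ρ β‖ ^ 2 := ⟨_, rfl⟩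
  have q1 := E1 hc hα _ l hθ hρ hν
  have q2 := E2_s2 hc hα _ l hθ hρ hν
  have q3 := E3 hc hα (y ^ 14) l hθ hρ
  have q4 := E4 hc hα l hθ hρ
  have q5 := E5 hc hα l hθ hρ hk
  have q6 := E6 hc hα l hθ hρ hW hk
  have q7 := E7 hc hα hθ hρ hx hxα hP
  have q8 := E8 hc hα hθ hρ hy
  rw [← hP] at q4
  have q9 := I4 hr
  have T0 : 0 ≤ ∑' β, (Sv α β ^ 1)⁻¹ * ‖ρ β‖ ^ 2 := tsum_nonneg (fun β => by
    have := Sv_nonneg α β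
    positivity)
  have cs0 : 0 ≤ ∑' β, ‖cs ρ β‖ ^ 2 := tsum_nonneg (fun β => by positivity)
  have sq : ∀ u : ℤ → ℝ, (∀ β, 0 ≤ u β) → ∃ s : ℝ, 0 ≤ s ∧ ∑' β, u β = s ^ 2 := fun u hu =>
    ⟨√(∑' β, u β), Real.sqrt_nonneg _, (Real.sq_sqrt (tsum_nonneg hu)).symm⟩
  obtain ⟨r, r0, er⟩ := sq (fun β => ‖ρ β‖ ^ 2) (fun β => by positivity)
  obtain ⟨f, f0, ef⟩ := sq (fun β => ‖Fs (bb α) α (y ^ 14) l θ β‖ ^ 2) (fun β => by positivity)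
  obtain ⟨p, p0, ep⟩ := sq (fun β : ℤ => (α ^ 2 + (β : ℝ) ^ 2) * ‖ρ β‖ ^ 2) (fun β => by positivity)
  obtain ⟨m, m0, em⟩ := sq (fun β : ℤ => ((α ^ 2 + (β : ℝ) ^ 2) * ‖ρ β‖) ^ 2) (fun β => by positivity)
  obtain ⟨D, D0, eD⟩ := sq (fun β => ‖dl ρ β‖ ^ 2) (fun β => by positivity)
  obtain ⟨g, g0, eg⟩ := sq (fun β => ‖cs ρ β - (l:ℂ) * θ β‖ ^ 2) (fun β => by positivity)
  obtain ⟨n, n0, en⟩ := sq (fun β : ℤ => (β:ℝ) ^ 2 * ‖dl ρ β‖ ^ 2) (fun β => by positivity)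
  simp only [er, ef, ep, em, eD, eg, en, Real.sqrt_sq, r0, f0, p0, m0, D0, g0, n0, ← hW, ← hC₁] at q1 q2 q3 q4 q5 q6 q7 q8 q9 ⊢
  generalize ∑' β, (Sv α β ^ 1)⁻¹ * ‖ρ β‖ ^ 2 = T at *
  clear er ef ep em eD eg en hP
  have q4' : P ≤ 4 * g * (n + r) := by
    refine q4.trans ?_
    have : √(2 * n ^ 2 + 2 * r ^ 2) ≤ 4 * (n + r) :=
      Real.sqrt_le_iff.mpr ⟨by positivity, by nlinarith [mul_nonneg n0 r0]⟩
    calc _ ≤ g * (4 * (n + r)) := by gcongr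
      _ = _ := by ring
  subst hxα
  have main : e ^ 4 * y ^ 6 * r ≤ f := by
    by_contra hh; push Not at hh
    have hr0 : 0 < r := by
      rcases r0.eq_or_lt with h0 | h0
      · rw [← h0] at hh; simp at hh; linarith
      · exact h0
    have r2 : 0 < r ^ 2 := by positivity
    refine alg1 (W := W) (C₁ := C₁) (e := e) (x := x) (y := y) (f := f / r) (p := p / r) (m := m / r) (D := D / r)
      (g := g / r) (n := n / r) (ε := 1 - k ^ 2) (P := P / r ^ 2) (Q := (T + D ^ 2) / r ^ 2)
      hW1 hC1 e0 eb e1 hx hy hye (by positivity) (by positivity) (by positivity) (by positivity)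
      (by positivity) (by positivity) ?_ ?_ ?_ ?_ ?_ ?_ ?_ ?_ ?_ ?_
    · rw [div_pow]; gcongr; linarith
    · refine le_of_mul_le_mul_right (a := r ^ 2) ?_ r2
      field_simp; linarith
    · refine le_of_mul_le_mul_right (a := r ^ 2) ?_ r2
      field_simp; linarith
    · refine le_of_mul_le_mul_right (a := r ^ 2) ?_ r2
      field_simp; linarith
    · refine le_of_mul_le_mul_right (a := r ^ 2) ?_ r2
      field_simp; linarith
    · refine le_of_mul_le_mul_right (a := r ^ 2) ?_ r2
      field_simp; linarith
    · refine le_of_mul_le_mul_right (a := r ^ 2) ?_ r2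
      field_simp
      have : D ^ 2 ≤ 2 * W ^ 2 * D ^ 2 := le_mul_of_one_le_left (by positivity) (by linarith)
      linarith
    · refine le_of_mul_le_mul_right (a := r ^ 2) ?_ r2
      field_simp; linarith
    · refine le_of_mul_le_mul_right (a := r ^ 2) ?_ r2
      field_simp
      have : 0 ≤ D ^ 2 := by positivity
      linarith
    · rw [div_le_iff₀ hr0]; linarith
  refine ⟨?_, fun hαy => ?_⟩
  · have := pow_le_pow_left₀ (by positivity) main 2
    calc _ = (e ^ 4 * y ^ 6 * r) ^ 2 := by ring
      _ ≤ _ := this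
  · have hD : D ≤ 2 * r := by
      refine (sq_le_sq₀ D0 (by positivity)).mp ?_
      nlinarith
    -- scaled
    obtain ⟨M, hM⟩ : ∃ M, M = y ^ 14 * m := ⟨_, rfl⟩
    have M0 : 0 ≤ M := by rw [hM]; positivity
    have a1 : M ^ 2 ≤ M * f + y ^ 14 * (x ^ 4 * (p * D)) := by
      have := mul_le_mul_of_nonneg_left q2 hν
      rw [hM]; linarith
    have hp : e ^ 2 * y ^ 10 * p ≤ f := by
      refine (sq_le_sq₀ (by positivity) f0).mp ?_
      calc (e ^ 2 * y ^ 10 * p) ^ 2 = e ^ 4 * y ^ 6 * (y ^ 14 * p ^ 2) := by ring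
        _ ≤ e ^ 4 * y ^ 6 * (r * f) := by gcongr
        _ = (e ^ 4 * y ^ 6 * r) * f := by ring
        _ ≤ f * f := by gcongr
        _ = _ := by ring
    have a2 : e ^ 6 * y ^ 6 * (y ^ 14 * (x ^ 4 * (p * D))) ≤ 4 * f ^ 2 := by
      calc e ^ 6 * y ^ 6 * (y ^ 14 * (x ^ 4 * (p * D))) ≤ e ^ 6 * y ^ 6 * (y ^ 14 * (x ^ 4 * (p * (2 * r)))) := by gcongr
        _ = 2 * (x ^ 4 * y ^ 4) * (e ^ 2 * y ^ 10 * p) * (e ^ 4 * y ^ 6 * r) := by ring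
        _ ≤ 2 * 2 * f * f := by gcongr
        _ = _ := by ring
    have a3 : M ^ 2 ≤ f ^ 2 + 2 * (y ^ 14 * (x ^ 4 * (p * D))) := by nlinarith [sq_nonneg (M - f)]
    have a4 : e ^ 6 * y ^ 6 ≤ 1 := by
      have h1 : e ^ 6 ≤ 1 := pow_le_one₀ e0.le (by linarith)
      have h4 : e ^ 4 ≤ 1 := pow_le_one₀ e0.le (by linarith)
      have h2 : y ^ 6 ≤ 1 := by
        calc y ^ 6 = (y ^ 2) ^ 3 := by ring
          _ ≤ 1 := pow_le_one₀ (by positivity) (by linarith)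
      calc _ ≤ (1:ℝ) * 1 := by gcongr
        _ = 1 := by ring
    have a5 : e ^ 6 * y ^ 6 * f ^ 2 ≤ f ^ 2 := mul_le_of_le_one_left (by positivity) a4
    have a6 := mul_le_mul_of_nonneg_left a3 (show 0 ≤ e ^ 6 * y ^ 6 by positivity)
    calc e ^ 6 * y ^ 34 * m ^ 2 = e ^ 6 * y ^ 6 * M ^ 2 := by rw [hM]; ring
      _ ≤ _ := by linarith


structure UF (a b : ℝ) (f : ℝ → ℤ → ℂ) : Prop where
  bd : ∀ k : ℕ, ∃ M : ℝ, ∀ s ∈ Set.Icc a b, ∀ β : ℤ, (1 + (β : ℝ) ^ 2) ^ k * ‖f s β‖ ≤ M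
  ct : ∀ β : ℤ, ContinuousOn (fun s => f s β) (Set.Icc a b)

lemma UF.rd {a b : ℝ} {f : ℝ → ℤ → ℂ} (h : UF a b f) {s : ℝ} (hs : s ∈ Set.Icc a b) : RD (f s) := by
  intro k
  obtain ⟨M, hM⟩ := h.bd k
  exact ⟨M, hM s hs⟩

lemma UF.mono {a b a' b' : ℝ} {f : ℝ → ℤ → ℂ} (h : UF a b f) (hs : Set.Icc a' b' ⊆ Set.Icc a b) :
    UF a' b' f :=
  ⟨fun k => (h.bd k).imp fun _ hM s hs' => hM s (hs hs'), fun β => (h.ct β).mono hs⟩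

/-- a summable dominating sequence -/
lemma UF.dom {a b : ℝ} {f : ℝ → ℤ → ℂ} (h : UF a b f) : ∃ w : ℤ → ℝ, RD w ∧ (∀ β, 0 ≤ w β) ∧
    ∀ s ∈ Set.Icc a b, ∀ β, ‖f s β‖ ≤ w β := by
  rcases (Set.Icc a b).eq_empty_or_nonempty with he | ⟨s₀, hs₀⟩
  · refine ⟨fun _ => 0, fun k => ⟨0, by simp⟩, by simp, by simp [he]⟩
  have bd : ∀ β, BddAbove (Set.range (fun s : Set.Icc a b => ‖f s β‖)) := by
    intro β
    obtain ⟨M, hM⟩ := h.bd 0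
    exact ⟨M, by rintro _ ⟨s, rfl⟩; simpa using hM s s.2 β⟩
  have hle : ∀ s ∈ Set.Icc a b, ∀ β, ‖f s β‖ ≤ ⨆ s : Set.Icc a b, ‖f s β‖ := fun s hs β =>
    le_ciSup (bd β) ⟨s, hs⟩
  have h0 : ∀ β, 0 ≤ ⨆ s : Set.Icc a b, ‖f s β‖ := fun β => (norm_nonneg _).trans (hle s₀ hs₀ β)
  refine ⟨fun β => ⨆ s : Set.Icc a b, ‖f s β‖, fun k => ?_, h0, hle⟩
  obtain ⟨M, hM⟩ := h.bd k
  refine ⟨M, fun β => ?_⟩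
  rw [Real.norm_of_nonneg (h0 β), mul_comm, ← le_div_iff₀ (by positivity)]
  have : Nonempty (Set.Icc a b) := ⟨⟨s₀, hs₀⟩⟩
  refine ciSup_le fun s => ?_
  rw [le_div_iff₀ (by positivity), mul_comm]
  exact hM s s.2 β

noncomputable def NN (a b : ℝ) (f : ℝ → ℤ → ℂ) : ℝ := ∑' β, ∫ s in a..b, ‖f s β‖ ^ 2

lemma RD.rnsq {w : ℤ → ℝ} (hw : RD w) : Summable (fun β => w β ^ 2) := by
  have h : RD (fun β => w β ^ 2) := hw.prod hw 1 0 (fun β => by simp [sq])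
  exact h.summable

lemma UF.hasSum {a b : ℝ} (hab : a < b) {f : ℝ → ℤ → ℂ} (h : UF a b f) :
    HasSum (fun β => ∫ s in a..b, ‖f s β‖ ^ 2) (∫ s in a..b, ∑' β, ‖f s β‖ ^ 2) := by
  obtain ⟨w, hw, w0, hwb⟩ := h.dom
  have hsq := hw.rnsq
  have sub : Set.uIoc a b ⊆ Set.Icc a b := by
    rw [Set.uIoc_of_le hab.le]; exact Set.Ioc_subset_Icc_self
  refine intervalIntegral.hasSum_integral_of_dominated_convergence (fun β _ => w β ^ 2) ?_ ?_ ?_ ?_ ?_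
  · intro β
    exact (((h.ct β).norm.pow 2).mono sub).aestronglyMeasurable measurableSet_uIoc
  · intro β
    refine Filter.Eventually.of_forall fun s hs => ?_
    rw [Real.norm_of_nonneg (by positivity)]
    exact pow_le_pow_left₀ (norm_nonneg _) (hwb s (sub hs) β) 2
  · exact Filter.Eventually.of_forall fun s hs => hsq
  · simp
  · refine Filter.Eventually.of_forall fun s hs => ?_
    exact ((h.rd (sub hs)).nsq.summable).hasSum

lemma UF.NN_eq {a b : ℝ} (hab : a < b) {f : ℝ → ℤ → ℂ} (h : UF a b f) :
    NN a b f = ∫ s in a..b, ∑' β, ‖f s β‖ ^ 2 := (h.hasSum hab).tsum_eq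

lemma UF.contsum {a b : ℝ} {f : ℝ → ℤ → ℂ} (h : UF a b f) :
    ContinuousOn (fun s => ∑' β, ‖f s β‖ ^ 2) (Set.Icc a b) := by
  obtain ⟨w, hw, w0, hwb⟩ := h.dom
  refine continuousOn_tsum (u := fun β => w β ^ 2) (fun β => (h.ct β).norm.pow 2) hw.rnsq ?_
  intro β s hs
  rw [Real.norm_of_nonneg (by positivity)]
  exact pow_le_pow_left₀ (norm_nonneg _) (hwb s hs β) 2

lemma parseval_sum {a b : ℝ} (hab : a < b) {f : ℝ → ℤ → ℂ} (h : UF a b f) :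
    HasSum (fun n : ℤ => ∑' β, ‖fourierCoeffOn hab (fun s => f s β) n‖ ^ 2) ((b - a)⁻¹ * NN a b f) := by
  have key : ∀ β, HasSum (fun n => ‖fourierCoeffOn hab (fun s => f s β) n‖ ^ 2)
      ((b - a)⁻¹ * ∫ s in a..b, ‖f s β‖ ^ 2) := by
    intro β
    have := hasSum_sq_fourierCoeffOn hab (f := fun s => f s β) ?_
    · simpa [smul_eq_mul] using this
    · have hc := h.ct β
      obtain ⟨M, hM⟩ := h.bd 0
      refine MeasureTheory.MemLp.of_bound ((hc.mono Set.Ioc_subset_Icc_self).aestronglyMeasurable measurableSet_Ioc) M ?_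
      refine (MeasureTheory.ae_restrict_iff' measurableSet_Ioc).mpr (Filter.Eventually.of_forall fun s hs => ?_)
      simpa using hM s (Set.Ioc_subset_Icc_self hs) β
  have hs : Summable (fun p : ℤ × ℤ => ‖fourierCoeffOn hab (fun s => f s p.1) p.2‖ ^ 2) := by
    refine (summable_prod_of_nonneg (fun p => by positivity)).mpr ⟨fun β => (key β).summable, ?_⟩
    simp only [(key _).tsum_eq]
    exact ((h.hasSum hab).summable).mul_left _
  have h2 : (b - a)⁻¹ * NN a b f = ∑' n : ℤ, ∑' β, ‖fourierCoeffOn hab (fun s => f s β) n‖ ^ 2 := by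
    rw [Summable.tsum_comm (f := fun β n => ‖fourierCoeffOn hab (fun s => f s β) n‖ ^ 2) hs]
    simp only [(key _).tsum_eq, tsum_mul_left, NN]
  rw [h2]
  have := hs.prod_symm
  exact (this.prod).hasSum

lemma NN_compare {a b : ℝ} (hab : a < b) {f g : ℝ → ℤ → ℂ} (hf : UF a b f) (hg : UF a b g) (c : ℝ)
    (H : ∀ n : ℤ, c * ∑' β, ‖fourierCoeffOn hab (fun s => f s β) n‖ ^ 2 ≤
      ∑' β, ‖fourierCoeffOn hab (fun s => g s β) n‖ ^ 2) : c * NN a b f ≤ NN a b g := by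
  have := hasSum_le H ((parseval_sum hab hf).mul_left c) (parseval_sum hab hg)
  have hp : 0 < b - a := by linarith
  have h2 := mul_le_mul_of_nonneg_left this hp.le
  field_simp at h2
  linarith


lemma fc_int {a b : ℝ} (hab : a < b) {f : ℝ → ℂ} (hf : ContinuousOn f (Set.Icc a b)) (n : ℤ) :
    IntervalIntegrable (fun x => fourier (-n) (x : AddCircle (b - a)) • f x) MeasureTheory.volume a b := by
  apply ContinuousOn.intervalIntegrable
  rw [Set.uIcc_of_le hab.le]
  have hq : Continuous (fun x : ℝ => fourier (-n) (x : AddCircle (b - a))) :=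
    (fourier (T := b - a) (-n)).continuous.comp (AddCircle.continuous_mk' (b - a))
  exact ContinuousOn.smul hq.continuousOn hf

lemma fc_add {a b : ℝ} (hab : a < b) {f g : ℝ → ℂ} (hf : ContinuousOn f (Set.Icc a b)) (hg : ContinuousOn g (Set.Icc a b)) (n : ℤ) :
    fourierCoeffOn hab (fun s => f s + g s) n = fourierCoeffOn hab f n + fourierCoeffOn hab g n := by
  simp only [fourierCoeffOn_eq_integral, smul_add]
  rw [intervalIntegral.integral_add (fc_int hab hf n) (fc_int hab hg n), smul_add]

lemma fc_mul {a b : ℝ} (hab : a < b) (f : ℝ → ℂ) (c : ℂ) (n : ℤ) :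
    fourierCoeffOn hab (fun s => c * f s) n = c * fourierCoeffOn hab f n :=
  fourierCoeffOn.const_mul f c n hab

lemma fc_deriv {a b : ℝ} (hab : a < b) {f f' : ℝ → ℂ} (hf : ∀ s ∈ Set.Icc a b, HasDerivAt f (f' s) s)
    (hf' : ContinuousOn f' (Set.Icc a b)) (ha : f a = 0) (hb : f b = 0) (n : ℤ) :
    fourierCoeffOn hab f' n = (2 * Real.pi * Complex.I * n / (b - a)) * fourierCoeffOn hab f n := by
  have hi : IntervalIntegrable f' MeasureTheory.volume a b :=
    ContinuousOn.intervalIntegrable (by rwa [Set.uIcc_of_le hab.le])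
  have hba : (b:ℂ) - a ≠ 0 := by
    rw [← Complex.ofReal_sub]; exact_mod_cast (sub_pos.mpr hab).ne'
  by_cases hn : n = 0
  · subst hn
    rw [fourierCoeffOn_eq_integral]
    have := intervalIntegral.integral_eq_sub_of_hasDerivAt (f := f) (f' := f')
      (by rwa [Set.uIcc_of_le hab.le]) hi
    simp [this, ha, hb]
  · have := fourierCoeffOn_of_hasDerivAt hab hn (f := f) (f' := f') (by rwa [Set.uIcc_of_le hab.le]) hi
    rw [this, ha, hb]
    have hn' : (n:ℂ) ≠ 0 := by exact_mod_cast hn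
    have hpi : (Real.pi : ℂ) ≠ 0 := by exact_mod_cast Real.pi_ne_zero
    have hI := Complex.I_ne_zero
    field_simp
    ring

lemma fc_bound {a b : ℝ} (hab : a < b) {f : ℝ → ℂ} {M : ℝ} (hf : ∀ s ∈ Set.Icc a b, ‖f s‖ ≤ M) (n : ℤ) :
    ‖fourierCoeffOn hab f n‖ ≤ M := by
  rw [fourierCoeffOn_eq_integral, norm_smul]
  have hp : 0 < b - a := by linarith
  have := intervalIntegral.norm_integral_le_of_norm_le_const (a := a) (b := b) (C := M)
    (f := fun x => fourier (-n) (x : AddCircle (b - a)) • f x) ?_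
  · rw [Real.norm_of_nonneg (by positivity)]
    calc _ ≤ 1 / (b - a) * (M * |b - a|) := by gcongr
      _ = M := by rw [abs_of_pos hp]; field_simp
  · intro x hx
    rw [Set.uIoc_of_le hab.le] at hx
    rw [norm_smul]
    have : ‖fourier (-n) (x : AddCircle (b - a))‖ = 1 := by
      rw [fourier_apply]; exact Circle.norm_coe _
    rw [this, one_mul]
    exact hf x (Set.Ioc_subset_Icc_self hx)

lemma UF.fc_rd {a b : ℝ} (hab : a < b) {f : ℝ → ℤ → ℂ} (h : UF a b f) (n : ℤ) :
    RD (fun β => fourierCoeffOn hab (fun s => f s β) n) := by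
  obtain ⟨w, hw, w0, hwb⟩ := h.dom
  refine hw.of_le 1 0 (fun β => ?_)
  rw [pow_zero, mul_one, one_mul, Real.norm_of_nonneg (w0 β)]
  exact fc_bound hab (fun s hs => hwb s hs β) n


lemma UF.of_le {a b : ℝ} {f g : ℝ → ℤ → ℂ} (h : UF a b f) (K : ℝ) (m : ℕ)
    (hg : ∀ s ∈ Set.Icc a b, ∀ β : ℤ, ‖g s β‖ ≤ K * (1 + (β : ℝ) ^ 2) ^ m * ‖f s β‖)
    (hc : ∀ β : ℤ, ContinuousOn (fun s => g s β) (Set.Icc a b)) : UF a b g := by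
  obtain ⟨w, hw, w0, hwb⟩ := h.dom
  refine ⟨fun k => ?_, hc⟩
  have hw2 : RD (fun β : ℤ => |K| * (1 + (β : ℝ) ^ 2) ^ m * w β) :=
    hw.of_le |K| m (fun β => by
      rw [norm_mul, Real.norm_of_nonneg (show 0 ≤ |K| * (1 + (β : ℝ) ^ 2) ^ m by positivity)])
  obtain ⟨M, hM⟩ := hw2 k
  refine ⟨M, fun s hs β => le_trans ?_ (hM β)⟩
  have h1 := w0 β
  rw [Real.norm_of_nonneg (by positivity)]
  refine mul_le_mul_of_nonneg_left ((hg s hs β).trans ?_) (by positivity)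
  have h2 := hwb s hs β
  calc K * (1 + (β : ℝ) ^ 2) ^ m * ‖f s β‖ ≤ |K| * (1 + (β : ℝ) ^ 2) ^ m * ‖f s β‖ := by
        gcongr; exact le_abs_self K
    _ ≤ |K| * (1 + (β : ℝ) ^ 2) ^ m * w β := by gcongr

lemma UF.add {a b : ℝ} {f g : ℝ → ℤ → ℂ} (hf : UF a b f) (hg : UF a b g) :
    UF a b (fun s β => f s β + g s β) := by
  refine ⟨fun k => ?_, fun β => (hf.ct β).add (hg.ct β)⟩
  obtain ⟨C, hC⟩ := hf.bd k
  obtain ⟨D, hD⟩ := hg.bd k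
  refine ⟨C + D, fun s hs β => ?_⟩
  calc _ ≤ (1 + (β : ℝ) ^ 2) ^ k * (‖f s β‖ + ‖g s β‖) := by gcongr; exact norm_add_le _ _
    _ ≤ _ := by rw [mul_add]; exact add_le_add (hC s hs β) (hD s hs β)

/-- multiplication by a symbol in `β` and a continuous scalar in `s` -/
lemma UF.pc {a b : ℝ} {f : ℝ → ℤ → ℂ} (hf : UF a b f) {p : ℤ → ℝ} (hp : PB p) {c : ℝ → ℝ}
    (hc : ContinuousOn c (Set.Icc a b)) : UF a b (fun s β => ((c s * p β : ℝ) : ℂ) * f s β) := by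
  obtain ⟨K, m, K0, hK⟩ := hp
  obtain ⟨M, hM⟩ := (isCompact_Icc.exists_bound_of_continuousOn hc)
  refine hf.of_le (|M| * K) m (fun s hs β => ?_) (fun β => ?_)
  · rw [norm_mul, Complex.norm_real, norm_mul]
    have h1 := (hM s hs).trans (le_abs_self M)
    have h2 : ‖p β‖ ≤ _ := hK β
    calc _ ≤ (|M| * (K * (1 + (β : ℝ) ^ 2) ^ m)) * ‖f s β‖ := by gcongr
      _ = _ := by ring
  · refine ContinuousOn.mul ?_ (hf.ct β)
    exact Complex.continuous_ofReal.comp_continuousOn (hc.mul continuousOn_const)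

structure Sol (α ν L : ℝ) (μ : ℝ → ℝ) (ϑ : ℝ → ℤ → ℂ) : Prop where
  bd : ∀ k : ℕ, ∃ M : ℝ, ∀ s ∈ Set.Icc 0 L, ∀ β : ℤ, (1 + (β : ℝ) ^ 2) ^ k * ‖ϑ s β‖ ≤ M
  de : ∀ s ∈ Set.Icc 0 L, ∀ β : ℤ, HasDerivAt (fun s => ϑ s β) (-Fs (bb α) α (μ s) 0 (ϑ s) β) s
  mc : ContinuousOn μ (Set.Icc 0 L)
  ml : ∀ s ∈ Set.Icc 0 L, ν ≤ μ s
  mu : ∀ s ∈ Set.Icc 0 L, μ s ≤ 2 * ν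
  mL : ∀ s ∈ Set.Icc 0 L, ∀ r ∈ Set.Icc 0 L, |μ s - μ r| ≤ 4 * ν ^ 2 * |s - r|

lemma Sol.uf {α ν L : ℝ} {μ : ℝ → ℝ} {ϑ : ℝ → ℤ → ℂ} (h : Sol α ν L μ ϑ) : UF 0 L ϑ :=
  ⟨h.bd, fun β s hs => (h.de s hs β).continuousAt.continuousWithinAt⟩

noncomputable def EE (α : ℝ) (x : ℤ → ℂ) : ℝ := ∑' β, bb α β * ‖x β‖ ^ 2

lemma RD.pnsq {x : ℤ → ℂ} (h : RD x) {p : ℤ → ℝ} (hp : PB p) : Summable (fun β => p β * ‖x β‖ ^ 2) :=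
  (h.nsq.pmul hp).summable

lemma Sol.energy_cont {c₀ α ν L : ℝ} (hc : 1 < c₀) (hα : c₀ ≤ α) {μ : ℝ → ℝ} {ϑ : ℝ → ℤ → ℂ}
    (h : Sol α ν L μ ϑ) : ContinuousOn (fun s => EE α (ϑ s)) (Set.Icc 0 L) := by
  obtain ⟨w, hw, w0, hwb⟩ := h.uf.dom
  refine continuousOn_tsum (u := fun β => w β ^ 2) (fun β => continuousOn_const.mul ((h.uf.ct β).norm.pow 2)) hw.rnsq ?_
  intro β s hs
  have h1 := bb_pos hc hα β
  have h2 := bb_le_one α β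
  rw [Real.norm_of_nonneg (by positivity)]
  calc _ ≤ 1 * w β ^ 2 := by gcongr; exact hwb s hs β
    _ = _ := one_mul _

lemma Sol.energy_deriv {c₀ α ν L : ℝ} (hc : 1 < c₀) (hα : c₀ ≤ α) (hν : 0 < ν) {μ : ℝ → ℝ} {ϑ : ℝ → ℤ → ℂ}
    (h : Sol α ν L μ ϑ) {s : ℝ} (hs : s ∈ Set.Ioo 0 L) :
    HasDerivAt (fun s => EE α (ϑ s)) (-2 * ∑' β : ℤ, μ s * (α ^ 2 + (β:ℝ) ^ 2) * (bb α β * ‖ϑ s β‖ ^ 2)) s := by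
  obtain ⟨w, hw, w0, hwb⟩ := h.uf.dom
  have hsub := Set.Ioo_subset_Icc_self (a := (0:ℝ)) (b := L)
  have hb := PB.bb hc hα
  -- derivative of one term
  have term : ∀ β, ∀ s ∈ Set.Icc 0 L, HasDerivAt (fun s => bb α β * ‖ϑ s β‖ ^ 2)
      (-2 * ((starRingEnd ℂ) ((bb α β : ℂ) * ϑ s β) * Fs (bb α) α (μ s) 0 (ϑ s) β).re) s := by
    intro β s hs
    have h1 := ((h.de s hs β).norm_sq).const_mul (bb α β)
    refine h1.congr_deriv ?_
    rw [inner_neg_right]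
    simp only [Complex.inner, map_mul, Complex.conj_ofReal, mul_assoc, Complex.re_ofReal_mul]
    ring_nf
  -- bound
  set w' : ℤ → ℝ := fun β => 2 * w β * ((2 * ν * (α ^ 2 + (β:ℝ)^2)) * w β + α * ((w (β - 1) + w (β + 1)) / 2)) with hw'
  have hα0 : 0 < α := by linarith
  have rdw' : RD w' := by
    have e1 : RD (fun β : ℤ => (2 * ν * (α ^ 2 + (β:ℝ)^2)) * w β) :=
      hw.pmul ((PB.const (2 * ν)).mul (PB.S2 α))
    have e2 : RD (fun β : ℤ => α * ((w (β - 1) + w (β + 1)) / 2)) := by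
      have := ((hw.shift (-1)).add (hw.shift 1)).pmul (PB.const (α / 2))
      convert this using 2
      rw [← sub_eq_add_neg]; ring
    exact (hw.prod (e1.add e2) 2 0 (fun β => by
      simp only [hw', norm_mul, pow_zero, mul_one, Real.norm_ofNat]
      rw [mul_assoc]))
  have bound : ∀ β, ∀ s ∈ Set.Ioo 0 L,
      ‖-2 * ((starRingEnd ℂ) ((bb α β : ℂ) * ϑ s β) * Fs (bb α) α (μ s) 0 (ϑ s) β).re‖ ≤ w' β := by
    intro β s hs
    have hs' := hsub hs
    have bw : ∀ β, ‖(bb α β : ℂ) * ϑ s β‖ ≤ w β := by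
      intro β
      rw [norm_mul, Complex.norm_real, Real.norm_of_nonneg (bb_pos hc hα β).le]
      calc _ ≤ 1 * w β := by gcongr; exacts [bb_le_one α β, hwb s hs' β]
        _ = _ := one_mul _
    have hμ0 : 0 ≤ μ s := hν.le.trans (h.ml s hs')
    have F1 : ‖Fs (bb α) α (μ s) 0 (ϑ s) β‖ ≤
        (2 * ν * (α ^ 2 + (β:ℝ)^2)) * w β + α * ((w (β - 1) + w (β + 1)) / 2) := by
      unfold Fs
      refine (norm_add_le _ _).trans (add_le_add ?_ ?_)
      · rw [norm_mul, Complex.norm_real, Real.norm_of_nonneg (by positivity)]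
        gcongr
        · exact h.mu s hs'
        · exact hwb s hs' β
      · rw [norm_mul, norm_mul, Complex.norm_I, one_mul, Complex.norm_real, Real.norm_of_nonneg hα0.le]
        gcongr
        simp only [Complex.ofReal_zero, zero_mul, sub_zero, cs, norm_div, RCLike.norm_ofNat]
        gcongr
        exact (norm_add_le _ _).trans (add_le_add (bw _) (bw _))
    rw [norm_mul, Real.norm_eq_abs (Complex.re _)]
    have := abs_reM ((bb α β : ℂ) * ϑ s β) (Fs (bb α) α (μ s) 0 (ϑ s) β)
    have n2 : ‖(-2:ℝ)‖ = 2 := by norm_num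
    rw [n2, hw']
    have w0' := w0 β
    calc _ ≤ 2 * (w β * ((2 * ν * (α ^ 2 + (β:ℝ)^2)) * w β + α * ((w (β - 1) + w (β + 1)) / 2))) := by
          refine mul_le_mul_of_nonneg_left (this.trans ?_) (by norm_num)
          exact mul_le_mul (bw β) F1 (norm_nonneg _) w0'
      _ = _ := by ring
  have main := hasDerivAt_tsum_of_isPreconnected (u := w') rdw'.summable isOpen_Ioo isPreconnected_Ioo
    (fun β s hs => term β s (hsub hs)) bound hs ((h.uf.rd (hsub hs)).pnsq hb) hs
  refine main.congr_deriv ?_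
  rw [tsum_mul_left, I1 hb α (μ s) 0 (h.uf.rd (hsub hs)) rfl]

lemma Sol.energy_decay {c₀ α ν L : ℝ} (hc : 1 < c₀) (hα : c₀ ≤ α) (hν : 0 < ν) {μ : ℝ → ℝ} {ϑ : ℝ → ℤ → ℂ}
    (h : Sol α ν L μ ϑ) {κ : ℝ} (hκ : κ ≤ 2 * ν * α ^ 2) :
    AntitoneOn (fun s => Real.exp (κ * s) * EE α (ϑ s)) (Set.Icc 0 L) := by
  have D : ∀ s ∈ Set.Ioo 0 L, HasDerivAt (fun s => Real.exp (κ * s) * EE α (ϑ s))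
      (Real.exp (κ * s) * κ * EE α (ϑ s) + Real.exp (κ * s) * (-2 * ∑' β : ℤ, μ s * (α ^ 2 + (β:ℝ) ^ 2) * (bb α β * ‖ϑ s β‖ ^ 2))) s := by
    intro s hs
    have e1 : HasDerivAt (fun s => Real.exp (κ * s)) (Real.exp (κ * s) * κ) s := by
      simpa using ((hasDerivAt_id s).const_mul κ).exp
    exact e1.mul (h.energy_deriv hc hα hν hs)
  refine antitoneOn_of_deriv_nonpos (convex_Icc 0 L) ?_ ?_ ?_
  · exact (Continuous.continuousOn (by fun_prop)).mul (h.energy_cont hc hα)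
  · rw [interior_Icc]
    exact fun s hs => (D s hs).differentiableAt.differentiableWithinAt
  · rw [interior_Icc]
    intro s hs
    rw [(D s hs).deriv]
    have hs' : s ∈ Set.Icc 0 L := Set.Ioo_subset_Icc_self hs
    have rd := h.uf.rd hs'
    have hb := PB.bb hc hα
    have key : κ * EE α (ϑ s) ≤ 2 * ∑' β : ℤ, μ s * (α ^ 2 + (β:ℝ) ^ 2) * (bb α β * ‖ϑ s β‖ ^ 2) := by
      unfold EE
      rw [← tsum_mul_left, ← tsum_mul_left]
      refine Summable.tsum_le_tsum (fun β => ?_) ((rd.pnsq hb).mul_left _) (Summable.mul_left _ ?_)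
      · have b0 := (bb_pos hc hα β).le
        rw [← mul_assoc 2]
        refine mul_le_mul_of_nonneg_right ?_ (mul_nonneg b0 (sq_nonneg _))
        have := h.ml s hs'
        have : ν * α ^ 2 ≤ μ s * (α ^ 2 + (β:ℝ) ^ 2) := by
          have h3 := sq_nonneg (β:ℝ)
          exact mul_le_mul this (by linarith) (by positivity) (by linarith)
        linarith
      · have := rd.pnsq (((PB.const (μ s)).mul (PB.S2 α)).mul hb)
        simpa only [mul_assoc] using this
    have he := Real.exp_pos (κ * s)
    nlinarith


lemma fc_Fs {a b : ℝ} (hab : a < b) {u : ℝ → ℤ → ℂ} (hu : UF a b u) (q : ℤ → ℝ) (α ν l : ℝ) (β n : ℤ) :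
    ContinuousOn (fun s => Fs q α ν l (u s) β) (Set.Icc a b) ∧
    fourierCoeffOn hab (fun s => Fs q α ν l (u s) β) n =
      Fs q α ν l (fun β => fourierCoeffOn hab (fun s => u s β) n) β := by
  have e : ∀ x : ℤ → ℂ, Fs q α ν l x β = (((ν * (α ^ 2 + (β:ℝ) ^ 2) : ℝ) : ℂ) - Complex.I * α * l) * x β +
      ((Complex.I * α * q (β - 1) / 2) * x (β - 1) + (Complex.I * α * q (β + 1) / 2) * x (β + 1)) := by
    intro x; unfold Fs cs; ring
  simp only [e]
  have c1 : ∀ (γ : ℤ) (c : ℂ), ContinuousOn (fun s => c * u s γ) (Set.Icc a b) := fun γ c => continuousOn_const.mul (hu.ct γ)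
  refine ⟨(c1 _ _).add ((c1 _ _).add (c1 _ _)), ?_⟩
  have c2 : ∀ (γ δ : ℤ) (c d : ℂ), ContinuousOn (fun s => c * u s γ + d * u s δ) (Set.Icc a b) :=
    fun γ δ c d => (c1 _ _).add (c1 _ _)
  rw [fc_add hab (c1 _ _) (c2 _ _ _ _), fc_add hab (c1 _ _) (c1 _ _), fc_mul, fc_mul, fc_mul]

lemma int_chi (a b : ℝ) : ∫ s in a..b, ((s - a) * (b - s)) ^ 2 = (b - a) ^ 5 / 30 := by
  have : ∀ s ∈ Set.uIcc a b, HasDerivAt (fun s => (b - a) ^ 2 * (s - a) ^ 3 / 3 - (b - a) * (s - a) ^ 4 / 2 + (s - a) ^ 5 / 5)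
      (((s - a) * (b - s)) ^ 2) s := by
    intro s _
    have h0 := (hasDerivAt_id s).sub_const a
    have h1 := (((h0.pow 3).const_mul ((b - a) ^ 2)).div_const 3).sub
      (((h0.pow 4).const_mul (b - a)).div_const 2)
    have h2 := h1.add ((h0.pow 5).div_const 5)
    refine h2.congr_deriv ?_
    simp
    ring
  rw [intervalIntegral.integral_eq_sub_of_hasDerivAt this (Continuous.intervalIntegrable (by fun_prop) _ _)]
  ring

lemma tsum_le_W {c₀ α : ℝ} (hc : 1 < c₀) (hα : c₀ ≤ α) {x : ℤ → ℂ} (h : RD x) :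
    ∑' β, ‖x β‖ ^ 2 ≤ c₀ / (c₀ - 1) * EE α x := by
  unfold EE
  rw [← tsum_mul_left]
  refine Summable.tsum_le_tsum (fun β => ?_) h.nsq.summable ((h.pnsq (PB.bb hc hα)).mul_left _)
  have := bb_lower hc hα β
  rw [← mul_assoc]
  exact le_mul_of_one_le_left (by positivity) this

lemma EE_le {c₀ α : ℝ} (hc : 1 < c₀) (hα : c₀ ≤ α) {x : ℤ → ℂ} (h : RD x) :
    EE α x ≤ c₀ / (c₀ - 1) * ∑' β, ‖(bb α β : ℂ) * x β‖ ^ 2 := by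
  unfold EE
  rw [← tsum_mul_left]
  refine Summable.tsum_le_tsum (fun β => ?_) (h.pnsq (PB.bb hc hα)) (((h.cmul (PB.bb hc hα)).nsq.summable).mul_left _)
  have h1 := bb_lower hc hα β
  have h2 := bb_pos hc hα β
  rw [norm_mul, Complex.norm_real, Real.norm_of_nonneg h2.le]
  calc bb α β * ‖x β‖ ^ 2 ≤ (c₀ / (c₀ - 1) * bb α β) * (bb α β * ‖x β‖ ^ 2) :=
        le_mul_of_one_le_left (by positivity) h1
    _ = _ := by ring

lemma EE_nonneg {c₀ α : ℝ} (hc : 1 < c₀) (hα : c₀ ≤ α) (x : ℤ → ℂ) : 0 ≤ EE α x :=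
  tsum_nonneg fun β => mul_nonneg (bb_pos hc hα β).le (by positivity)

lemma Sol.anti {c₀ α ν L : ℝ} (hc : 1 < c₀) (hα : c₀ ≤ α) (hν : 0 < ν) {μ : ℝ → ℝ} {ϑ : ℝ → ℤ → ℂ}
    (h : Sol α ν L μ ϑ) : AntitoneOn (fun s => EE α (ϑ s)) (Set.Icc 0 L) := by
  have := h.energy_decay hc hα hν (κ := 0) (by positivity)
  simpa using this

set_option maxHeartbeats 1000000 in
lemma window {c₀ e : ℝ} (hc : 1 < c₀) (he : 0 < e)
    (HS : ∀ y : ℝ, 0 < y → y ^ 2 ≤ e ^ 4 → ∀ α : ℝ, c₀ ≤ α → ∀ (l : ℝ) (θ : ℤ → ℂ), RD θ →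
      e ^ 8 * y ^ 12 * (∑' β, ‖(bb α β : ℂ) * θ β‖ ^ 2) ≤ ∑' β, ‖Fs (bb α) α (y ^ 14) l θ β‖ ^ 2 ∧
      (α * y ^ 4 ≤ 2 → e ^ 6 * y ^ 34 * (∑' β : ℤ, ((α ^ 2 + (β : ℝ) ^ 2) * ‖(bb α β : ℂ) * θ β‖) ^ 2) ≤
        9 * ∑' β, ‖Fs (bb α) α (y ^ 14) l θ β‖ ^ 2))
    {α ν L : ℝ} (hα : c₀ ≤ α) (hν : 0 < ν) {μ : ℝ → ℝ} {ϑ : ℝ → ℤ → ℂ} (h : Sol α ν L μ ϑ)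
    {a b y W : ℝ} (hW : W = c₀ / (c₀ - 1)) (ha : 0 ≤ a) (hab : a < b) (hb : b ≤ L) (hy : 0 < y) (hy2 : y ^ 2 ≤ e ^ 4)
    (hyμ : μ a = y ^ 14) (hαy : α * y ^ 4 ≤ 2) (small : 576 * W ^ 2 * ν ^ 4 * (b - a) ^ 2 ≤ e ^ 6 * y ^ 34) :
    e ^ 8 * y ^ 12 * (b - a) ^ 2 * EE α (ϑ b) ≤ 120 * W ^ 2 * EE α (ϑ a) := by
  have hsub : Set.Icc a b ⊆ Set.Icc 0 L := Set.Icc_subset_Icc ha hb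
  have huf : UF a b ϑ := h.uf.mono hsub
  have hT : 0 < b - a := by linarith
  have hW0 : 0 < W := by rw [hW]; exact div_pos (by linarith) (by linarith)
  have hα0 : 0 < α := by linarith
  have hbb := PB.bb hc hα
  have mc := h.mc.mono hsub
  obtain ⟨χ, hχ⟩ : ∃ χ : ℝ → ℝ, χ = fun s => (s - a) * (b - s) := ⟨_, rfl⟩
  obtain ⟨χ', hχ'⟩ : ∃ χ' : ℝ → ℝ, χ' = fun s => a + b - 2 * s := ⟨_, rfl⟩
  have cχ : Continuous χ := by rw [hχ]; fun_prop
  have cχ' : Continuous χ' := by rw [hχ']; fun_prop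
  have dχ : ∀ s, HasDerivAt χ (χ' s) s := by
    intro s
    rw [hχ, hχ']
    have h1 := ((hasDerivAt_id s).sub_const a).mul ((hasDerivAt_id s).const_sub b)
    refine h1.congr_deriv ?_
    simp; ring
  obtain ⟨u, hu⟩ : ∃ u : ℝ → ℤ → ℂ, u = fun s β => ((χ s : ℝ) : ℂ) * ϑ s β := ⟨_, rfl⟩
  have ufu : UF a b u := by
    have := huf.pc (PB.const 1) cχ.continuousOn
    simpa [hu] using this
  obtain ⟨A, hA⟩ : ∃ A : ℝ → ℤ → ℂ, A = fun s β => ((χ' s : ℝ) : ℂ) * ϑ s β := ⟨_, rfl⟩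
  have ufA : UF a b A := by
    have := huf.pc (PB.const 1) cχ'.continuousOn
    simpa [hA] using this
  obtain ⟨ρ, hρ⟩ : ∃ ρ : ℝ → ℤ → ℂ, ρ = fun s β => ((bb α β : ℝ) : ℂ) * u s β := ⟨_, rfl⟩
  have ufρ : UF a b ρ := by
    have := ufu.pc hbb (continuousOn_const (c := (1:ℝ)))
    simpa [hρ] using this
  obtain ⟨R, hR⟩ : ∃ R : ℝ → ℤ → ℂ, R = fun s (β : ℤ) => (((α ^ 2 + (β:ℝ) ^ 2) * bb α β : ℝ) : ℂ) * u s β := ⟨_, rfl⟩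
  have ufR : UF a b R := by
    have := ufu.pc ((PB.S2 α).mul hbb) (continuousOn_const (c := (1:ℝ)))
    simpa [hR] using this
  obtain ⟨B, hB⟩ : ∃ B : ℝ → ℤ → ℂ, B = fun s (β : ℤ) => ((-(μ s - μ a) * (α ^ 2 + (β:ℝ) ^ 2) : ℝ) : ℂ) * u s β := ⟨_, rfl⟩
  have ufB : UF a b B := by
    have := ufu.pc (PB.S2 α) (c := fun s => -(μ s - μ a)) (by fun_prop)
    simpa only [hB] using this
  obtain ⟨G, hG⟩ : ∃ G : ℝ → ℤ → ℂ, G = fun s β => A s β + B s β := ⟨_, rfl⟩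
  have ufG : UF a b G := hG ▸ ufA.add ufB
  -- derivative of u
  have du : ∀ β, ∀ s ∈ Set.Icc a b, HasDerivAt (fun s => u s β) (G s β + (-1) * Fs (bb α) α (μ a) 0 (u s) β) s := by
    intro β s hs
    have h1 := ((dχ s).ofReal_comp).mul (h.de s (hsub hs) β)
    rw [hu]
    refine h1.congr_deriv ?_
    simp only [hG, hA, hB, hu, Fs, cs]
    push_cast
    ring
  have four : ∀ β n, fourierCoeffOn hab (fun s => G s β) n =
      Fs (bb α) α (μ a) (-(2 * Real.pi * n / ((b - a) * α))) (fun β => fourierCoeffOn hab (fun s => u s β) n) β := by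
    intro β n
    obtain ⟨c1, c2⟩ := fc_Fs hab ufu (bb α) α (μ a) 0 β n
    have c3 : ContinuousOn (fun s => (-1) * Fs (bb α) α (μ a) 0 (u s) β) (Set.Icc a b) := continuousOn_const.mul c1
    have e1 := fc_deriv hab (du β) ((ufG.ct β).add c3) (by simp [hu, hχ]) (by simp [hu, hχ]) n
    rw [fc_add hab (ufG.ct β) c3, fc_mul, c2] at e1
    have e2 : fourierCoeffOn hab (fun s => G s β) n = (2 * Real.pi * Complex.I * n / (b - a)) * fourierCoeffOn hab (fun s => u s β) n +
       Fs (bb α) α (μ a) 0 (fun β => fourierCoeffOn hab (fun s => u s β) n) β := by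
      linear_combination e1
    rw [e2]
    unfold Fs
    have hba : (b:ℂ) - a ≠ 0 := by
      rw [← Complex.ofReal_sub]; exact_mod_cast hT.ne'
    have hα1 : (α:ℂ) ≠ 0 := by exact_mod_cast hα0.ne'
    push_cast
    field_simp
    ring
  have st := fun n => HS y hy hy2 α hα (-(2 * Real.pi * (n:ℤ) / ((b - a) * α))) _ (ufu.fc_rd hab n)
  have N1 : e ^ 8 * y ^ 12 * NN a b ρ ≤ NN a b G := by
    refine NN_compare hab ufρ ufG _ (fun n => ?_)
    simp only [four, hρ, fc_mul, hyμ]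
    exact (st n).1
  have N2 : e ^ 6 * y ^ 34 / 9 * NN a b R ≤ NN a b G := by
    refine NN_compare hab ufR ufG _ (fun n => ?_)
    simp only [four, hR, fc_mul, hyμ]
    have := (st n).2 hαy
    have e3 : ∀ β : ℤ, ‖(((α ^ 2 + (β:ℝ) ^ 2) * bb α β : ℝ) : ℂ) * fourierCoeffOn hab (fun s => u s β) n‖ ^ 2 =
       ((α ^ 2 + (β : ℝ) ^ 2) * ‖(bb α β : ℂ) * fourierCoeffOn hab (fun s => u s β) n‖) ^ 2 := by
      intro β
      rw [Complex.ofReal_mul, mul_assoc, norm_mul, Complex.norm_real, Real.norm_of_nonneg (by positivity)]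
    simp only [e3]
    linarith
  -- bound of NN G
  have N3 : NN a b G ≤ 2 * NN a b A + 32 * ν ^ 4 * (b - a) ^ 2 * W ^ 2 * NN a b R := by
    have sA := (ufA.hasSum hab).summable
    have sR := (ufR.hasSum hab).summable
    have sG := (ufG.hasSum hab).summable
    unfold NN
    rw [← tsum_mul_left, ← tsum_mul_left, ← (sA.mul_left _).tsum_add (sR.mul_left _)]
    refine sG.tsum_le_tsum (fun β => ?_) ((sA.mul_left _).add (sR.mul_left _))
    have II : ∀ {f : ℝ → ℤ → ℂ}, UF a b f → IntervalIntegrable (fun s => ‖f s β‖ ^ 2) MeasureTheory.volume a b :=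
      fun hf => ContinuousOn.intervalIntegrable (by rw [Set.uIcc_of_le hab.le]; exact (hf.ct β).norm.pow 2)
    rw [← intervalIntegral.integral_const_mul, ← intervalIntegral.integral_const_mul,
      ← intervalIntegral.integral_add ((II ufA).const_mul _) ((II ufR).const_mul _)]
    refine intervalIntegral.integral_mono_on hab.le (II ufG) (((II ufA).const_mul _).add ((II ufR).const_mul _)) ?_
    intro s hs
    have hBR : ‖B s β‖ ≤ 4 * ν ^ 2 * (b - a) * W * ‖R s β‖ := by
      simp only [hB, hR, norm_mul, Complex.norm_real, Real.norm_eq_abs, abs_neg, abs_mul]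
      have b0 := bb_pos hc hα β
      have b1 := bb_lower hc hα β
      rw [← hW] at b1
      have m1 := h.mL s (hsub hs) a (hsub ⟨le_rfl, hab.le⟩)
      have m2 : |s - a| ≤ b - a := by rw [abs_of_nonneg (by linarith [hs.1])]; linarith [hs.2]
      rw [abs_of_pos b0]
      have m3 : |μ s - μ a| ≤ 4 * ν ^ 2 * (b - a) := m1.trans (by gcongr)
      calc |μ s - μ a| * |α ^ 2 + (β:ℝ) ^ 2| * ‖u s β‖ ≤ 4 * ν ^ 2 * (b - a) * |α ^ 2 + (β:ℝ) ^ 2| * ‖u s β‖ := by gcongr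
        _ = 4 * ν ^ 2 * (b - a) * |α ^ 2 + (β:ℝ) ^ 2| * ‖u s β‖ * 1 := by ring
        _ ≤ 4 * ν ^ 2 * (b - a) * |α ^ 2 + (β:ℝ) ^ 2| * ‖u s β‖ * (W * bb α β) := by gcongr
        _ = _ := by ring
    have hGn : ‖G s β‖ ≤ ‖A s β‖ + ‖B s β‖ := by rw [hG]; exact norm_add_le _ _
    have g1 : ‖G s β‖ ^ 2 ≤ (‖A s β‖ + ‖B s β‖) ^ 2 := pow_le_pow_left₀ (norm_nonneg _) hGn 2
    have g2 : ‖B s β‖ ^ 2 ≤ (4 * ν ^ 2 * (b - a) * W * ‖R s β‖) ^ 2 := pow_le_pow_left₀ (norm_nonneg _) hBR 2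
    nlinarith [sq_nonneg (‖A s β‖ - ‖B s β‖)]
  have R0 : 0 ≤ NN a b R := tsum_nonneg fun β => intervalIntegral.integral_nonneg hab.le (fun s _ => by positivity)
  have N4 : NN a b G ≤ 4 * NN a b A := by
    have k1 : 576 * W ^ 2 * ν ^ 4 * (b - a) ^ 2 * NN a b R ≤ e ^ 6 * y ^ 34 * NN a b R := by gcongr
    linarith
  have anti := h.anti hc hα hν
  have N5 : NN a b A ≤ (b - a) ^ 3 * W * EE α (ϑ a) := by
    rw [ufA.NN_eq hab]
    have : ∫ s in a..b, ∑' β, ‖A s β‖ ^ 2 ≤ ∫ s in a..b, (b - a) ^ 2 * (W * EE α (ϑ a)) := by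
      refine intervalIntegral.integral_mono_on hab.le ?_ (by simp) ?_
      · exact ContinuousOn.intervalIntegrable (by rw [Set.uIcc_of_le hab.le]; exact ufA.contsum)
      · intro s hs
        have q1 := tsum_le_W hc hα (huf.rd hs)
        rw [← hW] at q1
        have q2 : EE α (ϑ s) ≤ EE α (ϑ a) := anti (hsub ⟨le_rfl, hab.le⟩) (hsub hs) hs.1
        have q3 : ∑' β, ‖A s β‖ ^ 2 = (χ' s) ^ 2 * ∑' β, ‖ϑ s β‖ ^ 2 := by
          rw [← tsum_mul_left]
          congr 1; ext β
          rw [hA]; simp [mul_pow]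
        rw [q3]
        have q4 : (χ' s) ^ 2 ≤ (b - a) ^ 2 := by
          rw [hχ']; apply sq_le_sq' <;> linarith [hs.1, hs.2]
        have q5 : 0 ≤ ∑' β, ‖ϑ s β‖ ^ 2 := tsum_nonneg fun β => by positivity
        refine mul_le_mul q4 (q1.trans ?_) q5 (by positivity)
        gcongr
    refine this.trans (le_of_eq ?_)
    rw [intervalIntegral.integral_const, smul_eq_mul]; ring
  have N6 : (b - a) ^ 5 / 30 * EE α (ϑ b) ≤ W * NN a b ρ := by
    rw [ufρ.NN_eq hab, ← int_chi, ← intervalIntegral.integral_mul_const, ← intervalIntegral.integral_const_mul]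
    refine intervalIntegral.integral_mono_on hab.le (Continuous.intervalIntegrable (by fun_prop) _ _) ?_ ?_
    · exact (ContinuousOn.intervalIntegrable (by rw [Set.uIcc_of_le hab.le]; exact ufρ.contsum)).const_mul _
    · intro s hs
      have q1 := EE_le hc hα (huf.rd hs)
      rw [← hW] at q1
      have q2 : EE α (ϑ b) ≤ EE α (ϑ s) := anti (hsub hs) (hsub ⟨hab.le, le_rfl⟩) hs.2
      have q3 : ∑' β, ‖ρ s β‖ ^ 2 = (χ s) ^ 2 * ∑' β, ‖(bb α β : ℂ) * ϑ s β‖ ^ 2 := by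
        rw [← tsum_mul_left]
        congr 1; ext β
        rw [hρ, hu]; simp [mul_pow]; ring
      rw [q3]
      have q4 : ((s - a) * (b - s)) ^ 2 = χ s ^ 2 := by rw [hχ]
      rw [q4]
      calc _ ≤ χ s ^ 2 * (W * ∑' β, ‖(bb α β : ℂ) * ϑ s β‖ ^ 2) := by gcongr; linarith
        _ = _ := by ring
  have fin : (b - a) ^ 3 * (e ^ 8 * y ^ 12 * (b - a) ^ 2 * EE α (ϑ b)) ≤ (b - a) ^ 3 * (120 * W ^ 2 * EE α (ϑ a)) := by
    have z1 : e ^ 8 * y ^ 12 * ((b - a) ^ 5 / 30 * EE α (ϑ b)) ≤ e ^ 8 * y ^ 12 * (W * NN a b ρ) := by gcongr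
    have z2 : W * (e ^ 8 * y ^ 12 * NN a b ρ) ≤ W * (4 * ((b - a) ^ 3 * W * EE α (ϑ a))) := by
      exact mul_le_mul_of_nonneg_left (by linarith) hW0.le
    linarith
  exact le_of_mul_le_mul_left fin (by positivity)


lemma halving_iter {L T : ℝ} (hT : 0 < T) {f : ℝ → ℝ} (anti : AntitoneOn f (Set.Icc 0 L))
    (h : ∀ a, 0 ≤ a → a + T ≤ L → f (a + T) ≤ 1 / 2 * f a) (f0 : 0 ≤ f 0) {s : ℝ} (hs : s ∈ Set.Icc 0 L) :
    f s ≤ 2 * Real.exp (-(Real.log 2 / T * s)) * f 0 := by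
  have it : ∀ n : ℕ, ∀ s ∈ Set.Icc 0 L, n * T ≤ s → f s ≤ (1 / 2) ^ n * f 0 := by
    intro n
    induction n with
    | zero =>
      intro s hs _
      simpa using anti ⟨le_rfl, hs.1.trans hs.2⟩ hs hs.1
    | succ n ih =>
      intro s hs hn
      push_cast at hn
      have hnT : 0 ≤ n * T := by positivity
      have h1 := h (s - T) (by linarith) (by linarith [hs.2])
      have h2 := ih (s - T) ⟨by linarith, by linarith [hs.2]⟩ (by linarith)
      rw [sub_add_cancel] at h1
      rw [pow_succ]
      linarith
  have h1 := it ⌊s / T⌋₊ s hs (by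
    rw [← le_div_iff₀ hT]; exact Nat.floor_le (div_nonneg hs.1 hT.le))
  refine h1.trans (mul_le_mul_of_nonneg_right ?_ f0)
  have h2 := (Nat.lt_floor_add_one (s / T)).le
  have hl := Real.log_pos (show (1:ℝ) < 2 by norm_num)
  have e1 : ((1:ℝ) / 2) ^ ⌊s / T⌋₊ = Real.exp (-(⌊s / T⌋₊ * Real.log 2)) := by
    rw [Real.exp_neg, Real.exp_nat_mul, Real.exp_log (by norm_num)]
    simp
  have e2 : 2 * Real.exp (-(Real.log 2 / T * s)) = Real.exp (Real.log 2 + -(Real.log 2 / T * s)) := by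
    rw [Real.exp_add, Real.exp_log (by norm_num)]
  rw [e1, e2]
  apply Real.exp_le_exp.mpr
  have : Real.log 2 / T * s = s / T * Real.log 2 := by ring
  rw [this]
  nlinarith

set_option maxHeartbeats 1000000 in
lemma decay {c₀ : ℝ} (hc : 1 < c₀) : ∃ ν₀ r : ℝ, 0 < ν₀ ∧ ν₀ ≤ 1 ∧ 0 < r ∧
    ∀ z : ℝ, 0 < z → z ^ 14 < ν₀ → ∀ α, c₀ ≤ α → ∀ (L : ℝ) (μ : ℝ → ℝ) (ϑ : ℝ → ℤ → ℂ), Sol α (z ^ 14) L μ ϑ →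
    ∀ s ∈ Set.Icc 0 L, EE α (ϑ s) ≤ 2 * Real.exp (-(r * z ^ 6 * s)) * EE α (ϑ 0) := by
  obtain ⟨e, he, he1, HS⟩ := static_est hc
  obtain ⟨W, hW⟩ : ∃ W, W = c₀ / (c₀ - 1) := ⟨_, rfl⟩
  have hW1 : 1 ≤ W := by rw [hW, le_div_iff₀ (by linarith)]; linarith
  obtain ⟨K, hK⟩ : ∃ K, K = 16 * W / e ^ 4 := ⟨_, rfl⟩
  have e4 : e ^ 4 ≤ 1 := pow_le_one₀ he.le (by linarith)
  have hK1 : 1 ≤ K := by rw [hK, le_div_iff₀ (by positivity)]; linarith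
  have hKe : K ^ 2 * e ^ 8 = 256 * W ^ 2 := by rw [hK]; field_simp; ring
  obtain ⟨η, hη⟩ : ∃ η, η = e ^ 6 / (576 * W ^ 2 * K ^ 2) := ⟨_, rfl⟩
  have η0 : 0 < η := by rw [hη]; positivity
  have hl := Real.log_pos (show (1:ℝ) < 2 by norm_num)
  refine ⟨min 1 (min (e ^ 28 / 2) (η ^ 2)), Real.log 2 / K, by positivity, min_le_left _ _, by positivity, ?_⟩
  intro z hz hzν α hα L μ ϑ h s hs
  have z1 : z ^ 14 < 1 := hzν.trans_le (min_le_left _ _)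
  have z2 : z ^ 14 < e ^ 28 / 2 := hzν.trans_le ((min_le_right _ _).trans (min_le_left _ _))
  have z3 : z ^ 14 < η ^ 2 := hzν.trans_le ((min_le_right _ _).trans (min_le_right _ _))
  have zle : z ≤ 1 := by
    by_contra hh; push Not at hh
    exact absurd z1 (not_lt.mpr (one_le_pow₀ hh.le))
  have z4 : z ^ 10 ≤ η := by
    refine le_of_pow_le_pow_left₀ (n := 2) (by norm_num) η0.le ?_
    calc (z ^ 10) ^ 2 = z ^ 14 * z ^ 6 := by ring
      _ ≤ z ^ 14 * 1 := by gcongr; exact pow_le_one₀ hz.le zle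
      _ ≤ _ := by linarith
  have hν : 0 < z ^ 14 := by positivity
  have E0 := EE_nonneg hc hα (ϑ 0)
  by_cases hbig : 1 ≤ α * z ^ 4
  · -- large α
    have k1 : Real.log 2 / K * z ^ 6 ≤ 2 * z ^ 14 * α ^ 2 := by
      have a1 : Real.log 2 / K ≤ 1 := by
        rw [div_le_one (by linarith)]
        have := Real.log_two_lt_d9
        linarith
      have a2 : 1 ≤ (α * z ^ 4) ^ 2 := one_le_pow₀ hbig
      calc Real.log 2 / K * z ^ 6 ≤ 1 * z ^ 6 := by gcongr
        _ ≤ (2 * (α * z ^ 4) ^ 2) * z ^ 6 := by gcongr; linarith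
        _ = _ := by ring
    have := h.energy_decay hc hα hν k1 ⟨le_rfl, hs.1.trans hs.2⟩ hs hs.1
    simp only [mul_zero, Real.exp_zero, one_mul] at this
    have ep := Real.exp_pos (-(Real.log 2 / K * z ^ 6 * s))
    have h3 := mul_le_mul_of_nonneg_left this ep.le
    rw [← mul_assoc, ← Real.exp_add, neg_add_cancel, Real.exp_zero, one_mul] at h3
    have : 0 ≤ Real.exp (-(Real.log 2 / K * z ^ 6 * s)) * EE α (ϑ 0) := by positivity
    linarith
  · push Not at hbig
    have T0 : 0 < K / z ^ 6 := by positivity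
    have := halving_iter T0 (h.anti hc hα hν) ?_ E0 hs
    · refine this.trans (le_of_eq ?_)
      congr 4
      field_simp
    intro a ha haT
    have haL : a ∈ Set.Icc 0 L := ⟨ha, by linarith⟩
    have m1 := h.ml a haL
    have m2 := h.mu a haL
    obtain ⟨y, hy⟩ : ∃ y, y = (μ a) ^ ((1:ℝ) / 14) := ⟨_, rfl⟩
    have μ0 : 0 < μ a := hν.trans_le m1
    have y0 : 0 < y := by rw [hy]; positivity
    have yμ : μ a = y ^ 14 := by
      rw [hy, ← Real.rpow_natCast, ← Real.rpow_mul μ0.le]; norm_num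
    have zy : z ≤ y := by
      refine le_of_pow_le_pow_left₀ (n := 14) (by norm_num) y0.le (by rw [← yμ]; exact m1)
    have y14 : y ^ 14 ≤ 2 * z ^ 14 := by rw [← yμ]; exact m2
    have y2 : y ^ 2 ≤ e ^ 4 := by
      refine le_of_pow_le_pow_left₀ (n := 7) (by norm_num) (by positivity) ?_
      calc (y ^ 2) ^ 7 = y ^ 14 := by ring
        _ ≤ e ^ 28 := by linarith
        _ = _ := by ring
    have y4 : y ^ 4 ≤ 2 * z ^ 4 := by
      refine le_of_pow_le_pow_left₀ (n := 7) (by norm_num) (by positivity) ?_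
      calc (y ^ 4) ^ 7 = (y ^ 14) ^ 2 := by ring
        _ ≤ (2 * z ^ 14) ^ 2 := by gcongr
        _ ≤ (2 * z ^ 4) ^ 7 := by ring_nf; gcongr; norm_num
    have hα0 : 0 < α := by linarith
    have αy : α * y ^ 4 ≤ 2 := by
      calc α * y ^ 4 ≤ α * (2 * z ^ 4) := by gcongr
        _ ≤ 2 := by linarith
    have zT : z ^ 12 * (K / z ^ 6) ^ 2 = K ^ 2 := by field_simp
    have small : 576 * W ^ 2 * (z ^ 14) ^ 4 * (a + K / z ^ 6 - a) ^ 2 ≤ e ^ 6 * y ^ 34 := by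
      have : 576 * W ^ 2 * (z ^ 14) ^ 4 * (a + K / z ^ 6 - a) ^ 2 = 576 * W ^ 2 * K ^ 2 * z ^ 10 * z ^ 34 := by
        rw [← zT]; ring
      rw [this]
      calc _ ≤ 576 * W ^ 2 * K ^ 2 * η * y ^ 34 := by gcongr
        _ = _ := by rw [hη]; field_simp
    have w := window hc he HS hα hν h hW ha (by linarith : a < a + K / z ^ 6) haT y0 y2 yμ αy small
    have Eb := EE_nonneg hc hα (ϑ (a + K / z ^ 6))
    have Ea := EE_nonneg hc hα (ϑ a)
    have hh : 240 * W ^ 2 * EE α (ϑ (a + K / z ^ 6)) ≤ 120 * W ^ 2 * EE α (ϑ a) := by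
      refine le_trans (mul_le_mul_of_nonneg_right ?_ Eb) w
      calc 240 * W ^ 2 ≤ 256 * W ^ 2 := by nlinarith [sq_nonneg W]
        _ = e ^ 8 * (z ^ 12 * (K / z ^ 6) ^ 2) := by rw [zT, ← hKe]; ring
        _ ≤ e ^ 8 * (y ^ 12 * (K / z ^ 6) ^ 2) := by gcongr
        _ = _ := by rw [add_sub_cancel_left]; ring
    have hW2 : 0 < W ^ 2 := by positivity
    change EE α (ϑ (a + K / z ^ 6)) ≤ 1 / 2 * EE α (ϑ a)
    refine le_of_mul_le_mul_left ?_ (show 0 < 240 * W ^ 2 by positivity)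
    linarith


lemma mkSol {α ν : ℝ} (hν : 0 < ν) {θ : ℝ → ℤ → ℂ} (hr : RapidlyDecaying θ) (hq : SubcriticalQG α ν θ) :
    Sol α ν (1 / (2 * ν)) (fun s => ν / (1 - ν * s)) (fun s => θ (-Real.log (1 - ν * s) / ν)) := by
  have hp : ∀ s ∈ Set.Icc 0 (1 / (2 * ν)), 1 / 2 ≤ 1 - ν * s ∧ 1 - ν * s ≤ 1 := by
    rintro s ⟨h0, h1⟩
    rw [le_div_iff₀ (by positivity)] at h1
    have : 0 ≤ ν * s := by positivity
    constructor <;> linarith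
  refine ⟨?_, ?_, ?_, ?_, ?_, ?_⟩
  · intro k
    obtain ⟨M, hM⟩ := hr (2 * k) (1 / ν) (by positivity)
    refine ⟨Real.sqrt M, fun s hs β => ?_⟩
    obtain ⟨p1, p2⟩ := hp s hs
    have l1 : Real.log (1 - ν * s) ≤ 0 := Real.log_nonpos (by linarith) p2
    have l2 : -1 ≤ Real.log (1 - ν * s) := by
      have := Real.log_le_log (by norm_num) p1
      rw [one_div, Real.log_inv] at this
      have := Real.log_two_lt_d9
      linarith
    obtain ⟨h1, h2⟩ := hM (-Real.log (1 - ν * s) / ν) (div_nonneg (by linarith) hν.le)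
      (by gcongr; linarith)
    refine Real.le_sqrt_of_sq_le ?_
    calc _ = (1 + (β : ℝ) ^ 2) ^ (2 * k) * ‖θ (-Real.log (1 - ν * s) / ν) β‖ ^ 2 := by
          rw [mul_pow, ← pow_mul, mul_comm k 2]
      _ ≤ _ := h1.le_tsum β (fun γ _ => by positivity)
      _ ≤ M := h2
  · intro s hs β
    obtain ⟨p1, p2⟩ := hp s hs
    have p0 : 0 < 1 - ν * s := by linarith
    have d1 : HasDerivAt (fun s => -Real.log (1 - ν * s) / ν) (1 / (1 - ν * s)) s := by
      have := ((((hasDerivAt_id s).const_mul ν).const_sub 1).log p0.ne').neg.div_const ν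
      refine this.congr_deriv ?_
      simp only [id]
      field_simp
    have d2 := HasDerivAt.scomp s (hq (-Real.log (1 - ν * s) / ν) β) d1
    refine d2.congr_deriv ?_
    have e1 : Real.exp (-(ν * (-Real.log (1 - ν * s) / ν))) = 1 - ν * s := by
      have : -(ν * (-Real.log (1 - ν * s) / ν)) = Real.log (1 - ν * s) := by field_simp
      rw [this, Real.exp_log p0]
    rw [e1]
    have pc : (1 : ℂ) - ν * s ≠ 0 := by
      have : ((1 - ν * s : ℝ) : ℂ) ≠ 0 := by exact_mod_cast p0.ne'
      simpa using this
    simp only [Fs, cs, bb, Complex.real_smul]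
    push_cast
    field_simp
    ring
  · refine ContinuousOn.div continuousOn_const (by fun_prop) (fun s hs => ?_)
    have := (hp s hs).1
    linarith
  · intro s hs
    obtain ⟨p1, p2⟩ := hp s hs
    rw [le_div_iff₀ (by linarith)]
    nlinarith
  · intro s hs
    obtain ⟨p1, p2⟩ := hp s hs
    rw [div_le_iff₀ (by linarith)]
    nlinarith
  · intro s hs r hr
    obtain ⟨p1, p2⟩ := hp s hs
    obtain ⟨q1, q2⟩ := hp r hr
    have p0 : 0 < 1 - ν * s := by linarith
    have q0 : 0 < 1 - ν * r := by linarith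
    have : ν / (1 - ν * s) - ν / (1 - ν * r) = ν ^ 2 * (s - r) / ((1 - ν * s) * (1 - ν * r)) := by
      rw [div_sub_div _ _ p0.ne' q0.ne']; congr 1; ring
    rw [this, abs_div, abs_mul, abs_of_nonneg (sq_nonneg ν), abs_of_pos (mul_pos p0 q0), div_le_iff₀ (mul_pos p0 q0)]
    have h4 : 1 / 4 ≤ (1 - ν * s) * (1 - ν * r) := by nlinarith
    have : 0 ≤ ν ^ 2 * |s - r| := by positivity
    nlinarith

lemma conj_sol {α ν : ℝ} {θ : ℝ → ℤ → ℂ} (hq : SubcriticalQG α ν θ) :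
    SubcriticalQG (-α) ν (fun t β => (starRingEnd ℂ) (θ t β)) := by
  intro t β
  have hS : ∀ β, Sv (-α) β = Sv α β := by intro β; unfold Sv; rw [neg_sq]
  have := (hq t β).star
  refine this.congr_deriv ?_
  rw [hS, hS, neg_sq]
  simp only [star_sub, star_add, star_mul', star_neg, Complex.star_def, map_sub, map_mul, map_add, map_neg, map_div₀,
    Complex.conj_ofReal, Complex.conj_I, map_inv₀, map_one, map_ofNat]
  push_cast
  ring

lemma conj_rd {θ : ℝ → ℤ → ℂ} (h : RapidlyDecaying θ) :
    RapidlyDecaying (fun t β => (starRingEnd ℂ) (θ t β)) := by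
  intro k T hT
  simpa only [RCLike.norm_conj] using h k T hT

lemma main_pos (c₀ : ℝ) (hc₀ : 1 < c₀) :
    ∃ ν₀ c C : ℝ, 0 < ν₀ ∧ ν₀ ≤ 1 ∧ 0 < c ∧ 1 < C ∧
      ∀ ν : ℝ, 0 < ν → ν < ν₀ → ∀ α : ℝ, c₀ ≤ α →
      ∀ θ : ℝ → ℤ → ℂ, RapidlyDecaying θ → SubcriticalQG α ν θ →
      ∀ t : ℝ, 0 ≤ t → t ≤ C⁻¹ * ν⁻¹ →
        (∑' β : ℤ, ‖θ t β‖ ^ 2) ≤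
          C ^ 2 * Real.exp (-2 * c * ν ^ ((3 : ℝ) / 7) * t) * ∑' β : ℤ, ‖θ 0 β‖ ^ 2 := by
  obtain ⟨ν₀, r, hν₀, hν₁, hr, H⟩ := decay hc₀
  obtain ⟨W, hW⟩ : ∃ W, W = c₀ / (c₀ - 1) := ⟨_, rfl⟩
  have hW1 : 1 ≤ W := by rw [hW, le_div_iff₀ (by linarith)]; linarith
  refine ⟨ν₀, r / 4, 4 + 2 * W, hν₀, hν₁, by positivity, by linarith, ?_⟩
  intro ν hν hνν α hα θ hrd hq t ht0 ht
  have h := mkSol hν hrd hq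
  obtain ⟨z, hz⟩ : ∃ z, z = ν ^ ((1:ℝ) / 14) := ⟨_, rfl⟩
  have z0 : 0 < z := by rw [hz]; positivity
  have zν : z ^ 14 = ν := by
    rw [hz, ← Real.rpow_natCast, ← Real.rpow_mul hν.le]; norm_num
  have z6 : ν ^ ((3:ℝ) / 7) = z ^ 6 := by
    rw [hz, ← Real.rpow_natCast, ← Real.rpow_mul hν.le]; norm_num
  have tν : ν * t ≤ 1 / 4 := by
    have : (4 + 2 * W)⁻¹ ≤ (4:ℝ)⁻¹ := inv_anti₀ (by norm_num) (by linarith)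
    calc ν * t ≤ ν * ((4 + 2 * W)⁻¹ * ν⁻¹) := by gcongr
      _ = (4 + 2 * W)⁻¹ := by field_simp
      _ ≤ 1 / 4 := by linarith
  have tν0 : 0 ≤ ν * t := by positivity
  obtain ⟨s, hs⟩ : ∃ s, s = (1 - Real.exp (-(ν * t))) / ν := ⟨_, rfl⟩
  have eνs : 1 - ν * s = Real.exp (-(ν * t)) := by rw [hs]; field_simp; ring
  have τs : -Real.log (1 - ν * s) / ν = t := by rw [eνs, Real.log_exp]; field_simp
  have exb : Real.exp (-(ν * t)) ≤ 1 - ν * t / 2 := by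
    have h1 := Real.add_one_le_exp (ν * t)
    rw [Real.exp_neg]
    calc (Real.exp (ν * t))⁻¹ ≤ (ν * t + 1)⁻¹ := inv_anti₀ (by linarith) h1
      _ ≤ _ := by
        rw [inv_le_iff_one_le_mul₀ (by linarith)]
        nlinarith
  have exl := Real.add_one_le_exp (-(ν * t))
  have sI : s ∈ Set.Icc 0 (1 / (2 * ν)) := by
    constructor
    · rw [hs]; exact div_nonneg (by linarith) hν.le
    · rw [hs, div_le_div_iff₀ hν (by positivity)]; nlinarith
  have st : t / 2 ≤ s := by rw [hs, le_div_iff₀ hν]; linarith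
  have D := H z z0 (by rw [zν]; exact hνν) α hα _ _ _ (by rw [zν]; exact h) s sI
  simp only [τs] at D
  have e0 : -Real.log (1 - ν * 0) / ν = 0 := by simp
  rw [e0] at D
  have R0 := h.uf.rd (s := 0) ⟨le_rfl, by positivity⟩
  rw [e0] at R0
  have Rt := h.uf.rd sI
  rw [τs] at Rt
  have A1 := tsum_le_W hc₀ hα Rt
  rw [← hW] at A1
  have A2 : EE α (θ 0) ≤ ∑' β, ‖θ 0 β‖ ^ 2 := by
    unfold EE
    refine Summable.tsum_le_tsum (fun β => ?_) (R0.pnsq (PB.bb hc₀ hα)) R0.nsq.summable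
    exact mul_le_of_le_one_left (by positivity) (bb_le_one α β)
  have E0 := EE_nonneg hc₀ hα (θ 0)
  have ex : Real.exp (-(r * z ^ 6 * s)) ≤ Real.exp (-2 * (r / 4) * z ^ 6 * t) := by
    apply Real.exp_le_exp.mpr
    have : r * z ^ 6 * (t / 2) ≤ r * z ^ 6 * s := by gcongr
    linarith
  rw [z6]
  calc _ ≤ W * EE α (θ t) := A1
    _ ≤ W * (2 * Real.exp (-2 * (r / 4) * z ^ 6 * t) * ∑' β, ‖θ 0 β‖ ^ 2) := by
        refine mul_le_mul_of_nonneg_left (D.trans ?_) (by linarith)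
        gcongr
    _ = (2 * W) * Real.exp (-2 * (r / 4) * z ^ 6 * t) * ∑' β, ‖θ 0 β‖ ^ 2 := by ring
    _ ≤ _ := by
        have : 0 ≤ ∑' β, ‖θ 0 β‖ ^ 2 := E0.trans A2
        gcongr
        nlinarith

theorem subcritical_QG_enhanced_dissipation (c₀ : ℝ) (hc₀ : 1 < c₀) :
    ∃ ν₀ c C : ℝ, 0 < ν₀ ∧ ν₀ ≤ 1 ∧ 0 < c ∧ 1 < C ∧
      ∀ ν : ℝ, 0 < ν → ν < ν₀ → ∀ α : ℝ, c₀ ≤ |α| →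
      ∀ θ : ℝ → ℤ → ℂ, RapidlyDecaying θ → SubcriticalQG α ν θ →
      ∀ t : ℝ, 0 ≤ t → t ≤ C⁻¹ * ν⁻¹ →
        (∑' β : ℤ, ‖θ t β‖ ^ 2) ≤
          C ^ 2 * Real.exp (-2 * c * ν ^ ((3 : ℝ) / 7) * t) * ∑' β : ℤ, ‖θ 0 β‖ ^ 2 := by
  obtain ⟨ν₀, c, C, h1, h2, h3, h4, H⟩ := main_pos c₀ hc₀
  refine ⟨ν₀, c, C, h1, h2, h3, h4, ?_⟩
  intro ν hν hνν α hα θ hrd hq t ht0 ht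
  rcases le_total 0 α with ha | ha
  · rw [abs_of_nonneg ha] at hα
    exact H ν hν hνν α hα θ hrd hq t ht0 ht
  · rw [abs_of_nonpos ha] at hα
    have := H ν hν hνν (-α) hα _ (conj_rd hrd) (conj_sol hq) t ht0 ht
    simpa only [RCLike.norm_conj] using this
end

section
/- Let α be real with |α| > 1, let ψ : ℤ → ℂ be rapidly decaying, and set u(β) = (S(β) − 1) ψ(β). Then Σ_β |u(β−1) + u(β+1)|² / S(β) ≤ 4 Σ_β (S(β) − 1) |ψ(β)|². -/
/-- A sequence `ψ : ℤ → ℂ` is rapidly decaying if `Σ_β (1+β²)^k |ψ(β)|² < ∞` for all `k`. -/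
def RapidlyDecayingSeq (ψ : ℤ → ℂ) : Prop :=
  ∀ k : ℕ, Summable (fun β : ℤ => (1 + (β : ℝ) ^ 2) ^ k * ‖ψ β‖ ^ 2)

/-- `u(β) = (S(β) − 1) ψ(β)`. -/
noncomputable def useq (α : ℝ) (ψ : ℤ → ℂ) (β : ℤ) : ℂ := ((Sv α β - 1 : ℝ) : ℂ) * ψ β

theorem Sv_gt_one (α : ℝ) (hα : 1 < |α|) (β : ℤ) : 1 < Sv α β := by
  unfold Sv
  rw [Real.lt_sqrt (by norm_num)]
  have : 1 < α ^ 2 := by rw [← sq_abs]; nlinarith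
  nlinarith [sq_nonneg (β : ℝ)]

theorem Sv_lip (α : ℝ) (hα : 1 < |α|) (β γ : ℤ) (h : ((γ : ℝ) - β) ^ 2 = 1) :
    Sv α γ - 1 ≤ Sv α β := by
  have h1 := Sv_gt_one α hα β
  have h2 : Sv α β ^ 2 = α ^ 2 + (β : ℝ) ^ 2 := Real.sq_sqrt (by positivity)
  have h4 : |(β : ℝ)| ≤ Sv α β := Real.abs_le_sqrt (by nlinarith [sq_nonneg α])
  have h3 : Sv α γ ≤ Sv α β + 1 := by
    conv_lhs => unfold Sv
    rw [Real.sqrt_le_left (by linarith)]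
    have h5 := abs_le.mp h4
    have h6 : (γ : ℝ) - β = 1 ∨ (γ : ℝ) - β = -1 := by simpa using h
    rcases h6 with h6 | h6
    · have : (γ : ℝ) = β + 1 := by linarith
      rw [this]; nlinarith
    · have : (γ : ℝ) = β - 1 := by linarith
      rw [this]; nlinarith
  linarith

theorem useq_sq_le (α : ℝ) (hα : 1 < |α|) (ψ : ℤ → ℂ) (β γ : ℤ) (h : ((γ : ℝ) - β) ^ 2 = 1) :
    ‖useq α ψ γ‖ ^ 2 ≤ (Sv α γ - 1) * ‖ψ γ‖ ^ 2 * Sv α β := by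
  have h1 := Sv_gt_one α hα γ
  have h2 := Sv_lip α hα β γ h
  unfold useq
  rw [norm_mul, Complex.norm_real, mul_pow, Real.norm_eq_abs, sq_abs]
  have : 0 ≤ (Sv α γ - 1) * ‖ψ γ‖ ^ 2 := mul_nonneg (by linarith) (by positivity)
  nlinarith [mul_le_mul_of_nonneg_left h2 this]

theorem B_weighted_bound (α : ℝ) (hα : 1 < |α|) (ψ : ℤ → ℂ) (hψ : RapidlyDecayingSeq ψ) :
    (∑' β : ℤ, ‖useq α ψ (β - 1) + useq α ψ (β + 1)‖ ^ 2 / Sv α β) ≤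
      4 * ∑' β : ℤ, (Sv α β - 1) * ‖ψ β‖ ^ 2 := by
  have hf : Summable (fun β : ℤ => (Sv α β - 1) * ‖ψ β‖ ^ 2) := by
    refine Summable.of_nonneg_of_le (fun β => ?_) (fun β => ?_) ((hψ 1).mul_left (α ^ 2 + 1))
    · exact mul_nonneg (by linarith [Sv_gt_one α hα β]) (by positivity)
    · rw [← mul_assoc]
      apply mul_le_mul_of_nonneg_right _ (by positivity)
      have h1 := Sv_gt_one α hα β
      have h2 : Sv α β ^ 2 = α ^ 2 + (β : ℝ) ^ 2 := Real.sq_sqrt (by positivity)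
      nlinarith [mul_nonneg (sq_nonneg α) (sq_nonneg (β : ℝ))]
  have hm : HasSum (fun β : ℤ => (Sv α (β - 1) - 1) * ‖ψ (β - 1)‖ ^ 2)
      (∑' β : ℤ, (Sv α β - 1) * ‖ψ β‖ ^ 2) :=
    (Equiv.hasSum_iff (f := fun β : ℤ => (Sv α β - 1) * ‖ψ β‖ ^ 2) (Equiv.subRight (1 : ℤ))).mpr
      hf.hasSum
  have hp : HasSum (fun β : ℤ => (Sv α (β + 1) - 1) * ‖ψ (β + 1)‖ ^ 2)
      (∑' β : ℤ, (Sv α β - 1) * ‖ψ β‖ ^ 2) :=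
    (Equiv.hasSum_iff (f := fun β : ℤ => (Sv α β - 1) * ‖ψ β‖ ^ 2) (Equiv.addRight (1 : ℤ))).mpr
      hf.hasSum
  have hs := (hm.add hp).mul_left 2
  have hle : ∀ β : ℤ, ‖useq α ψ (β - 1) + useq α ψ (β + 1)‖ ^ 2 / Sv α β ≤
      2 * ((Sv α (β - 1) - 1) * ‖ψ (β - 1)‖ ^ 2 + (Sv α (β + 1) - 1) * ‖ψ (β + 1)‖ ^ 2) := by
    intro β
    have h1 := Sv_gt_one α hα β
    rw [div_le_iff₀ (by linarith)]
    have ha := useq_sq_le α hα ψ β (β - 1) (by push_cast; ring)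
    have hb := useq_sq_le α hα ψ β (β + 1) (by push_cast; ring)
    have hn := norm_add_le (useq α ψ (β - 1)) (useq α ψ (β + 1))
    have hq := pow_le_pow_left₀ (norm_nonneg _) hn 2
    have hr := sq_nonneg (‖useq α ψ (β - 1)‖ - ‖useq α ψ (β + 1)‖)
    generalize ‖useq α ψ (β - 1)‖ = a at *
    generalize ‖useq α ψ (β + 1)‖ = b at *
    refine hq.trans ?_
    rw [mul_assoc, add_mul]
    have : (a + b) ^ 2 ≤ 2 * (a ^ 2 + b ^ 2) := by linarith [add_sq a b, sub_sq a b]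
    linarith
  have h0 : ∀ β : ℤ, 0 ≤ ‖useq α ψ (β - 1) + useq α ψ (β + 1)‖ ^ 2 / Sv α β := by
    intro β
    have h1 := Sv_gt_one α hα β
    positivity
  have hl := Summable.of_nonneg_of_le h0 hle hs.summable
  have := hl.tsum_le_tsum hle hs.summable
  rw [hs.tsum_eq] at this
  linarith
end

section
/- Let c₀ > 1. There exists a constant c₁ > 0, depending only on c₀, such that for every real α with |α| ≥ c₀ and every rapidly decaying ψ : ℤ → ℂ, one has 𝓔₂(ψ) ≤ c₁ ( |α|^{1/2} Q_A(ψ) + |α|^{1/2} Σ_β (β² / S(β)) |ψ(β)|² ). -/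
/-- `Q_A(ψ) = (1/4) Σ_β |u(β−1) − u(β+1)|²`. -/
noncomputable def QA (α : ℝ) (ψ : ℤ → ℂ) : ℝ :=
  (1 / 4) * ∑' β : ℤ, ‖useq α ψ (β - 1) - useq α ψ (β + 1)‖ ^ 2

/-- `𝓔₂(ψ) = Σ_β (S(β)−1) S(β) |ψ(β)|² − (1/4) Σ_β ((S(β)−1)/S(β)) |u(β−1) + u(β+1)|²`. -/
noncomputable def E2 (α : ℝ) (ψ : ℤ → ℂ) : ℝ :=
  (∑' β : ℤ, (Sv α β - 1) * Sv α β * ‖ψ β‖ ^ 2)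
    - (1 / 4) * ∑' β : ℤ, ((Sv α β - 1) / Sv α β) * ‖useq α ψ (β - 1) + useq α ψ (β + 1)‖ ^ 2

theorem le_of_pow_le_aux {x y : ℝ} (h : x ^ 2 ≤ y ^ 2) (hy : 0 ≤ y) : x ≤ y :=
  (le_abs_self x).trans (abs_le_of_sq_le_sq h hy)

theorem aux_hsq (a b S e : ℝ) (ha : 1 ≤ a) (hS : 0 < S) (hS2 : S ^ 2 = a ^ 2 + b ^ 2)
    (he : e ^ 2 = 1) :
    (a * (b + e) / (a ^ 2 + (b + e) ^ 2)) ^ 2 * S ^ 2 ≤ 32 * a ^ 2 * (b ^ 2 + 1) / S ^ 2 := by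
  have hN : S ^ 2 / 4 ≤ a ^ 2 + (b + e) ^ 2 := by nlinarith [sq_nonneg (b + 2 * e), sq_nonneg b]
  have hN0 : 0 < a ^ 2 + (b + e) ^ 2 := by positivity
  have h1 : (b + e) ^ 2 ≤ 2 * (b ^ 2 + 1) := by nlinarith [sq_nonneg (b - e)]
  rw [div_pow, div_mul_eq_mul_div, div_le_div_iff₀ (by positivity) (by positivity)]
  have h2 : (S ^ 2 / 4) ^ 2 ≤ (a ^ 2 + (b + e) ^ 2) ^ 2 :=
    pow_le_pow_left₀ (by positivity) hN 2
  calc (a * (b + e)) ^ 2 * S ^ 2 * S ^ 2 = 16 * a ^ 2 * (b + e) ^ 2 * (S ^ 2 / 4) ^ 2 := by ring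
    _ ≤ 16 * a ^ 2 * (2 * (b ^ 2 + 1)) * (a ^ 2 + (b + e) ^ 2) ^ 2 := by gcongr
    _ = _ := by ring

theorem aux_cube (a b S : ℝ) (ha : 1 ≤ a) (hS : 0 < S) (hS2 : S ^ 2 = a ^ 2 + b ^ 2) :
    S - 2 * (b ^ 2 / S) ≤ a ^ 3 / S ^ 2 := by
  rw [le_div_iff₀ (by positivity)]
  have e : (S - 2 * (b ^ 2 / S)) * S ^ 2 = S * (a ^ 2 - b ^ 2) := by
    field_simp; nlinarith
  rw [e]
  rcases le_total (a ^ 2) (b ^ 2) with h | h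
  · have : S * (a ^ 2 - b ^ 2) ≤ 0 := mul_nonpos_of_nonneg_of_nonpos hS.le (by linarith)
    have : 0 ≤ a ^ 3 := by positivity
    linarith
  · refine le_of_pow_le_aux ?_ (by positivity)
    have : (S * (a ^ 2 - b ^ 2)) ^ 2 = (a ^ 4 - b ^ 4) * (a ^ 2 - b ^ 2) := by
      rw [mul_pow, hS2]; ring
    rw [this]
    have h4 : b ^ 4 ≤ a ^ 4 := by nlinarith [sq_nonneg a, sq_nonneg b]
    calc (a ^ 4 - b ^ 4) * (a ^ 2 - b ^ 2) ≤ a ^ 4 * a ^ 2 := by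
          apply mul_le_mul <;> nlinarith [sq_nonneg b, sq_nonneg (b^2), sq_nonneg (a^2)]
      _ = _ := by ring

theorem aux_V (a b S w θ : ℝ) (ha : 1 ≤ a) (hS : 0 < S) (hS2 : S ^ 2 = a ^ 2 + b ^ 2)
    (haS : a ≤ S) (hθ : 0 < θ) (hθ1 : θ ≤ 1) (hw : θ * S ≤ w) (hwS : w ≤ S) :
    θ ^ 2 / 2 * S - 33 * (b ^ 2 / S) ≤
      (a * (b + 1) / (a ^ 2 + (b + 1) ^ 2) - a * (b + -1) / (a ^ 2 + (b + -1) ^ 2)) * w ^ 2 := by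
  set M := a ^ 2 + (b + 1) ^ 2 with hM
  set N := a ^ 2 + (b + -1) ^ 2 with hN
  have hM0 : 0 < M := by positivity
  have hN0 : 0 < N := by positivity
  have hM1 : S ^ 2 / 4 ≤ M := by nlinarith [sq_nonneg (b + 2), sq_nonneg b]
  have hN1 : S ^ 2 / 4 ≤ N := by nlinarith [sq_nonneg (b - 2), sq_nonneg b]
  have hP1 : (S ^ 2 / 4) * (S ^ 2 / 4) ≤ M * N := mul_le_mul hM1 hN1 (by positivity) hM0.le
  have hP2 : M * N ≤ 4 * S ^ 4 := by
    have : M * N = (S ^ 2 + 1) ^ 2 - 4 * b ^ 2 := by rw [hM, hN, hS2]; ring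
    have h1 : 1 ≤ S ^ 2 := by nlinarith
    nlinarith [sq_nonneg b]
  have hV : a * (b + 1) / M - a * (b + -1) / N = 2 * a * (a ^ 2 + 1) / (M * N)
      - 2 * a * b ^ 2 / (M * N) := by
    rw [div_sub_div _ _ hM0.ne' hN0.ne', ← sub_div, hM, hN]; congr 1; ring
  have hw0 : 0 ≤ w := le_trans (by positivity) hw
  have hw2 : (θ * S) ^ 2 ≤ w ^ 2 := pow_le_pow_left₀ (by positivity) hw 2
  have hw3 : w ^ 2 ≤ S ^ 2 := pow_le_pow_left₀ hw0 hwS 2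
  have hA : θ ^ 2 / 2 * (a ^ 3 / S ^ 2) ≤ 2 * a * (a ^ 2 + 1) / (M * N) * w ^ 2 := by
    calc θ ^ 2 / 2 * (a ^ 3 / S ^ 2) = 2 * a * a ^ 2 / (4 * S ^ 4) * (θ * S) ^ 2 := by
          field_simp; ring
      _ ≤ 2 * a * (a ^ 2 + 1) / (M * N) * w ^ 2 := by
          gcongr; linarith
  have hB : 2 * a * b ^ 2 / (M * N) * w ^ 2 ≤ 32 * (b ^ 2 / S) := by
    calc 2 * a * b ^ 2 / (M * N) * w ^ 2 ≤ 2 * S * b ^ 2 / ((S ^ 2 / 4) * (S ^ 2 / 4)) * S ^ 2 := by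
          gcongr
      _ = _ := by field_simp; ring
  have hC := aux_cube a b S ha hS hS2
  have hb : 0 ≤ b ^ 2 / S := by positivity
  have hD : θ ^ 2 / 2 * (S - 2 * (b ^ 2 / S)) ≤ θ ^ 2 / 2 * (a ^ 3 / S ^ 2) := by gcongr
  have hE : θ ^ 2 * (b ^ 2 / S) ≤ 1 * (b ^ 2 / S) := by
    gcongr; nlinarith
  rw [hV, sub_mul]
  nlinarith

theorem aux_P (a b S w θ s : ℝ) (ha : 1 ≤ a) (hS : 0 < S) (hS2 : S ^ 2 = a ^ 2 + b ^ 2)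
    (haS : a ≤ S) (hθ : 0 < θ) (hθ1 : θ ≤ 1) (hw : θ * S ≤ w) (hwS : w ≤ S)
    (hs : 1 ≤ s) (hsa : s ^ 2 = a) :
    (((a * (b + -1) / (a ^ 2 + (b + -1) ^ 2)) ^ 2 / (256 / θ ^ 2 * s)
        + a * (b + -1) / (a ^ 2 + (b + -1) ^ 2))
      + ((a * (b + 1) / (a ^ 2 + (b + 1) ^ 2)) ^ 2 / (256 / θ ^ 2 * s)
        - a * (b + 1) / (a ^ 2 + (b + 1) ^ 2))) * w ^ 2 
      ≤ - (θ ^ 2 / 4) * S + 34 * (s * (b ^ 2 / S)) := by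
  have hV := aux_V a b S w θ ha hS hS2 haS hθ hθ1 hw hwS
  have h1 := aux_hsq a b S 1 ha hS hS2 (by norm_num)
  have h2 := aux_hsq a b S (-1) ha hS hS2 (by norm_num)
  set h := a * (b + 1) / (a ^ 2 + (b + 1) ^ 2)
  set k := a * (b + -1) / (a ^ 2 + (b + -1) ^ 2)
  have hw0 : 0 ≤ w := le_trans (by positivity) hw
  have hw3 : w ^ 2 ≤ S ^ 2 := pow_le_pow_left₀ hw0 hwS 2
  have hs0 : 0 < s := by linarith
  have hb : 0 ≤ b ^ 2 / S := by positivity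
  have e1 : (h ^ 2 + k ^ 2) * w ^ 2 ≤ 64 * a ^ 2 * (b ^ 2 + 1) / S ^ 2 := by
    have : (h ^ 2 + k ^ 2) * w ^ 2 ≤ (h ^ 2 + k ^ 2) * S ^ 2 := by gcongr
    have e : 64 * a ^ 2 * (b ^ 2 + 1) / S ^ 2 = 32 * a ^ 2 * (b ^ 2 + 1) / S ^ 2
      + 32 * a ^ 2 * (b ^ 2 + 1) / S ^ 2 := by ring
    rw [e]; linarith
  have e2 : (h ^ 2 + k ^ 2) * w ^ 2 / (256 / θ ^ 2 * s) ≤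
      θ ^ 2 / 4 * (a ^ 2 * (b ^ 2 + 1) / (S ^ 2 * s)) := by
    calc _ ≤ (64 * a ^ 2 * (b ^ 2 + 1) / S ^ 2) / (256 / θ ^ 2 * s) := by gcongr
      _ = _ := by field_simp; ring
  have e3 : a ^ 2 * (b ^ 2 + 1) / (S ^ 2 * s) ≤ s * (b ^ 2 / S) + S := by
    have x1 : a ^ 2 * b ^ 2 / (S ^ 2 * s) ≤ s * (b ^ 2 / S) := by
      calc a ^ 2 * b ^ 2 / (S ^ 2 * s) = a * s ^ 2 * b ^ 2 / (S ^ 2 * s) := by rw [hsa]; ring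
        _ ≤ S * s ^ 2 * b ^ 2 / (S ^ 2 * s) := by gcongr
        _ = _ := by field_simp
    have x2 : a ^ 2 / (S ^ 2 * s) ≤ S := by
      calc a ^ 2 / (S ^ 2 * s) ≤ S ^ 2 / (S ^ 2 * 1) := by gcongr
        _ = 1 := by field_simp
        _ ≤ S := by linarith
    have : a ^ 2 * (b ^ 2 + 1) / (S ^ 2 * s) = a ^ 2 * b ^ 2 / (S ^ 2 * s) + a ^ 2 / (S ^ 2 * s) := by
      ring
    linarith
  have e4 : θ ^ 2 / 4 * (a ^ 2 * (b ^ 2 + 1) / (S ^ 2 * s)) ≤ θ ^ 2 / 4 * (s * (b ^ 2 / S) + S) := by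
    gcongr
  have e5 : θ ^ 2 / 4 * (s * (b ^ 2 / S)) ≤ 1 * (s * (b ^ 2 / S)) := by
    gcongr; nlinarith
  have e6 : 1 * (b ^ 2 / S) ≤ s * (b ^ 2 / S) := by gcongr
  have e7 : (k ^ 2 / (256 / θ ^ 2 * s) + k + (h ^ 2 / (256 / θ ^ 2 * s) - h)) * w ^ 2 
    = (h ^ 2 + k ^ 2) * w ^ 2 / (256 / θ ^ 2 * s) - (h - k) * w ^ 2 := by ring
  rw [e7]; nlinarith

theorem aux_A (x y : ℂ) (h L : ℝ) (hL : 0 < L) :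
    0 ≤ L / 2 * ‖x - y‖ ^ 2 + ((h ^ 2 / L + h) * ‖y‖ ^ 2 + (h ^ 2 / L - h) * ‖x‖ ^ 2) := by
  have h1 : |‖x‖ - ‖y‖| ≤ ‖x - y‖ := abs_norm_sub_norm_le x y
  have h2 : (‖x‖ - ‖y‖) ^ 2 ≤ ‖x - y‖ ^ 2 := by
    rw [← sq_abs]; exact pow_le_pow_left₀ (abs_nonneg _) h1 2
  have h3 : L / 2 * (‖x‖ - ‖y‖) ^ 2 ≤ L / 2 * ‖x - y‖ ^ 2 := by gcongr
  have h4 : L / 2 * (‖x‖ - ‖y‖) ^ 2 + ((h ^ 2 / L + h) * ‖y‖ ^ 2 + (h ^ 2 / L - h) * ‖x‖ ^ 2)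
    = L / 2 * (‖x‖ - ‖y‖ - h / L * (‖x‖ + ‖y‖)) ^ 2 + h ^ 2 / (2 * L) * (‖x‖ - ‖y‖) ^ 2 := by
    field_simp; ring
  have : 0 ≤ L / 2 * (‖x‖ - ‖y‖ - h / L * (‖x‖ + ‖y‖)) ^ 2
    + h ^ 2 / (2 * L) * (‖x‖ - ‖y‖) ^ 2 := by positivity
  linarith

theorem aux_shift (p q U : ℤ → ℝ) (C : ℝ) (hU : Summable U) (hU0 : ∀ β, 0 ≤ U β)
    (hp : ∀ β, |p β| ≤ C) (hq : ∀ β, |q β| ≤ C) :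
    Summable (fun β => p β * U (β + 1) + q β * U (β - 1)) ∧
    Summable (fun β => (p (β - 1) + q (β + 1)) * U β) ∧
    ∑' β, (p β * U (β + 1) + q β * U (β - 1)) = ∑' β, (p (β - 1) + q (β + 1)) * U β := by
  have bd : ∀ (r : ℤ → ℝ), (∀ β, |r β| ≤ C) → Summable (fun β => r β * U β) := by
    intro r hr
    refine Summable.of_norm_bounded (hU.mul_left C) fun β => ?_
    rw [norm_mul, Real.norm_eq_abs, Real.norm_eq_abs, abs_of_nonneg (hU0 β)]
    exact mul_le_mul_of_nonneg_right (hr β) (hU0 β)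
  have s1 := bd (fun β => p (β - 1)) (fun β => hp _)
  have s2 := bd (fun β => q (β + 1)) (fun β => hq _)
  have t1 : HasSum (fun β => p β * U (β + 1)) (∑' β, p (β - 1) * U β) := by
    have := (Equiv.addRight (1 : ℤ)).hasSum_iff.mpr s1.hasSum
    simpa [Function.comp_def] using this
  have t2 : HasSum (fun β => q β * U (β - 1)) (∑' β, q (β + 1) * U β) := by
    have := (Equiv.subRight (1 : ℤ)).hasSum_iff.mpr s2.hasSum
    simpa [Function.comp_def] using this
  have s3 := s1.add s2
  refine ⟨(t1.add t2).summable, ?_, ?_⟩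
  · simpa only [add_mul] using s3
  · rw [(t1.add t2).tsum_eq]
    simp only [add_mul]
    exact (s1.tsum_add s2).symm

set_option maxHeartbeats 2000000 in
theorem E2_upper_bound (c₀ : ℝ) (hc₀ : 1 < c₀) :
    ∃ c₁ : ℝ, 0 < c₁ ∧
      ∀ α : ℝ, c₀ ≤ |α| → ∀ ψ : ℤ → ℂ, RapidlyDecayingSeq ψ →
        E2 α ψ ≤ c₁ * (Real.sqrt |α| * QA α ψ
          + Real.sqrt |α| * ∑' β : ℤ, ((β : ℝ) ^ 2 / Sv α β) * ‖ψ β‖ ^ 2) := by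
  obtain ⟨θ, hθd⟩ : ∃ θ, θ = 1 - 1 / c₀ := ⟨_, rfl⟩
  have hc0 : 0 < c₀ := by linarith
  have hθ : 0 < θ := by
    rw [hθd, sub_pos, div_lt_one hc0]; exact hc₀
  have hθ1 : θ ≤ 1 := by
    rw [hθd]; have : 0 < 1 / c₀ := by positivity
    linarith
  refine ⟨1 + 12 / θ ^ 2 * (512 / θ ^ 2 + 34), by positivity, ?_⟩
  intro α hα ψ hψ
  obtain ⟨a, had⟩ : ∃ a, a = |α| := ⟨_, rfl⟩
  obtain ⟨s, hsd⟩ : ∃ s, s = Real.sqrt |α| := ⟨_, rfl⟩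
  rw [← hsd]
  rw [← had] at hα hsd
  have ha : 1 ≤ a := by linarith
  have hsa : s ^ 2 = a := by rw [hsd]; exact Real.sq_sqrt (by linarith)
  have hs : 1 ≤ s := by rw [hsd]; exact Real.one_le_sqrt.mpr ha
  have hs0 : 0 < s := by linarith
  have hS2 : ∀ β, Sv α β ^ 2 = a ^ 2 + (β : ℝ) ^ 2 := by
    intro β; rw [Sv, Real.sq_sqrt (by positivity), had, sq_abs]
  have haS : ∀ β, a ≤ Sv α β := by
    intro β; refine le_of_pow_le_aux ?_ (Real.sqrt_nonneg _)
    have := hS2 β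
    rw [this]; nlinarith [sq_nonneg (β : ℝ)]
  have hS0 : ∀ β, 0 < Sv α β := fun β => by linarith [haS β]
  have hw : ∀ β, θ * Sv α β ≤ Sv α β - 1 := by
    intro β
    have h1 : 1 / c₀ * Sv α β ≥ 1 / c₀ * c₀ := by
      have := haS β
      gcongr; linarith
    have : 1 / c₀ * c₀ = 1 := by field_simp
    rw [hθd]; nlinarith
  have hw0 : ∀ β, 0 ≤ Sv α β - 1 := fun β => by linarith [haS β]
  -- summability
  have hsum : ∀ g : ℤ → ℝ, (∀ β, 0 ≤ g β) → (∀ β, g β ≤ Sv α β ^ 2) →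
      Summable (fun β => g β * ‖ψ β‖ ^ 2) := by
    intro g hg0 hg
    refine Summable.of_nonneg_of_le (fun β => mul_nonneg (hg0 β) (by positivity)) (fun β => ?_)
      ((hψ 1).mul_left (a ^ 2))
    have : g β ≤ a ^ 2 * (1 + (β : ℝ) ^ 2) ^ 1 := by
      refine (hg β).trans ?_
      rw [hS2]; nlinarith [sq_nonneg (β : ℝ), mul_nonneg (sq_nonneg (β : ℝ)) (by nlinarith : 0 ≤ a ^ 2 - 1)]
    calc g β * ‖ψ β‖ ^ 2 ≤ (a ^ 2 * (1 + (β : ℝ) ^ 2) ^ 1) * ‖ψ β‖ ^ 2 := by gcongr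
      _ = _ := by ring
  have hU : ∀ β, ‖useq α ψ β‖ ^ 2 = (Sv α β - 1) ^ 2 * ‖ψ β‖ ^ 2 := by
    intro β
    rw [useq, norm_mul, mul_pow, Complex.norm_real, Real.norm_eq_abs, sq_abs]
  have sU : Summable (fun β => ‖useq α ψ β‖ ^ 2) := by
    simp only [hU]
    exact hsum _ (fun β => by positivity)
      (fun β => pow_le_pow_left₀ (hw0 β) (by linarith) 2)
  have sT : Summable (fun β => Sv α β * ‖ψ β‖ ^ 2) :=
    hsum _ (fun β => (hS0 β).le) (fun β => by nlinarith [haS β])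
  have sR : Summable (fun β : ℤ => ((β : ℝ) ^ 2 / Sv α β) * ‖ψ β‖ ^ 2) := by
    refine hsum _ (fun β => by have := hS0 β; positivity) (fun β => ?_)
    rw [div_le_iff₀ (hS0 β)]
    have := hS2 β
    have h1 : 1 ≤ Sv α β := by linarith [haS β]
    have h2 : Sv α β ^ 2 * 1 ≤ Sv α β ^ 2 * Sv α β := by gcongr
    nlinarith [sq_nonneg a]
  have sW : Summable (fun β : ℤ => (Sv α β - 1) * Sv α β * ‖ψ β‖ ^ 2) :=
    hsum _ (fun β => mul_nonneg (hw0 β) (hS0 β).le) (fun β => by nlinarith [hS0 β])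
  have sUm : Summable (fun β => ‖useq α ψ (β - 1)‖ ^ 2) := by
    have := (Equiv.subRight (1 : ℤ)).summable_iff.mpr sU
    simpa [Function.comp_def] using this
  have sUp : Summable (fun β => ‖useq α ψ (β + 1)‖ ^ 2) := by
    have := (Equiv.addRight (1 : ℤ)).summable_iff.mpr sU
    simpa [Function.comp_def] using this
  have par : ∀ β, ‖useq α ψ (β - 1) + useq α ψ (β + 1)‖ ^ 2 =
      2 * ‖useq α ψ (β - 1)‖ ^ 2 + 2 * ‖useq α ψ (β + 1)‖ ^ 2
        - ‖useq α ψ (β - 1) - useq α ψ (β + 1)‖ ^ 2 := by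
    intro β
    have := parallelogram_law_with_norm ℝ (useq α ψ (β - 1)) (useq α ψ (β + 1))
    nlinarith
  have sD : Summable (fun β => ‖useq α ψ (β - 1) - useq α ψ (β + 1)‖ ^ 2) := by
    refine Summable.of_nonneg_of_le (fun β => by positivity) (fun β => ?_)
      ((sUm.mul_left 2).add (sUp.mul_left 2))
    have := par β
    have : 0 ≤ ‖useq α ψ (β - 1) + useq α ψ (β + 1)‖ ^ 2 := by positivity
    linarith
  have hg0 : ∀ β, 0 ≤ (Sv α β - 1) / Sv α β := fun β => div_nonneg (hw0 β) (hS0 β).le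
  have hg1 : ∀ β, (Sv α β - 1) / Sv α β ≤ 1 := fun β => by
    rw [div_le_one (hS0 β)]; linarith
  have sP : Summable (fun β => ((Sv α β - 1) / Sv α β) *
      ‖useq α ψ (β - 1) + useq α ψ (β + 1)‖ ^ 2) := by
    refine Summable.of_nonneg_of_le (fun β => mul_nonneg (hg0 β) (by positivity)) (fun β => ?_)
      ((sUm.mul_left 2).add (sUp.mul_left 2))
    have := par β
    have h1 : 0 ≤ ‖useq α ψ (β - 1) - useq α ψ (β + 1)‖ ^ 2 := by positivity
    have h2 : ((Sv α β - 1) / Sv α β) * ‖useq α ψ (β - 1) + useq α ψ (β + 1)‖ ^ 2 ≤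
      1 * ‖useq α ψ (β - 1) + useq α ψ (β + 1)‖ ^ 2 := by
      have := hg1 β
      gcongr
    linarith
  set T := ∑' β, Sv α β * ‖ψ β‖ ^ 2 with hT
  set R := ∑' β : ℤ, ((β : ℝ) ^ 2 / Sv α β) * ‖ψ β‖ ^ 2 with hR
  set D := ∑' β, ‖useq α ψ (β - 1) - useq α ψ (β + 1)‖ ^ 2 with hD
  have hQ : QA α ψ = 1 / 4 * D := rfl
  have hD0 : 0 ≤ D := tsum_nonneg fun β => by positivity
  have hR0 : 0 ≤ R := tsum_nonneg fun β => by have := hS0 β; positivity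
  -- step 1
  have step1 : θ ^ 2 / 4 * T ≤ 256 / θ ^ 2 * s / 2 * D + 34 * s * R := by
    obtain ⟨h, hh⟩ : ∃ h : ℤ → ℝ, ∀ β : ℤ, h β = a * (β : ℝ) / (a ^ 2 + (β : ℝ) ^ 2) :=
      ⟨_, fun _ => rfl⟩
    obtain ⟨L, hL⟩ : ∃ L, L = 256 / θ ^ 2 * s := ⟨_, rfl⟩
    have hL0 : 0 < L := by rw [hL]; positivity
    have hh1 : ∀ β, |h β| ≤ 1 := by
      intro β
      have : 0 < a ^ 2 + (β : ℝ) ^ 2 := by positivity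
      rw [hh, abs_le, le_div_iff₀ this, div_le_one this]
      constructor <;> nlinarith [sq_nonneg (a + β), sq_nonneg (a - β)]
    have hh2 : ∀ β, |h β ^ 2 / L| ≤ 1 / L := by
      intro β
      rw [abs_of_nonneg (by positivity)]
      gcongr
      rw [← sq_abs]; exact pow_le_one₀ (abs_nonneg _) (hh1 β)
    obtain ⟨S1, S2, S3⟩ := aux_shift (fun β => h β ^ 2 / L + h β) (fun β => h β ^ 2 / L - h β)
      (fun β => ‖useq α ψ β‖ ^ 2) (1 / L + 1) sU (fun β => by positivity)
      (fun β => (abs_add_le _ _).trans (add_le_add (hh2 β) (hh1 β)))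
      (fun β => (abs_sub _ _).trans (add_le_add (hh2 β) (hh1 β)))
    have k1 : 0 ≤ L / 2 * D + ∑' β, ((h β ^ 2 / L + h β) * ‖useq α ψ (β + 1)‖ ^ 2
        + (h β ^ 2 / L - h β) * ‖useq α ψ (β - 1)‖ ^ 2) := by
      rw [hD, ← tsum_mul_left, ← (sD.mul_left (L / 2)).tsum_add S1]
      exact tsum_nonneg fun β => aux_A _ _ _ _ hL0
    have k2 : ∑' β, ((h (β - 1) ^ 2 / L + h (β - 1)) + (h (β + 1) ^ 2 / L - h (β + 1)))
        * ‖useq α ψ β‖ ^ 2 ≤ - (θ ^ 2 / 4) * T + 34 * s * R := by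
      rw [hT, hR, ← tsum_mul_left, ← tsum_mul_left,
        ← (sT.mul_left (- (θ ^ 2 / 4))).tsum_add (sR.mul_left (34 * s))]
      refine S2.tsum_le_tsum (fun β => ?_) ((sT.mul_left _).add (sR.mul_left _))
      have := aux_P a β (Sv α β) (Sv α β - 1) θ s ha (hS0 β) (hS2 β) (haS β) hθ hθ1 (hw β)
        (by linarith) hs hsa
      have h2 := mul_le_mul_of_nonneg_right this (by positivity : 0 ≤ ‖ψ β‖ ^ 2)
      rw [hU, hh, hh, hL]
      push_cast
      simp only [sub_eq_add_neg] at h2 ⊢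
      linarith
    have k3 := S3
    rw [k3] at k1
    rw [← hL]
    linarith
  -- step 2
  have step2 : E2 α ψ ≤ 1 / 4 * D + 3 * T := by
    obtain ⟨S1, S2, S3⟩ := aux_shift (fun β => (Sv α β - 1) / Sv α β)
      (fun β => (Sv α β - 1) / Sv α β)
      (fun β => ‖useq α ψ β‖ ^ 2) 1 sU (fun β => by positivity)
      (fun β => by rw [abs_of_nonneg (hg0 β)]; exact hg1 β)
      (fun β => by rw [abs_of_nonneg (hg0 β)]; exact hg1 β)
    have k1 : 1 / 2 * (∑' β, ((Sv α β - 1) / Sv α β * ‖useq α ψ (β + 1)‖ ^ 2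
        + (Sv α β - 1) / Sv α β * ‖useq α ψ (β - 1)‖ ^ 2)) ≤ 
        1 / 4 * D + 1 / 4 * ∑' β, ((Sv α β - 1) / Sv α β) *
          ‖useq α ψ (β - 1) + useq α ψ (β + 1)‖ ^ 2 := by
      rw [hD, ← tsum_mul_left, ← tsum_mul_left, ← tsum_mul_left,
        ← (sD.mul_left _).tsum_add (sP.mul_left _)]
      refine (S1.mul_left _).tsum_le_tsum (fun β => ?_) ((sD.mul_left _).add (sP.mul_left _))
      rw [par β]
      have : ((Sv α β - 1) / Sv α β) * ‖useq α ψ (β - 1) - useq α ψ (β + 1)‖ ^ 2 ≤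
        1 * ‖useq α ψ (β - 1) - useq α ψ (β + 1)‖ ^ 2 := by
        have := hg1 β
        gcongr
      linarith
    have k2 : ∑' β : ℤ, (Sv α β - 1) * Sv α β * ‖ψ β‖ ^ 2 ≤ 3 * T +
        1 / 2 * ∑' β, ((Sv α (β - 1) - 1) / Sv α (β - 1) + (Sv α (β + 1) - 1) / Sv α (β + 1))
          * ‖useq α ψ β‖ ^ 2 := by
      rw [hT, ← tsum_mul_left, ← tsum_mul_left, ← (sT.mul_left _).tsum_add (S2.mul_left _)]
      refine sW.tsum_le_tsum (fun β => ?_) ((sT.mul_left _).add (S2.mul_left _))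
      rw [hU]
      have inv : ∀ γ : ℤ, Sv α β ≤ 2 * Sv α γ →
          1 - 2 / Sv α β ≤ (Sv α γ - 1) / Sv α γ := by
        intro γ hγ
        have e : (Sv α γ - 1) / Sv α γ = 1 - 1 / Sv α γ := by
          have := hS0 γ; field_simp
        have : 1 / Sv α γ ≤ 2 / Sv α β := by
          rw [div_le_div_iff₀ (hS0 γ) (hS0 β)]; linarith
        linarith
      have i1 := inv (β - 1) (by
        refine le_of_pow_le_aux ?_ (by linarith [hS0 (β - 1)])
        rw [mul_pow, hS2, hS2]; push_cast; nlinarith [sq_nonneg ((β : ℝ) - 2), sq_nonneg (β : ℝ)])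
      have i2 := inv (β + 1) (by
        refine le_of_pow_le_aux ?_ (by linarith [hS0 (β + 1)])
        rw [mul_pow, hS2, hS2]; push_cast; nlinarith [sq_nonneg ((β : ℝ) + 2), sq_nonneg (β : ℝ)])
      have i3 : (Sv α β - 1) ^ 2 * (2 * (1 - 2 / Sv α β)) ≤ (Sv α β - 1) ^ 2 *
        ((Sv α (β - 1) - 1) / Sv α (β - 1) + (Sv α (β + 1) - 1) / Sv α (β + 1)) := by
        gcongr; linarith
      have i4 : (Sv α β - 1) * Sv α β ≤ 3 * Sv α β + (Sv α β - 1) ^ 2 * (1 - 2 / Sv α β) := by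
        have hp := hS0 β
        have : (Sv α β - 1) ^ 2 * (1 - 2 / Sv α β) = (Sv α β - 1) ^ 2 - 2 * Sv α β + 4
          - 2 / Sv α β := by field_simp; ring
        have h2 : 2 / Sv α β ≤ 2 := by rw [div_le_iff₀ hp]; linarith [haS β]
        nlinarith
      have i5 : (Sv α β - 1) * Sv α β ≤ 3 * Sv α β + 1 / 2 * ((Sv α β - 1) ^ 2 *
        ((Sv α (β - 1) - 1) / Sv α (β - 1) + (Sv α (β + 1) - 1) / Sv α (β + 1))) := by linarith
      have := mul_le_mul_of_nonneg_right i5 (by positivity : 0 ≤ ‖ψ β‖ ^ 2)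
      linarith
    rw [S3] at k1
    rw [E2]; linarith
  have step3 : T ≤ 4 / θ ^ 2 * (256 / θ ^ 2 * s / 2 * D + 34 * s * R) := by
    calc T = 4 / θ ^ 2 * (θ ^ 2 / 4 * T) := by field_simp
      _ ≤ _ := by gcongr
  rw [hQ]
  have f1 : 1 / 4 * D ≤ s * (1 / 4 * D) := by nlinarith
  have f2 : 0 ≤ s * R := by positivity
  have f3 : 0 ≤ 12 / θ ^ 2 * (512 / θ ^ 2) * (s * R) := by positivity
  have f4 : 0 ≤ 12 / θ ^ 2 * 34 * (s * (1 / 4 * D)) := by positivity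
  calc E2 α ψ ≤ 1 / 4 * D + 3 * T := step2
    _ ≤ s * (1 / 4 * D) + 3 * (4 / θ ^ 2 * (256 / θ ^ 2 * s / 2 * D + 34 * s * R)) := by linarith
    _ = s * (1 / 4 * D) + 12 / θ ^ 2 * (512 / θ ^ 2) * (s * (1 / 4 * D))
        + 12 / θ ^ 2 * 34 * (s * R) := by ring
    _ ≤ _ := by nlinarith
end
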